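/- arXiv:2501.12010 — 18 statements merged into one kernel-verified Lean document; each statement's English description precedes it below -/
import Mathlib

section
/- The function F is continuous on [0,∞), satisfies F(0) = 0, is strictly increasing on [0,∞), and is strictly concave on [0,∞). -/
/-- The values of `f K + g H` over the budget set `K, H ≥ 0`, `p * K + H ≤ S`. -/
def budgetValues (p : ℝ) (f g : ℝ → ℝ) (S : ℝ) : Set ℝ :=
  {y | ∃ K H : ℝ, 0 ≤ K ∧ 0 ≤ H ∧ p * K + H ≤ S ∧ y = f K + g H}

theorem exists_isGreatest_budgetValues {p : ℝ} {f g : ℝ → ℝ} (hp : 0 < p)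
    (hf : ContinuousOn f (Set.Ici 0)) (hg : ContinuousOn g (Set.Ici 0)) {S : ℝ} (hS : 0 ≤ S) :
    ∃ y, IsGreatest (budgetValues p f g S) y := by
  set B : Set (ℝ × ℝ) := {x | 0 ≤ x.1 ∧ 0 ≤ x.2 ∧ p * x.1 + x.2 ≤ S} with hB
  have hclosed : IsClosed B := by
    simp only [hB, Set.ofPred_and]
    exact (isClosed_le continuous_const continuous_fst).inter
      ((isClosed_le continuous_const continuous_snd).inter
        (isClosed_le (by fun_prop) continuous_const))
  have hsub : B ⊆ Set.Icc 0 (S / p) ×ˢ Set.Icc 0 S := by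
    rintro ⟨K, H⟩ ⟨hK, hH, hb⟩
    refine ⟨⟨hK, (le_div_iff₀ hp).2 ?_⟩, hH, ?_⟩
    · simp only at *; linarith
    · have := mul_nonneg hp.le hK
      simp only at *; linarith
  have hcompact : IsCompact B := (isCompact_Icc.prod isCompact_Icc).of_isClosed_subset hclosed hsub
  have hcont : ContinuousOn (fun x : ℝ × ℝ => f x.1 + g x.2) B :=
    (hf.comp continuousOn_fst fun x hx => hx.1).add
      (hg.comp continuousOn_snd fun x hx => hx.2.1)
  obtain ⟨x, hx, hmax⟩ := hcompact.exists_isMaxOn ⟨(0, 0), by simp [hB, hS]⟩ hcont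
  refine ⟨f x.1 + g x.2, ⟨x.1, x.2, hx.1, hx.2.1, hx.2.2, rfl⟩, ?_⟩
  rintro _ ⟨K, H, hK, hH, hb, rfl⟩
  exact hmax (show (K, H) ∈ B from ⟨hK, hH, hb⟩)

section ValueFunction

variable {p : ℝ} {f g V : ℝ → ℝ}

theorem strictMonoOn_of_isGreatest_budgetValues
    (hg : StrictMonoOn g (Set.Ici 0))
    (hV : ∀ S, 0 ≤ S → IsGreatest (budgetValues p f g S) (V S)) :
    StrictMonoOn V (Set.Ici 0) := by
  intro S hS T hT hST
  obtain ⟨K, H, hK, hH, hb, hy⟩ := (hV S hS).1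
  have h := (hV T hT).2 ⟨K, H + (T - S), hK, by linarith, by linarith, rfl⟩
  have := hg (show H ∈ Set.Ici 0 from hH)
    (show H + (T - S) ∈ Set.Ici 0 from by simp only [Set.mem_Ici]; linarith) (by linarith)
  linarith

theorem strictConcaveOn_of_isGreatest_budgetValues
    (hf : StrictConcaveOn ℝ (Set.Ici 0) f) (hg : StrictConcaveOn ℝ (Set.Ici 0) g)
    (hgm : StrictMonoOn g (Set.Ici 0))
    (hV : ∀ S, 0 ≤ S → IsGreatest (budgetValues p f g S) (V S)) :
    StrictConcaveOn ℝ (Set.Ici 0) V := by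
  have hmono := strictMonoOn_of_isGreatest_budgetValues hgm hV
  refine ⟨convex_Ici 0, fun S hS T hT hST a b ha hb hab => ?_⟩
  obtain ⟨K₁, H₁, hK₁, hH₁, hb₁, hy₁⟩ := (hV S hS).1
  obtain ⟨K₂, H₂, hK₂, hH₂, hb₂, hy₂⟩ := (hV T hT).1
  have hmem := (hV (a • S + b • T) (convex_Ici 0 hS hT ha.le hb.le hab)).2
    ⟨a • K₁ + b • K₂, a • H₁ + b • H₂, convex_Ici (0 : ℝ) hK₁ hK₂ ha.le hb.le hab,
      convex_Ici (0 : ℝ) hH₁ hH₂ ha.le hb.le hab, by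
        simp only [smul_eq_mul]
        nlinarith [mul_le_mul_of_nonneg_left hb₁ ha.le, mul_le_mul_of_nonneg_left hb₂ hb.le], rfl⟩
  refine lt_of_lt_of_le ?_ hmem
  have hfle := hf.concaveOn.2 hK₁ hK₂ ha.le hb.le hab
  have hgle := hg.concaveOn.2 hH₁ hH₂ ha.le hb.le hab
  rw [hy₁, hy₂, smul_add, smul_add]
  by_cases hK : K₁ = K₂
  · have hH : H₁ ≠ H₂ := by
      rintro rfl
      subst hK
      exact hST (hmono.injOn hS hT (hy₁.trans hy₂.symm))
    have := hg.2 hH₁ hH₂ hH ha hb hab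
    linarith
  · have := hf.2 hK₁ hK₂ hK ha hb hab
    linarith

theorem continuousOn_of_isGreatest_budgetValues (hp : 0 < p)
    (hfc : ContinuousOn f (Set.Ici 0)) (hgc : ContinuousOn g (Set.Ici 0))
    (hfm : MonotoneOn f (Set.Ici 0)) (hgm : MonotoneOn g (Set.Ici 0))
    (hconc : ConcaveOn ℝ (Set.Ici 0) V)
    (hV : ∀ S, 0 ≤ S → IsGreatest (budgetValues p f g S) (V S)) :
    ContinuousOn V (Set.Ici 0) := by
  have hlower : ∀ S, 0 ≤ S → f 0 + g 0 ≤ V S := fun S hS =>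
    (hV S hS).2 ⟨0, 0, le_rfl, le_rfl, by simpa using hS, rfl⟩
  have hupper : ∀ S, 0 ≤ S → V S ≤ f (S / p) + g S := by
    intro S hS
    obtain ⟨K, H, hK, hH, hb, hy⟩ := (hV S hS).1
    have hpK := mul_nonneg hp.le hK
    rw [hy]
    exact add_le_add (hfm hK (div_nonneg hS hp.le) ((le_div_iff₀ hp).2 (by linarith)))
      (hgm hH hS (by linarith))
  have hzero : V 0 = f 0 + g 0 :=
    le_antisymm (by simpa using hupper 0 le_rfl) (hlower 0 le_rfl)
  have hint : ContinuousOn V (Set.Ioi 0) := by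
    simpa using hconc.continuousOn_interior
  intro S hS
  rcases (show (0 : ℝ) ≤ S from hS).eq_or_lt with rfl | hpos
  · have hbound : ContinuousOn (fun S => f (S / p) + g S) (Set.Ici 0) :=
      (hfc.comp (by fun_prop) fun x hx => div_nonneg hx hp.le).add hgc
    have hlim := hbound 0 hS
    simp only [ContinuousWithinAt, zero_div, ← hzero] at hlim ⊢
    refine tendsto_of_tendsto_of_tendsto_of_le_of_le' tendsto_const_nhds hlim ?_ ?_
    · filter_upwards [self_mem_nhdsWithin] with T hT
      exact hzero ▸ hlower T hT
    · filter_upwards [self_mem_nhdsWithin] with T hT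
      exact hupper T hT
  · exact (hint.continuousAt (Ioi_mem_nhds hpos)).continuousWithinAt

end ValueFunction

theorem strictConcaveOn_const_mul_rpow {A a : ℝ} (hA : 0 < A) (ha : 0 < a) (ha1 : a < 1) :
    StrictConcaveOn ℝ (Set.Ici 0) fun x : ℝ => A * x ^ a := by
  refine ⟨convex_Ici 0, fun x hx y hy hxy s t hs ht hst => ?_⟩
  have := mul_lt_mul_of_pos_left
    ((Real.strictConcaveOn_rpow ha ha1).2 hx hy hxy hs ht hst) hA
  simp only [smul_eq_mul] at this ⊢
  linarith

theorem strictMonoOn_const_mul_rpow {A a : ℝ} (hA : 0 < A) (ha : 0 < a) :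
    StrictMonoOn (fun x : ℝ => A * x ^ a) (Set.Ici 0) := fun _ hx _ _ hxy =>
  mul_lt_mul_of_pos_left (Real.rpow_lt_rpow hx hxy ha) hA

theorem continuous_const_mul_rpow (A : ℝ) {a : ℝ} (ha : 0 ≤ a) :
    Continuous fun x : ℝ => A * x ^ a :=
  continuous_const.mul (Real.continuous_rpow_const ha)

/-- F(S) = max { A_c·K^α + w·A_h·H^{α_h} : K, H ≥ 0, p·K + H ≤ S }
is continuous on [0,∞), F(0) = 0, strictly increasing on [0,∞), and strictly
concave on [0,∞). -/
theorem stmt1 (p Ac w Ah al ah : ℝ)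
    (hp : 0 < p) (hAc : 0 < Ac) (hw : 0 < w) (hAh : 0 < Ah)
    (hal : 0 < al) (hal1 : al < 1) (hah : 0 < ah) (hah1 : ah < 1)
    (F : ℝ → ℝ)
    (hF : ∀ S : ℝ, F S = sSup {y : ℝ | ∃ K H : ℝ,
      0 ≤ K ∧ 0 ≤ H ∧ p * K + H ≤ S ∧ y = Ac * K ^ al + w * Ah * H ^ ah}) :
    ContinuousOn F (Set.Ici 0) ∧ F 0 = 0 ∧ StrictMonoOn F (Set.Ici 0) ∧
      StrictConcaveOn ℝ (Set.Ici 0) F := by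
  have hwA : 0 < w * Ah := mul_pos hw hAh
  have hfc := (continuous_const_mul_rpow Ac hal.le).continuousOn (s := Set.Ici 0)
  have hgc := (continuous_const_mul_rpow (w * Ah) hah.le).continuousOn (s := Set.Ici 0)
  have hfm := strictMonoOn_const_mul_rpow hAc hal
  have hgm := strictMonoOn_const_mul_rpow hwA hah
  have hV : ∀ S, 0 ≤ S → IsGreatest
      (budgetValues p (fun x => Ac * x ^ al) (fun x => w * Ah * x ^ ah) S) (F S) := by
    intro S hS
    obtain ⟨y, hy⟩ := exists_isGreatest_budgetValues hp hfc hgc hS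
    have : F S = y := (hF S).trans hy.csSup_eq
    exact this ▸ hy
  have hconc := strictConcaveOn_of_isGreatest_budgetValues
    (strictConcaveOn_const_mul_rpow hAc hal hal1)
    (strictConcaveOn_const_mul_rpow hwA hah hah1) hgm hV
  refine ⟨continuousOn_of_isGreatest_budgetValues hp hfc hgc hfm.monotoneOn hgm.monotoneOn
    hconc.concaveOn hV, ?_, strictMonoOn_of_isGreatest_budgetValues hgm hV, hconc⟩
  obtain ⟨K, H, hK, hH, hb, hy⟩ := (hV 0 le_rfl).1
  have hpK := mul_nonneg hp.le hK
  obtain rfl : H = 0 := by linarith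
  obtain rfl : K = 0 := by nlinarith
  simpa [Real.zero_rpow hal.ne', Real.zero_rpow hah.ne'] using hy
end

section
/- If α_h = α, then for every S ≥ 0 one has F(S) = A·S^α, where A := ((A_c/p^α)^{1/(1−α)} + (w·A_h)^{1/(1−α)})^{1−α}. -/
/-- Two-term Hölder inequality in geometric-mean form. -/
theorem rpow_mul_rpow_add_le {a b x y t : ℝ} (ha : 0 < a) (hb : 0 < b) (hx : 0 ≤ x) (hy : 0 ≤ y)
    (ht : 0 < t) (ht1 : t < 1) :
    a ^ (1 - t) * x ^ t + b ^ (1 - t) * y ^ t ≤ (a + b) ^ (1 - t) * (x + y) ^ t := by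
  rcases (add_nonneg hx hy).eq_or_lt with h | h
  · obtain rfl : x = 0 := by linarith
    obtain rfl : y = 0 := by linarith
    simp [Real.zero_rpow ht.ne']
  have hab : 0 < a + b := by positivity
  have h₁ := Real.geom_mean_le_arith_mean2_weighted (by linarith : 0 ≤ 1 - t) ht.le
    (by positivity : 0 ≤ a / (a + b)) (by positivity : 0 ≤ x / (x + y)) (by ring)
  have h₂ := Real.geom_mean_le_arith_mean2_weighted (by linarith : 0 ≤ 1 - t) ht.le
    (by positivity : 0 ≤ b / (a + b)) (by positivity : 0 ≤ y / (x + y)) (by ring)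
  have hsum : (1 - t) * (a / (a + b)) + t * (x / (x + y)) +
      ((1 - t) * (b / (a + b)) + t * (y / (x + y))) = 1 := by
    field_simp
    ring
  rw [Real.div_rpow ha.le hab.le, Real.div_rpow hx h.le, div_mul_div_comm] at h₁
  rw [Real.div_rpow hb.le hab.le, Real.div_rpow hy h.le, div_mul_div_comm] at h₂
  rw [← div_le_one (by positivity), add_div]
  linarith

/-- The bound of `rpow_mul_rpow_add_le` is attained when the total `S` is split in
proportion to the weights. -/
theorem rpow_mul_rpow_add_eq {a b S t : ℝ} (ha : 0 < a) (hb : 0 < b) (hS : 0 ≤ S) :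
    a ^ (1 - t) * (a * (S / (a + b))) ^ t + b ^ (1 - t) * (b * (S / (a + b))) ^ t =
      (a + b) ^ (1 - t) * S ^ t := by
  have hab : 0 < a + b := by positivity
  have key : ∀ c : ℝ, 0 < c → c ^ (1 - t) * c ^ t = c := fun c hc ↦ by
    rw [← Real.rpow_add hc, sub_add_cancel, Real.rpow_one]
  have hq : 0 ≤ S / (a + b) := by positivity
  have hS' : S ^ t = (a + b) ^ t * (S / (a + b)) ^ t := by
    rw [← Real.mul_rpow hab.le hq, mul_div_cancel₀ _ hab.ne']
  rw [hS', Real.mul_rpow ha.le hq, Real.mul_rpow hb.le hq, ← mul_assoc, ← mul_assoc, ← mul_assoc,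
    key a ha, key b hb, key _ hab, add_mul]

/-- If α_h = α then F(S) = A·S^α for every S ≥ 0, where
A = ((A_c/p^α)^{1/(1−α)} + (w·A_h)^{1/(1−α)})^{1−α}. -/
theorem stmt2 (p Ac w Ah al ah : ℝ)
    (hp : 0 < p) (hAc : 0 < Ac) (hw : 0 < w) (hAh : 0 < Ah)
    (hal : 0 < al) (hal1 : al < 1) (hah : 0 < ah) (hah1 : ah < 1)
    (F : ℝ → ℝ)
    (hF : ∀ S : ℝ, F S = sSup {y : ℝ | ∃ K H : ℝ,
      0 ≤ K ∧ 0 ≤ H ∧ p * K + H ≤ S ∧ y = Ac * K ^ al + w * Ah * H ^ ah})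
    (heq : ah = al) :
    ∀ S : ℝ, 0 ≤ S →
      F S = ((Ac / p ^ al) ^ (1 / (1 - al)) + (w * Ah) ^ (1 / (1 - al))) ^ (1 - al)
        * S ^ al := by
  intro S hS
  subst heq
  have h1 : 1 - ah ≠ 0 := by linarith
  have ha : 0 < (Ac / p ^ ah) ^ (1 / (1 - ah)) := by positivity
  have hb : 0 < (w * Ah) ^ (1 / (1 - ah)) := by positivity
  have hA : ((Ac / p ^ ah) ^ (1 / (1 - ah))) ^ (1 - ah) = Ac / p ^ ah := by
    rw [one_div, Real.rpow_inv_rpow (by positivity) h1]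
  have hB : ((w * Ah) ^ (1 / (1 - ah))) ^ (1 - ah) = w * Ah := by
    rw [one_div, Real.rpow_inv_rpow (by positivity) h1]
  generalize (Ac / p ^ ah) ^ (1 / (1 - ah)) = a at *
  generalize (w * Ah) ^ (1 / (1 - ah)) = b at *
  have hval : ∀ K H : ℝ, 0 ≤ K → Ac * K ^ ah + w * Ah * H ^ ah =
      a ^ (1 - ah) * (p * K) ^ ah + b ^ (1 - ah) * H ^ ah := fun K H hK ↦ by
    have hpa : p ^ ah ≠ 0 := by positivity
    rw [hA, hB, Real.mul_rpow hp.le hK]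
    field_simp
  rw [hF]
  refine IsGreatest.csSup_eq ⟨⟨a * (S / (a + b)) / p, b * (S / (a + b)), by positivity,
    by positivity, ?_, ?_⟩, ?_⟩
  · apply le_of_eq
    field_simp
  · rw [hval _ _ (by positivity), mul_div_cancel₀ _ hp.ne', rpow_mul_rpow_add_eq ha hb hS]
  · rintro _ ⟨K, H, hK, hH, hKH, rfl⟩
    rw [hval K H hK]
    have hpK : 0 ≤ p * K := by positivity
    refine (rpow_mul_rpow_add_le ha hb hpK hH hah hah1).trans ?_
    gcongr
end

section
/- Let S > 0 with b·S^σ ≤ x̄. Then every maximizer (K, N, H) of the problem defining G(S) satisfies N = 0, and consequently G(S) = F(S). -/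
/-- If S > 0 and b·S^σ ≤ x̄, then every maximizer (K, N, H) of the
problem defining G(S) satisfies N = 0, and consequently G(S) = F(S). -/
theorem stmt3 (p Ac w Ah a b xbar al ah sg : ℝ)
    (hp : 0 < p) (hAc : 0 < Ac) (hw : 0 < w) (hAh : 0 < Ah)
    (ha : 0 < a) (hb : 0 < b) (hxbar : 0 < xbar)
    (hal : 0 < al) (hal1 : al < 1) (hah : 0 < ah) (hah1 : ah < 1)
    (hsg : 0 < sg) (hsg1 : sg < 1)
    (F G : ℝ → ℝ)
    (hF : ∀ S : ℝ, F S = sSup {y : ℝ | ∃ K H : ℝ,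
      0 ≤ K ∧ 0 ≤ H ∧ p * K + H ≤ S ∧ y = Ac * K ^ al + w * Ah * H ^ ah})
    (hG : ∀ S : ℝ, G S = sSup {y : ℝ | ∃ K N H : ℝ,
      0 ≤ K ∧ 0 ≤ N ∧ 0 ≤ H ∧ p * K + N + H ≤ S ∧
      y = (Ac + a * max (b * N ^ sg - xbar) 0) * K ^ al + w * Ah * H ^ ah})
    (S : ℝ) (hS : 0 < S) (hcond : b * S ^ sg ≤ xbar) :
    (∀ K N H : ℝ, 0 ≤ K → 0 ≤ N → 0 ≤ H → p * K + N + H ≤ S →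
      (Ac + a * max (b * N ^ sg - xbar) 0) * K ^ al + w * Ah * H ^ ah = G S →
      N = 0) ∧ G S = F S := by
  have hmax : ∀ N : ℝ, 0 ≤ N → N ≤ S → max (b * N ^ sg - xbar) 0 = 0 := by
    intro N hN hNS
    have hpow : b * N ^ sg ≤ b * S ^ sg := by gcongr
    exact max_eq_right (by linarith)
  have hGF : G S = F S := by
    rw [hG, hF]
    congr 1
    ext y
    constructor
    · rintro ⟨K, N, H, hK, hN, hH, hbudget, rfl⟩
      have hpK : 0 ≤ p * K := by positivity
      refine ⟨K, H, hK, hH, by linarith, ?_⟩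
      rw [hmax N hN (by linarith), mul_zero, add_zero]
    · rintro ⟨K, H, hK, hH, hbudget, rfl⟩
      refine ⟨K, 0, H, hK, le_rfl, hH, by linarith, ?_⟩
      rw [hmax 0 le_rfl hS.le, mul_zero, add_zero]
  refine ⟨fun K N H hK hN hH hbudget hval => ?_, hGF⟩
  have hpK : 0 ≤ p * K := by positivity
  rw [hmax N hN (by linarith), mul_zero, add_zero, hGF, hF] at hval
  by_contra hN0
  have hNpos : 0 < N := lt_of_le_of_ne hN (Ne.symm hN0)
  have hbdd : BddAbove {y : ℝ | ∃ K H : ℝ,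
      0 ≤ K ∧ 0 ≤ H ∧ p * K + H ≤ S ∧ y = Ac * K ^ al + w * Ah * H ^ ah} := by
    refine ⟨Ac * (S / p) ^ al + w * Ah * S ^ ah, ?_⟩
    rintro y ⟨K, H, hK, hH, hbudget, rfl⟩
    have hpK : 0 ≤ p * K := by positivity
    have hKS : K ≤ S / p := by
      rw [le_div_iff₀ hp]
      linarith
    have hHS : H ≤ S := by linarith
    gcongr
  have hle := le_csSup hbdd ⟨K, H + N, hK, by linarith, by linarith, rfl⟩
  have hlt : w * Ah * H ^ ah < w * Ah * (H + N) ^ ah :=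
    mul_lt_mul_of_pos_left (Real.rpow_lt_rpow hH (by linarith) hah) (by positivity)
  linarith
end

section
/- Let S > 0 with b·S^σ > x̄, and suppose that [A_c + a·((b^{1/σ}·S/2 + x̄^{1/σ}/2)^σ − x̄)]·(1/p^α)·(S/2 − x̄^{1/σ}/(2·b^{1/σ}))^α > F(S). Then every maximizer (K, N, H) of the problem defining G(S) satisfies N > 0. -/
/-- If S > 0, b·S^σ > x̄ and
[A_c + a·((b^{1/σ}·S/2 + x̄^{1/σ}/2)^σ − x̄)]·(1/p^α)·(S/2 − x̄^{1/σ}/(2·b^{1/σ}))^α > F(S),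
then every maximizer (K, N, H) of the problem defining G(S) satisfies N > 0. -/
theorem stmt4 (p Ac w Ah a b xbar al ah sg : ℝ)
    (hp : 0 < p) (hAc : 0 < Ac) (hw : 0 < w) (hAh : 0 < Ah)
    (ha : 0 < a) (hb : 0 < b) (hxbar : 0 < xbar)
    (hal : 0 < al) (hal1 : al < 1) (hah : 0 < ah) (hah1 : ah < 1)
    (hsg : 0 < sg) (hsg1 : sg < 1)
    (F G : ℝ → ℝ)
    (hF : ∀ S : ℝ, F S = sSup {y : ℝ | ∃ K H : ℝ,
      0 ≤ K ∧ 0 ≤ H ∧ p * K + H ≤ S ∧ y = Ac * K ^ al + w * Ah * H ^ ah})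
    (hG : ∀ S : ℝ, G S = sSup {y : ℝ | ∃ K N H : ℝ,
      0 ≤ K ∧ 0 ≤ N ∧ 0 ≤ H ∧ p * K + N + H ≤ S ∧
      y = (Ac + a * max (b * N ^ sg - xbar) 0) * K ^ al + w * Ah * H ^ ah})
    (S : ℝ) (hS : 0 < S) (hcond : b * S ^ sg > xbar)
    (hval : (Ac + a * ((b ^ (1 / sg) * S / 2 + xbar ^ (1 / sg) / 2) ^ sg - xbar))
        * (1 / p ^ al) * (S / 2 - xbar ^ (1 / sg) / (2 * b ^ (1 / sg))) ^ al
        > F S) :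
    ∀ K N H : ℝ, 0 ≤ K → 0 ≤ N → 0 ≤ H → p * K + N + H ≤ S →
      (Ac + a * max (b * N ^ sg - xbar) 0) * K ^ al + w * Ah * H ^ ah = G S →
      0 < N := by
  intro K N H hK hN hH hbudget hmax
  have hwAh : 0 ≤ w * Ah := (mul_pos hw hAh).le
  refine hN.lt_of_ne fun hN0 => ?_
  subst hN0
  -- Without investment in `N` the value is at most `F S`.
  have hle_F : G S ≤ F S := by
    rw [← hmax, hF S]
    refine le_csSup ⟨Ac * (S / p) ^ al + w * Ah * S ^ ah, ?_⟩
      ⟨K, H, hK, hH, by linarith, ?_⟩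
    · rintro y ⟨K', H', hK', hH', hbudget', rfl⟩
      have hK'S : K' ≤ S / p := by
        rw [le_div_iff₀ hp]
        linarith
      have hH'S : H' ≤ S := by linarith [mul_nonneg hp.le hK']
      gcongr
    · rw [Real.zero_rpow hsg.ne', max_eq_right (by linarith)]
      ring
  -- The allocation with `N` halfway between its activation level and `S`, and `H = 0`, beats `F S`.
  have hlt_G : F S < G S := by
    have hBpos : 0 < b ^ (1 / sg) := Real.rpow_pos_of_pos hb _
    have hXpos : 0 < xbar ^ (1 / sg) := Real.rpow_pos_of_pos hxbar _
    have hBsg : (b ^ (1 / sg)) ^ sg = b := by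
      rw [← Real.rpow_mul hb.le, one_div_mul_cancel hsg.ne', Real.rpow_one]
    have hXsg : (xbar ^ (1 / sg)) ^ sg = xbar := by
      rw [← Real.rpow_mul hxbar.le, one_div_mul_cancel hsg.ne', Real.rpow_one]
    set B := b ^ (1 / sg)
    set X := xbar ^ (1 / sg)
    have hXB : X < B * S := by
      rw [← Real.rpow_lt_rpow_iff hXpos.le (mul_pos hBpos hS).le hsg,
        Real.mul_rpow hBpos.le hS.le, hXsg, hBsg]
      exact hcond
    have hrest : 0 ≤ S / 2 - X / (2 * B) := by
      rw [sub_nonneg, div_le_div_iff₀ (by positivity) two_pos]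
      linarith
    have hNval : b * (S / 2 + X / (2 * B)) ^ sg = (B * S / 2 + X / 2) ^ sg := by
      rw [← hBsg, ← Real.mul_rpow hBpos.le (by positivity)]
      congr 1
      field_simp
    rw [hG S]
    refine hval.trans_le (le_trans ?_ (le_csSup
      ⟨(Ac + a * max (b * S ^ sg - xbar) 0) * (S / p) ^ al + w * Ah * S ^ ah, ?_⟩
      ⟨(S / 2 - X / (2 * B)) / p, S / 2 + X / (2 * B), 0, by positivity, by positivity,
        le_rfl, ?_, rfl⟩))
    · rw [Real.zero_rpow hah.ne', mul_zero, add_zero, hNval, Real.div_rpow hrest hp.le,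
        mul_assoc, one_div_mul_eq_div]
      gcongr
      exact le_max_left _ _
    · rintro y ⟨K', N', H', hK', hN', hH', hbudget', rfl⟩
      have hpK' := mul_nonneg hp.le hK'
      have hK'S : K' ≤ S / p := by
        rw [le_div_iff₀ hp]
        linarith
      have hN'S : N' ≤ S := by linarith
      have hH'S : H' ≤ S := by linarith
      gcongr
    · rw [mul_div_cancel₀ _ hp.ne']
      linarith
  exact hle_F.not_gt hlt_G
end

section
/- Assume a·x̄ > A_c and α + σ ≥ 1. Then there exists a unique S* > 0 such that: (i) G(S) = F(S) for every S with 0 ≤ S ≤ S*, and (ii) for every S > S*, G(S) > F(S) and every maximizer (K, N, H) of the problem defining G(S) satisfies N > 0. -/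
open Filter Topology

/-- A concave function on the half-line has decreasing increments. -/
theorem ConcaveOn.add_le_add_of_shift {h : ℝ → ℝ} (hh : ConcaveOn ℝ (Set.Ici 0) h)
    {x y d : ℝ} (hx : 0 ≤ x) (hxy : x ≤ y) (hd : 0 ≤ d) :
    h x + h (y + d) ≤ h (x + d) + h y := by
  rcases eq_or_lt_of_le (show x ≤ y + d by linarith) with e | hlt
  · have h1 : y = x := by linarith
    have h2 : d = 0 := by linarith
    simp [h1, h2]
  have hpos : 0 < y + d - x := by linarith
  have hu0 : 0 ≤ d / (y + d - x) := by positivity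
  have hv0 : 0 ≤ (y - x) / (y + d - x) := div_nonneg (by linarith) hpos.le
  have hsum : d / (y + d - x) + (y - x) / (y + d - x) = 1 := by
    field_simp
    ring
  have hmem : y + d ∈ Set.Ici (0 : ℝ) := by
    simp only [Set.mem_Ici]
    linarith
  have h1 := hh.2 (x := y + d) (y := x) hmem hx hu0 hv0 hsum
  have h2 := hh.2 (x := x) (y := y + d) hx hmem hu0 hv0 hsum
  simp only [smul_eq_mul] at h1 h2
  have e1 : d / (y + d - x) * (y + d) + (y - x) / (y + d - x) * x = x + d := by
    field_simp
    ring
  have e2 : d / (y + d - x) * x + (y - x) / (y + d - x) * (y + d) = y := by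
    field_simp
    ring
  rw [e1] at h1
  rw [e2] at h2
  have h3 : h x + h (y + d) =
      (d / (y + d - x) + (y - x) / (y + d - x)) * (h x + h (y + d)) := by
    rw [hsum, one_mul]
  linarith

/-- The two-good problem without adoption attains its maximum. -/
theorem exists_isMax_two_goods {p A B al ah S : ℝ} (hp : 0 < p) (hal : 0 < al) (hah : 0 < ah)
    (hS : 0 ≤ S) :
    ∃ K H : ℝ, 0 ≤ K ∧ 0 ≤ H ∧ p * K + H ≤ S ∧ ∀ K' H' : ℝ, 0 ≤ K' → 0 ≤ H' →
      p * K' + H' ≤ S → A * K' ^ al + B * H' ^ ah ≤ A * K ^ al + B * H ^ ah := by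
  have hclosed : IsClosed {x : ℝ × ℝ | 0 ≤ x.1 ∧ 0 ≤ x.2 ∧ p * x.1 + x.2 ≤ S} := by
    refine IsClosed.and ?_ (IsClosed.and ?_ ?_) <;>
      exact isClosed_le (by fun_prop) (by fun_prop)
  have hcompact : IsCompact {x : ℝ × ℝ | 0 ≤ x.1 ∧ 0 ≤ x.2 ∧ p * x.1 + x.2 ≤ S} := by
    refine (isCompact_Icc (a := ((0 : ℝ), (0 : ℝ))) (b := (S / p, S))).of_isClosed_subset
      hclosed ?_
    rintro ⟨K, H⟩ ⟨hK, hH, hb⟩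
    simp only at hK hH hb
    refine ⟨⟨hK, hH⟩, ?_, ?_⟩
    · change K ≤ S / p
      rw [le_div_iff₀ hp]
      linarith
    · change H ≤ S
      nlinarith
  have hcont : Continuous fun x : ℝ × ℝ => A * x.1 ^ al + B * x.2 ^ ah :=
    (continuous_const.mul (continuous_fst.rpow_const fun _ => Or.inr hal.le)).add
      (continuous_const.mul (continuous_snd.rpow_const fun _ => Or.inr hah.le))
  obtain ⟨⟨K, H⟩, ⟨hK, hH, hb⟩, hmax⟩ :=
    hcompact.exists_isMaxOn ⟨(0, 0), by simp [hS]⟩ hcont.continuousOn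
  exact ⟨K, H, hK, hH, hb, fun K' H' hK' hH' hb' => hmax (a := (K', H')) ⟨hK', hH', hb'⟩⟩

/-- If some adoption plan beats every non-adoption plan with budget `S₀`, then the same holds for
every larger budget. -/
theorem exists_adoption_gt_of_le {p Ac B a b xbar al ah sg S₀ S K₀ N₀ H₀ : ℝ} (hp : 0 < p)
    (hAc : 0 < Ac) (hB : 0 < B) (ha : 0 < a) (hb : 0 < b) (hal : 0 < al) (hah : 0 < ah)
    (hah1 : ah < 1) (hsg : 0 < sg) (hK₀ : 0 ≤ K₀) (hN₀ : 0 ≤ N₀) (hH₀ : 0 ≤ H₀)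
    (hS₀ : p * K₀ + N₀ + H₀ ≤ S₀) (hS : S₀ ≤ S)
    (hbeat : ∀ K H : ℝ, 0 ≤ K → 0 ≤ H → p * K + H ≤ S₀ → Ac * K ^ al + B * H ^ ah <
      (Ac + a * max (b * N₀ ^ sg - xbar) 0) * K₀ ^ al + B * H₀ ^ ah)
    {K' H' : ℝ} (hK' : 0 ≤ K') (hH' : 0 ≤ H') (hb' : p * K' + H' ≤ S) :
    ∃ K N H : ℝ, 0 ≤ K ∧ 0 ≤ N ∧ 0 ≤ H ∧ p * K + N + H ≤ S ∧ Ac * K' ^ al + B * H' ^ ah <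
      (Ac + a * max (b * N ^ sg - xbar) 0) * K ^ al + B * H ^ ah := by
  have hM0 : 0 ≤ p * K₀ + N₀ := by positivity
  rcases le_total (p * K₀ + N₀) (p * K') with hle | hle
  · -- Non-adoption spends at least as much on production: scale up the production plan.
    have hgain := hbeat ((p * K₀ + N₀) / p) H₀ (by positivity) hH₀ (by
      rw [mul_div_cancel₀ _ hp.ne']
      exact hS₀)
    have hgain' : Ac * ((p * K₀ + N₀) / p) ^ al <
        (Ac + a * max (b * N₀ ^ sg - xbar) 0) * K₀ ^ al := by linarith
    have hK₀pos : 0 < K₀ := by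
      rcases hK₀.eq_or_lt with e | h
      · have : 0 ≤ Ac * ((p * K₀ + N₀) / p) ^ al := by positivity
        have hpow : K₀ ^ al = 0 := by rw [← e, Real.zero_rpow hal.ne']
        rw [hpow, mul_zero] at hgain'
        linarith
      · exact h
    have hMpos : 0 < p * K₀ + N₀ := by positivity
    obtain ⟨r, hr⟩ : ∃ r, r = p * K' / (p * K₀ + N₀) := ⟨_, rfl⟩
    have hr1 : 1 ≤ r := by
      rw [hr, one_le_div hMpos]
      exact hle
    have hr0 : 0 < r := by linarith
    have hrM : r * (p * K₀ + N₀) = p * K' := by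
      rw [hr]
      field_simp
    refine ⟨r * K₀, r * N₀, H', by positivity, by positivity, hH', by nlinarith, ?_⟩
    have hK'eq : K' = r * ((p * K₀ + N₀) / p) := by
      rw [← mul_div_assoc, hrM]
      field_simp
    rw [hK'eq, Real.mul_rpow hr0.le (by positivity), Real.mul_rpow hr0.le hK₀]
    have hNmono : N₀ ^ sg ≤ (r * N₀) ^ sg :=
      Real.rpow_le_rpow hN₀ (by nlinarith) hsg.le
    have hfac : Ac + a * max (b * N₀ ^ sg - xbar) 0 ≤
        Ac + a * max (b * (r * N₀) ^ sg - xbar) 0 := by gcongr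
    have hrpos : 0 < r ^ al := Real.rpow_pos_of_pos hr0 _
    have hKpow : 0 ≤ K₀ ^ al := by positivity
    have h1 := mul_lt_mul_of_pos_left hgain' hrpos
    have h2 := mul_le_mul_of_nonneg_right hfac (mul_nonneg hrpos.le hKpow)
    linarith
  · -- Otherwise keep the production plan and spend the extra budget on the other good.
    have hconc : ConcaveOn ℝ (Set.Ici 0) fun x : ℝ => x ^ ah :=
      Real.concaveOn_rpow hah.le hah1.le
    have hshift := hconc.add_le_add_of_shift (x := S₀ - (p * K₀ + N₀)) (y := S₀ - p * K')
      (d := S - S₀) (by linarith) (by linarith) (by linarith)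
    have hcmp := hbeat K' (S₀ - p * K') hK' (by linarith) (by linarith)
    refine ⟨K₀, N₀, S₀ - (p * K₀ + N₀) + (S - S₀), hK₀, hN₀, by linarith, by linarith, ?_⟩
    have m1 : H' ^ ah ≤ (S₀ - p * K' + (S - S₀)) ^ ah :=
      Real.rpow_le_rpow hH' (by linarith) hah.le
    have m2 : H₀ ^ ah ≤ (S₀ - (p * K₀ + N₀)) ^ ah :=
      Real.rpow_le_rpow hH₀ (by linarith) hah.le
    have := mul_le_mul_of_nonneg_left hshift hB.le
    have := mul_le_mul_of_nonneg_left m1 hB.le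
    have := mul_le_mul_of_nonneg_left m2 hB.le
    linarith

/-- For a large enough budget adoption beats an upper bound for every non-adoption plan. -/
theorem exists_budget_adoption_gt {p Ac B a b xbar al ah sg : ℝ} (hp : 0 < p)
    (ha : 0 < a) (hb : 0 < b) (hsg : 0 < sg) (hah : ah < al + sg) :
    ∃ t : ℝ, 0 < t ∧ Ac * (2 * t / p) ^ al + B * (2 * t) ^ ah <
      (Ac + a * (b * t ^ sg - xbar)) * (t / p) ^ al := by
  have hlim : Tendsto (fun t : ℝ => (Ac * (2 / p) ^ al - (Ac - a * xbar) * (1 / p) ^ al) *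
      t ^ (-sg) + B * 2 ^ ah * t ^ (-(al + sg - ah))) atTop (𝓝 0) := by
    have := ((tendsto_rpow_neg_atTop hsg).const_mul
      (Ac * (2 / p) ^ al - (Ac - a * xbar) * (1 / p) ^ al)).add
      ((tendsto_rpow_neg_atTop (show 0 < al + sg - ah by linarith)).const_mul (B * 2 ^ ah))
    simpa using this
  have hpos : 0 < a * b * (1 / p) ^ al := by positivity
  obtain ⟨t, hlt, ht⟩ := ((hlim.eventually_lt_const hpos).and (eventually_gt_atTop 0)).exists
  refine ⟨t, ht, ?_⟩
  have hscale := mul_lt_mul_of_pos_right hlt (Real.rpow_pos_of_pos ht (al + sg))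
  have e1 : t ^ (-sg) * t ^ (al + sg) = t ^ al := by
    rw [← Real.rpow_add ht]
    congr 1
    ring
  have e2 : t ^ (-(al + sg - ah)) * t ^ (al + sg) = t ^ ah := by
    rw [← Real.rpow_add ht]
    congr 1
    ring
  have e3 : (2 * t / p) ^ al = (2 / p) ^ al * t ^ al := by
    rw [← Real.mul_rpow (by positivity) ht.le]
    congr 1
    ring
  have e4 : (t / p) ^ al = (1 / p) ^ al * t ^ al := by
    rw [← Real.mul_rpow (by positivity) ht.le]
    congr 1
    ring
  rw [e3, e4, Real.mul_rpow two_pos.le ht.le]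
  rw [add_mul, mul_assoc _ (t ^ (-sg)), mul_assoc _ (t ^ (-(al + sg - ah))), e1, e2,
    Real.rpow_add ht] at hscale
  linarith

/-- If a·x̄ > A_c and α + σ ≥ 1, there is a unique S* > 0 such that
(i) G(S) = F(S) for 0 ≤ S ≤ S*, and (ii) for S > S*, G(S) > F(S) and every
maximizer of the problem defining G(S) has N > 0. -/
theorem stmt6 (p Ac w Ah a b xbar al ah sg : ℝ)
    (hp : 0 < p) (hAc : 0 < Ac) (hw : 0 < w) (hAh : 0 < Ah)
    (ha : 0 < a) (hb : 0 < b) (hxbar : 0 < xbar)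
    (hal : 0 < al) (hal1 : al < 1) (hah : 0 < ah) (hah1 : ah < 1)
    (hsg : 0 < sg) (hsg1 : sg < 1)
    (hax : a * xbar > Ac) (hrs : 1 ≤ al + sg)
    (F G : ℝ → ℝ)
    (hF : ∀ S : ℝ, F S = sSup {y : ℝ | ∃ K H : ℝ,
      0 ≤ K ∧ 0 ≤ H ∧ p * K + H ≤ S ∧ y = Ac * K ^ al + w * Ah * H ^ ah})
    (hG : ∀ S : ℝ, G S = sSup {y : ℝ | ∃ K N H : ℝ,
      0 ≤ K ∧ 0 ≤ N ∧ 0 ≤ H ∧ p * K + N + H ≤ S ∧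
      y = (Ac + a * max (b * N ^ sg - xbar) 0) * K ^ al + w * Ah * H ^ ah}) :
    ∃! Sstar : ℝ, 0 < Sstar ∧
      (∀ S : ℝ, 0 ≤ S → S ≤ Sstar → G S = F S) ∧
      (∀ S : ℝ, Sstar < S → G S > F S ∧
        ∀ K N H : ℝ, 0 ≤ K → 0 ≤ N → 0 ≤ H → p * K + N + H ≤ S →
          (Ac + a * max (b * N ^ sg - xbar) 0) * K ^ al + w * Ah * H ^ ah = G S →
          0 < N) := by
  have hB : 0 < w * Ah := mul_pos hw hAh
  have hbddF : ∀ S K H : ℝ, 0 ≤ K → 0 ≤ H → p * K + H ≤ S →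
      Ac * K ^ al + w * Ah * H ^ ah ≤ Ac * (S / p) ^ al + w * Ah * S ^ ah := by
    intro S K H hK hH hS
    have h1 : K ≤ S / p := by
      rw [le_div_iff₀ hp]
      linarith
    have h2 : H ≤ S := by nlinarith
    gcongr
  have hF_le : ∀ S K H : ℝ, 0 ≤ K → 0 ≤ H → p * K + H ≤ S →
      Ac * K ^ al + w * Ah * H ^ ah ≤ F S := by
    intro S K H hK hH hS
    rw [hF]
    refine le_csSup ⟨Ac * (S / p) ^ al + w * Ah * S ^ ah, ?_⟩ ⟨K, H, hK, hH, hS, rfl⟩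
    rintro _ ⟨K, H, hK, hH, hS, rfl⟩
    exact hbddF S K H hK hH hS
  have hF_max : ∀ S : ℝ, 0 ≤ S → ∃ K H : ℝ, 0 ≤ K ∧ 0 ≤ H ∧ p * K + H ≤ S ∧
      F S = Ac * K ^ al + w * Ah * H ^ ah := by
    intro S hS
    obtain ⟨K, H, hK, hH, hKH, hmax⟩ :=
      exists_isMax_two_goods (A := Ac) (B := w * Ah) hp hal hah hS
    refine ⟨K, H, hK, hH, hKH, le_antisymm ?_ (hF_le S K H hK hH hKH)⟩
    rw [hF]
    refine csSup_le ⟨_, K, H, hK, hH, hKH, rfl⟩ ?_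
    rintro _ ⟨K', H', hK', hH', hS', rfl⟩
    exact hmax K' H' hK' hH' hS'
  have hG_le : ∀ S K N H : ℝ, 0 ≤ K → 0 ≤ N → 0 ≤ H → p * K + N + H ≤ S →
      (Ac + a * max (b * N ^ sg - xbar) 0) * K ^ al + w * Ah * H ^ ah ≤ G S := by
    intro S K N H hK hN hH hS
    rw [hG]
    refine le_csSup ⟨(Ac + a * max (b * S ^ sg - xbar) 0) * (S / p) ^ al + w * Ah * S ^ ah, ?_⟩
      ⟨K, N, H, hK, hN, hH, hS, rfl⟩
    rintro _ ⟨K, N, H, hK, hN, hH, hS, rfl⟩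
    have hpK : 0 ≤ p * K := by positivity
    have h1 : K ≤ S / p := by
      rw [le_div_iff₀ hp]
      linarith
    have h2 : H ≤ S := by linarith
    have h3 : N ≤ S := by linarith
    gcongr
  have hzero : max (b * (0 : ℝ) ^ sg - xbar) 0 = 0 := by
    rw [Real.zero_rpow hsg.ne', max_eq_right (by linarith)]
  have hFG : ∀ S : ℝ, 0 ≤ S → F S ≤ G S := by
    intro S hS
    obtain ⟨K, H, hK, hH, hKH, e⟩ := hF_max S hS
    have := hG_le S K 0 H hK le_rfl hH (by linarith)
    rw [hzero, mul_zero, add_zero] at this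
    linarith
  have hG_gt : ∀ S : ℝ, 0 ≤ S → F S < G S → ∃ K N H : ℝ, 0 ≤ K ∧ 0 ≤ N ∧ 0 ≤ H ∧
      p * K + N + H ≤ S ∧
      F S < (Ac + a * max (b * N ^ sg - xbar) 0) * K ^ al + w * Ah * H ^ ah := by
    intro S hS hlt
    rw [hG] at hlt
    obtain ⟨_, ⟨K, N, H, hK, hN, hH, hKNH, rfl⟩, hy⟩ :=
      exists_lt_of_lt_csSup
        (by exact ⟨_, 0, 0, 0, le_rfl, le_rfl, le_rfl, by simpa using hS, rfl⟩) hlt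
    exact ⟨K, N, H, hK, hN, hH, hKNH, hy⟩
  have hmono : ∀ S₀ S : ℝ, 0 ≤ S₀ → S₀ ≤ S → F S₀ < G S₀ → F S < G S := by
    intro S₀ S h0 hle hlt
    obtain ⟨K₀, N₀, H₀, hK₀, hN₀, hH₀, hb₀, hval⟩ := hG_gt S₀ h0 hlt
    obtain ⟨K', H', hK', hH', hb', e⟩ := hF_max S (h0.trans hle)
    obtain ⟨K, N, H, hK, hN, hH, hKNH, hbig⟩ :=
      exists_adoption_gt_of_le hp hAc hB ha hb hal hah hah1 hsg hK₀ hN₀ hH₀ hb₀ hle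
        (fun K H hK hH hKH => (hF_le S₀ K H hK hH hKH).trans_lt hval) hK' hH' hb'
    rw [e]
    exact hbig.trans_le (hG_le S K N H hK hN hH hKNH)
  have hlow : ∀ S : ℝ, 0 ≤ S → F S < G S → (xbar / b) ^ (1 / sg) ≤ S := by
    intro S hS hlt
    by_contra! hsmall
    obtain ⟨K, N, H, hK, hN, hH, hKNH, hval⟩ := hG_gt S hS hlt
    have hpK : 0 ≤ p * K := by positivity
    have hNpow : N ^ sg ≤ xbar / b := by
      calc N ^ sg ≤ ((xbar / b) ^ (1 / sg)) ^ sg :=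
            Real.rpow_le_rpow hN (by linarith) hsg.le
        _ = xbar / b := by
            rw [← Real.rpow_mul (by positivity), one_div_mul_cancel hsg.ne', Real.rpow_one]
    rw [le_div_iff₀ hb] at hNpow
    rw [max_eq_right (by linarith), mul_zero, add_zero] at hval
    exact absurd (hF_le S K H hK hH (by linarith)) (not_le.mpr hval)
  have hne : ∃ S : ℝ, 0 ≤ S ∧ F S < G S := by
    obtain ⟨t, ht, hlt⟩ := exists_budget_adoption_gt (Ac := Ac) (B := w * Ah) (xbar := xbar)
      (al := al) (ah := ah) hp ha hb hsg (by linarith)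
    refine ⟨2 * t, by positivity, ?_⟩
    obtain ⟨K, H, hK, hH, hKH, e⟩ := hF_max (2 * t) (by positivity)
    have h1 := hbddF (2 * t) K H hK hH hKH
    have h2 := hG_le (2 * t) (t / p) t 0 (by positivity) ht.le le_rfl (by
      rw [mul_div_cancel₀ _ hp.ne']
      linarith)
    have h3 : (Ac + a * (b * t ^ sg - xbar)) * (t / p) ^ al ≤
        (Ac + a * max (b * t ^ sg - xbar) 0) * (t / p) ^ al := by
      gcongr
      exact le_max_left _ _
    rw [Real.zero_rpow hah.ne', mul_zero, add_zero] at h2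
    linarith
  have hleft : ∀ S : ℝ, 0 < S → F S < G S → ∃ S' : ℝ, 0 ≤ S' ∧ S' < S ∧ F S' < G S' := by
    intro S hS hlt
    obtain ⟨K, N, H, hK, hN, hH, hKNH, hval⟩ := hG_gt S hS.le hlt
    have hcont : Continuous fun t : ℝ =>
        (Ac + a * max (b * (t * N) ^ sg - xbar) 0) * (t * K) ^ al + w * Ah * (t * H) ^ ah := by
      have hpow : ∀ c e : ℝ, 0 < e → Continuous fun t : ℝ => (t * c) ^ e := fun c e he =>
        (continuous_mul_const c).rpow_const fun _ => Or.inr he.le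
      have := hpow N sg hsg
      have := hpow K al hal
      have := hpow H ah hah
      fun_prop
    have hev : ∀ᶠ t in 𝓝[<] (1 : ℝ), F S <
        (Ac + a * max (b * (t * N) ^ sg - xbar) 0) * (t * K) ^ al + w * Ah * (t * H) ^ ah :=
      ((hcont.tendsto 1).eventually_const_lt (by simpa using hval)).filter_mono
        nhdsWithin_le_nhds
    obtain ⟨t, hbig, ht0, ht1⟩ :=
      (hev.and (Ioo_mem_nhdsLT (show (0 : ℝ) < 1 by norm_num))).exists
    refine ⟨t * S, by positivity, by nlinarith, ?_⟩
    obtain ⟨K', H', hK', hH', hKH', e⟩ := hF_max (t * S) (by positivity)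
    have h1 := hF_le S K' H' hK' hH' (by nlinarith)
    have h2 := hG_le (t * S) (t * K) (t * N) (t * H) (by positivity) (by positivity)
      (by positivity) (by nlinarith)
    linarith
  have hbelow : BddBelow {S : ℝ | 0 ≤ S ∧ F S < G S} := ⟨0, fun _ h => h.1⟩
  have hinf_pos : 0 < sInf {S : ℝ | 0 ≤ S ∧ F S < G S} :=
    (show 0 < (xbar / b) ^ (1 / sg) by positivity).trans_le
      (le_csInf hne fun S h => hlow S h.1 h.2)
  refine ⟨sInf {S : ℝ | 0 ≤ S ∧ F S < G S}, ⟨hinf_pos, ?_, ?_⟩, ?_⟩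
  · intro S h0 hle
    refine le_antisymm (not_lt.mp fun hlt => ?_) (hFG S h0)
    have hge := csInf_le hbelow ⟨h0, hlt⟩
    obtain ⟨S', hS'0, hS'lt, hS'⟩ := hleft S (hinf_pos.trans_le hge) hlt
    have := csInf_le hbelow ⟨hS'0, hS'⟩
    linarith
  · intro S hlt
    obtain ⟨S₀, ⟨h0, hgt⟩, hS₀⟩ := exists_lt_of_csInf_lt hne hlt
    have hFGS := hmono S₀ S h0 hS₀.le hgt
    refine ⟨hFGS, fun K N H hK hN hH hKNH hval => ?_⟩
    rcases hN.eq_or_lt with e | h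
    · subst e
      rw [hzero, mul_zero, add_zero] at hval
      have := hF_le S K H hK hH (by linarith)
      linarith
    · exact h
  · rintro T ⟨hT, hTeq, hTgt⟩
    refine le_antisymm (not_lt.mp fun hlt => ?_) (not_lt.mp fun hlt => ?_)
    · obtain ⟨S₀, ⟨h0, hgt⟩, hS₀⟩ := exists_lt_of_csInf_lt hne hlt
      exact hgt.ne' (hTeq S₀ h0 hS₀.le)
    · obtain ⟨S, hTS, hSinf⟩ := exists_between hlt
      have := csInf_le hbelow ⟨(hT.trans hTS).le, (hTgt S hTS).1⟩
      linarith
end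

section
/- Assume a·x̄ > A_c and α + σ ≥ 1, and let S* > 0 be the unique threshold such that G(S) = F(S) for all 0 ≤ S ≤ S* and G(S) > F(S) for all S > S*. Then b·(S*)^σ > x̄. -/
open Filter Topology

/-- Beyond any positive `N₀` there is `S` such that `b * S ^ sg` exceeds `b * N₀ ^ sg` by at most `ε`
and `M * (S - N₀) ≤ N₀`. -/
theorem exists_gt_mul_rpow_le {b sg N₀ M ε : ℝ} (hN₀ : 0 < N₀) (hε : 0 < ε) :
    ∃ S, N₀ < S ∧ b * S ^ sg < b * N₀ ^ sg + ε ∧ M * (S - N₀) < N₀ := by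
  have hpow : ContinuousAt (fun S : ℝ => b * S ^ sg) N₀ :=
    continuousAt_const.mul (Real.continuousAt_rpow_const _ _ (Or.inl hN₀.ne'))
  have hlin : ContinuousAt (fun S : ℝ => M * (S - N₀)) N₀ := by fun_prop
  have h₁ : ∀ᶠ S in 𝓝 N₀, b * S ^ sg < b * N₀ ^ sg + ε :=
    hpow.eventually_lt_const (by linarith)
  have h₂ : ∀ᶠ S in 𝓝 N₀, M * (S - N₀) < N₀ := hlin.eventually_lt_const (by simpa using hN₀)
  have h₃ : ∀ᶠ S in 𝓝[>] N₀, N₀ < S := eventually_mem_nhdsWithin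
  exact (h₃.and ((h₁.and h₂).filter_mono nhdsWithin_le_nhds)).exists

/-- The attainable outputs of the two-input problem are bounded above. -/
theorem bddAbove_two_input_output {p A B al ah : ℝ} (hp : 0 < p) (hA : 0 ≤ A) (hB : 0 ≤ B)
    (hal : 0 ≤ al) (hah : 0 ≤ ah) (S : ℝ) :
    BddAbove {y : ℝ | ∃ K H : ℝ,
      0 ≤ K ∧ 0 ≤ H ∧ p * K + H ≤ S ∧ y = A * K ^ al + B * H ^ ah} := by
  refine ⟨A * (S / p) ^ al + B * S ^ ah, ?_⟩
  rintro y ⟨K, H, hK, hH, hS, rfl⟩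
  have hpK : 0 ≤ p * K := by positivity
  have hKS : K ≤ S / p := by
    rw [le_div_iff₀ hp]
    linarith
  have hHS : H ≤ S := by linarith
  gcongr

/-- Doubling the output of `K` units is no better than adding `L` units, if `L` is large
compared with `K`. -/
theorem two_mul_rpow_le_add_rpow {K L al : ℝ} (hK : 0 ≤ K) (hal : 0 < al)
    (h : 2 ^ (1 / al) * K ≤ K + L) : 2 * K ^ al ≤ (K + L) ^ al := by
  calc 2 * K ^ al = (2 ^ (1 / al) * K) ^ al := by
        rw [Real.mul_rpow (by positivity) hK, ← Real.rpow_mul (by norm_num),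
          one_div_mul_cancel hal.ne', Real.rpow_one]
    _ ≤ (K + L) ^ al := by gcongr

/-- Under a·x̄ > A_c and α + σ ≥ 1, the threshold S* (with
G = F on [0, S*] and G > F above S*) satisfies b·(S*)^σ > x̄. -/
theorem stmt7 (p Ac w Ah a b xbar al ah sg : ℝ)
    (hp : 0 < p) (hAc : 0 < Ac) (hw : 0 < w) (hAh : 0 < Ah)
    (ha : 0 < a) (hb : 0 < b) (hxbar : 0 < xbar)
    (hal : 0 < al) (hal1 : al < 1) (hah : 0 < ah) (hah1 : ah < 1)
    (hsg : 0 < sg) (hsg1 : sg < 1)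
    (hax : a * xbar > Ac) (hrs : 1 ≤ al + sg)
    (F G : ℝ → ℝ)
    (hF : ∀ S : ℝ, F S = sSup {y : ℝ | ∃ K H : ℝ,
      0 ≤ K ∧ 0 ≤ H ∧ p * K + H ≤ S ∧ y = Ac * K ^ al + w * Ah * H ^ ah})
    (hG : ∀ S : ℝ, G S = sSup {y : ℝ | ∃ K N H : ℝ,
      0 ≤ K ∧ 0 ≤ N ∧ 0 ≤ H ∧ p * K + N + H ≤ S ∧
      y = (Ac + a * max (b * N ^ sg - xbar) 0) * K ^ al + w * Ah * H ^ ah})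
    (Sstar : ℝ) (hSstar : 0 < Sstar)
    (hbelow : ∀ S : ℝ, 0 ≤ S → S ≤ Sstar → G S = F S)
    (habove : ∀ S : ℝ, Sstar < S → G S > F S) :
    b * Sstar ^ sg > xbar := by
  by_contra! hle
  set N₀ : ℝ := (xbar / b) ^ (1 / sg) with hN₀_def
  have hN₀ : 0 < N₀ := by positivity
  have hbN₀ : b * N₀ ^ sg = xbar := by
    rw [hN₀_def, ← Real.rpow_mul (by positivity), one_div_mul_cancel hsg.ne', Real.rpow_one]
    field_simp
  have hSN₀ : Sstar ≤ N₀ := by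
    rw [← hbN₀] at hle
    exact (Real.rpow_le_rpow_iff hSstar.le hN₀.le hsg).1 (le_of_mul_le_mul_left hle hb)
  obtain ⟨S, hS, hbS, hMS⟩ := exists_gt_mul_rpow_le (b := b) (sg := sg) (M := 2 ^ (1 / al))
    hN₀ (div_pos hAc ha)
  rw [hbN₀] at hbS
  refine (habove S (hSN₀.trans_lt hS)).not_ge ?_
  rw [hG, hF]
  have hbdd := bddAbove_two_input_output hp hAc.le (mul_pos hw hAh).le hal.le hah.le S
  refine csSup_le ⟨_, 0, 0, 0, le_rfl, le_rfl, le_rfl, by linarith, rfl⟩ ?_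
  rintro y ⟨K, N, H, hK, hN, hH, hKNH, rfl⟩
  rcases le_or_gt (b * N ^ sg) xbar with hNx | hNx
  · refine le_csSup hbdd ⟨K, H, hK, hH, by linarith, ?_⟩
    rw [max_eq_right (by linarith), mul_zero, add_zero]
  · have hN₀N : N₀ < N := by
      rw [← hbN₀] at hNx
      exact (Real.rpow_lt_rpow_iff hN₀.le hN hsg).1 (lt_of_mul_lt_mul_left hNx hb.le)
    have hpK : p * K ≤ S - N₀ := by linarith
    have hNS : N ≤ S := by linarith [mul_nonneg hp.le hK]
    have hcoef : Ac + a * max (b * N ^ sg - xbar) 0 ≤ Ac * 2 := by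
      have hbN : b * N ^ sg ≤ b * S ^ sg := by gcongr
      have hgain : a * (b * N ^ sg - xbar) ≤ a * (Ac / a) := by
        gcongr
        linarith
      rw [mul_div_cancel₀ _ ha.ne'] at hgain
      rw [max_eq_left (by linarith)]
      linarith
    have hKN : 2 ^ (1 / al) * K ≤ K + N / p := by
      have hmul : (2 : ℝ) ^ (1 / al) * (p * K) ≤ 2 ^ (1 / al) * (S - N₀) := by gcongr
      have hdiv : (2 : ℝ) ^ (1 / al) * K ≤ N / p := by
        rw [le_div_iff₀ hp]
        linarith
      linarith
    calc (Ac + a * max (b * N ^ sg - xbar) 0) * K ^ al + w * Ah * H ^ ah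
        ≤ Ac * 2 * K ^ al + w * Ah * H ^ ah := by gcongr
      _ = Ac * (2 * K ^ al) + w * Ah * H ^ ah := by ring
      _ ≤ Ac * (K + N / p) ^ al + w * Ah * H ^ ah := by
        gcongr
        exact two_mul_rpow_le_add_rpow hK hal hKN
      _ ≤ _ := by
        refine le_csSup hbdd ⟨K + N / p, H, by positivity, hH, ?_, rfl⟩
        rw [mul_add, mul_div_cancel₀ _ hp.ne']
        exact hKNH
end

section
/- Assume a·x̄ > A_c. Then the function S ↦ G_0(S) − F(S) is strictly increasing on [N_1, ∞); that is, for all N_1 ≤ S_1 < S_2 one has G_0(S_1) − F(S_1) < G_0(S_2) − F(S_2). -/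
/-- Shifting by `r > 0` gains more at the smaller of two points for a power with exponent in
`(0, 1)`. -/
theorem rpow_shift_exchange {c x y r : ℝ} (hc : 0 < c) (hc1 : c < 1) (hx : 0 ≤ x) (hxy : x < y)
    (hr : 0 < r) : (y + r) ^ c + x ^ c < (x + r) ^ c + y ^ c := by
  have hL : 0 < y + r - x := by linarith
  have hconc := Real.strictConcaveOn_rpow hc hc1
  have hx' : x ∈ Set.Ici (0 : ℝ) := hx
  have hy' : y + r ∈ Set.Ici (0 : ℝ) := by simp only [Set.mem_Ici]; linarith
  have hu : 0 < (y - x) / (y + r - x) := div_pos (by linarith) hL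
  have hv : 0 < r / (y + r - x) := div_pos hr hL
  have huv : (y - x) / (y + r - x) + r / (y + r - x) = 1 := by field_simp; ring
  have h₁ := hconc.2 hx' hy' (by linarith : x ≠ y + r) hu hv huv
  have h₂ := hconc.2 hx' hy' (by linarith : x ≠ y + r) hv hu (by linarith)
  have e₁ : (y - x) / (y + r - x) * x + r / (y + r - x) * (y + r) = x + r := by
    field_simp; ring
  have e₂ : r / (y + r - x) * x + (y - x) / (y + r - x) * (y + r) = y := by
    field_simp; ring
  simp only [smul_eq_mul, e₁, e₂] at h₁ h₂
  calc (y + r) ^ c + x ^ c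
      = ((y - x) / (y + r - x) + r / (y + r - x)) * ((y + r) ^ c + x ^ c) := by rw [huv, one_mul]
    _ < (x + r) ^ c + y ^ c := by linarith

/-- The two-good problem attains its maximum. -/
theorem exists_isGreatest_two_good {p A B c d S : ℝ} (hp : 0 < p) (hc : 0 < c) (hd : 0 < d)
    (hS : 0 ≤ S) :
    ∃ m, IsGreatest {y : ℝ | ∃ K H : ℝ,
      0 ≤ K ∧ 0 ≤ H ∧ p * K + H ≤ S ∧ y = A * K ^ c + B * H ^ d} m := by
  have hcomp : IsCompact ((Set.Icc 0 (S / p) ×ˢ Set.Icc 0 S) ∩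
      {q : ℝ × ℝ | p * q.1 + q.2 ≤ S}) :=
    (isCompact_Icc.prod isCompact_Icc).inter_right
      (isClosed_le (by fun_prop) (by fun_prop))
  have hcont : Continuous fun q : ℝ × ℝ => A * q.1 ^ c + B * q.2 ^ d :=
    (continuous_const.mul (continuous_fst.rpow_const fun _ => Or.inr hc.le)).add
      (continuous_const.mul (continuous_snd.rpow_const fun _ => Or.inr hd.le))
  obtain ⟨⟨K, H⟩, ⟨⟨hK, hH⟩, hKH⟩, hmax⟩ := hcomp.exists_isMaxOn
    ⟨((0 : ℝ), (0 : ℝ)), ⟨⟨⟨le_rfl, by positivity⟩, ⟨le_rfl, hS⟩⟩, by simpa using hS⟩⟩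
    hcont.continuousOn
  refine ⟨_, ⟨K, H, hK.1, hH.1, hKH, rfl⟩, ?_⟩
  rintro y ⟨K', H', hK', hH', hKH', rfl⟩
  have hpK : 0 ≤ p * K' := by positivity
  exact hmax (a := (K', H'))
    ⟨⟨⟨hK', by rw [le_div_iff₀ hp]; dsimp only; linarith⟩, ⟨hH', by dsimp only; linarith⟩⟩, hKH'⟩

/-- The three-good problem with an input threshold attains its maximum. -/
theorem exists_isGreatest_three_good {p Ac a b xbar B c d s S : ℝ} (hp : 0 < p) (hb : 0 < b)
    (hxbar : 0 < xbar) (hc : 0 < c) (hd : 0 < d) (hs : 0 < s) (hS : (xbar / b) ^ (1 / s) ≤ S) :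
    ∃ m, IsGreatest {y : ℝ | ∃ K N H : ℝ,
      0 ≤ K ∧ 0 ≤ N ∧ 0 ≤ H ∧ b * N ^ s ≥ xbar ∧ p * K + N + H ≤ S ∧
      y = (Ac + a * (b * N ^ s - xbar)) * K ^ c + B * H ^ d} m := by
  have hN₁ : 0 ≤ (xbar / b) ^ (1 / s) := by positivity
  have hS₀ : 0 ≤ S := hN₁.trans hS
  have hthr : b * ((xbar / b) ^ (1 / s)) ^ s = xbar := by
    rw [← Real.rpow_mul (by positivity), one_div_mul_cancel hs.ne', Real.rpow_one]
    field_simp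
  have hNs : Continuous fun q : ℝ × ℝ × ℝ => b * q.2.1 ^ s :=
    continuous_const.mul (Continuous.rpow_const (by fun_prop) fun _ => Or.inr hs.le)
  have hKc : Continuous fun q : ℝ × ℝ × ℝ => q.1 ^ c :=
    Continuous.rpow_const (by fun_prop) fun _ => Or.inr hc.le
  have hHd : Continuous fun q : ℝ × ℝ × ℝ => q.2.2 ^ d :=
    Continuous.rpow_const (by fun_prop) fun _ => Or.inr hd.le
  have hcomp : IsCompact ((Set.Icc 0 (S / p) ×ˢ Set.Icc 0 S ×ˢ Set.Icc 0 S) ∩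
      ({q : ℝ × ℝ × ℝ | xbar ≤ b * q.2.1 ^ s} ∩
        {q : ℝ × ℝ × ℝ | p * q.1 + q.2.1 + q.2.2 ≤ S})) :=
    (isCompact_Icc.prod (isCompact_Icc.prod isCompact_Icc)).inter_right
      ((isClosed_le continuous_const hNs).inter (isClosed_le (by fun_prop) (by fun_prop)))
  have hcont : Continuous fun q : ℝ × ℝ × ℝ =>
      (Ac + a * (b * q.2.1 ^ s - xbar)) * q.1 ^ c + B * q.2.2 ^ d := by
    fun_prop
  obtain ⟨⟨K, N, H⟩, ⟨⟨hK, hN, hH⟩, hx, hKH⟩, hmax⟩ := hcomp.exists_isMaxOn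
    ⟨((0 : ℝ), (xbar / b) ^ (1 / s), (0 : ℝ)),
      ⟨⟨⟨le_rfl, by positivity⟩, ⟨hN₁, hS⟩, ⟨le_rfl, hS₀⟩⟩, hthr.ge, by simpa using hS⟩⟩
    hcont.continuousOn
  refine ⟨_, ⟨K, N, H, hK.1, hN.1, hH.1, hx, hKH, rfl⟩, ?_⟩
  rintro y ⟨K', N', H', hK', hN', hH', hx', hKH', rfl⟩
  have hpK : 0 ≤ p * K' := by positivity
  exact hmax (a := (K', N', H'))
    ⟨⟨⟨hK', by rw [le_div_iff₀ hp]; dsimp only; linarith⟩, ⟨hN', by dsimp only; linarith⟩,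
      ⟨hH', by dsimp only; linarith⟩⟩, hx', hKH'⟩

/-- If a·x̄ > A_c, then S ↦ G_0(S) − F(S) is strictly increasing
on [N_1, ∞), where N_1 = (x̄/b)^{1/σ}. -/
theorem stmt8 (p Ac w Ah a b xbar al ah sg : ℝ)
    (hp : 0 < p) (hAc : 0 < Ac) (hw : 0 < w) (hAh : 0 < Ah)
    (ha : 0 < a) (hb : 0 < b) (hxbar : 0 < xbar)
    (hal : 0 < al) (hal1 : al < 1) (hah : 0 < ah) (hah1 : ah < 1)
    (hsg : 0 < sg) (hsg1 : sg < 1)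
    (hax : a * xbar > Ac)
    (F G0 : ℝ → ℝ)
    (hF : ∀ S : ℝ, F S = sSup {y : ℝ | ∃ K H : ℝ,
      0 ≤ K ∧ 0 ≤ H ∧ p * K + H ≤ S ∧ y = Ac * K ^ al + w * Ah * H ^ ah})
    (hG0 : ∀ S : ℝ, (xbar / b) ^ (1 / sg) ≤ S →
      G0 S = sSup {y : ℝ | ∃ K N H : ℝ,
        0 ≤ K ∧ 0 ≤ N ∧ 0 ≤ H ∧ b * N ^ sg ≥ xbar ∧ p * K + N + H ≤ S ∧
        y = (Ac + a * (b * N ^ sg - xbar)) * K ^ al + w * Ah * H ^ ah}) :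
    ∀ S₁ S₂ : ℝ, (xbar / b) ^ (1 / sg) ≤ S₁ → S₁ < S₂ →
      G0 S₁ - F S₁ < G0 S₂ - F S₂ := by
  intro S₁ S₂ hS₁ hS
  have hS₁pos : 0 ≤ S₁ := le_trans (by positivity) hS₁
  have hB : 0 < w * Ah := mul_pos hw hAh
  obtain ⟨f₁, hf₁⟩ := exists_isGreatest_two_good (A := Ac) (B := w * Ah) hp hal hah hS₁pos
  obtain ⟨f₂, hf₂⟩ := exists_isGreatest_two_good (A := Ac) (B := w * Ah) hp hal hah
    (hS₁pos.trans hS.le)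
  obtain ⟨g₁, hg₁⟩ := exists_isGreatest_three_good (Ac := Ac) (a := a) (B := w * Ah) hp hb hxbar
    hal hah hsg hS₁
  obtain ⟨g₂, hg₂⟩ := exists_isGreatest_three_good (Ac := Ac) (a := a) (B := w * Ah) hp hb hxbar
    hal hah hsg (hS₁.trans hS.le)
  rw [hF, hF, hG0 _ hS₁, hG0 _ (hS₁.trans hS.le), hf₁.csSup_eq, hf₂.csSup_eq, hg₁.csSup_eq,
    hg₂.csSup_eq]
  obtain ⟨K, N, H, hK, hN, hH, hx, hbud, rfl⟩ := hg₁.1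
  obtain ⟨K', H₀, hK', hH₀, hbud', rfl⟩ := hf₂.1
  have hNpos : 0 < N := by
    refine hN.lt_of_ne fun h => ?_
    rw [← h, Real.zero_rpow hsg.ne'] at hx
    linarith
  -- The budget may be taken to bind at the two-good optimum.
  obtain ⟨H', hH'⟩ : ∃ H', p * K' + H' = S₂ := ⟨S₂ - p * K', by ring⟩
  have hle : w * Ah * H₀ ^ ah ≤ w * Ah * H' ^ ah :=
    mul_le_mul_of_nonneg_left (Real.rpow_le_rpow hH₀ (by linarith) hah.le) hB.le
  obtain ⟨A, hA⟩ : ∃ A, Ac + a * (b * N ^ sg - xbar) = A := ⟨_, rfl⟩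
  have hAA : Ac ≤ A := by
    have := mul_nonneg ha.le (sub_nonneg.2 hx)
    linarith
  rw [hA]
  -- Moving `r` units of `K` and `s` units of `H` from one problem to the other stays feasible.
  have key : ∀ r s : ℝ, 0 ≤ r → 0 ≤ s → p * r + s = S₂ - S₁ → r ≤ K' → s ≤ H' →
      A * (K + r) ^ al + w * Ah * (H + s) ^ ah ≤ g₂ ∧
      Ac * (K' - r) ^ al + w * Ah * (H' - s) ^ ah ≤ f₁ := by
    intro r s hr hs hrs hrK hsH
    refine ⟨hg₂.2 ⟨K + r, N, H + s, by linarith, hN, by linarith, hx, by linarith, by rw [hA]⟩,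
      hf₁.2 ⟨K' - r, H' - s, by linarith, by linarith, by linarith, rfl⟩⟩
  have gainK : ∀ r : ℝ, 0 < r → K < K' - r →
      A * K ^ al + Ac * K' ^ al < A * (K + r) ^ al + Ac * (K' - r) ^ al := by
    intro r hr hlt
    have h := rpow_shift_exchange hal hal1 hK hlt hr
    rw [sub_add_cancel] at h
    have hmono : K ^ al ≤ (K + r) ^ al := Real.rpow_le_rpow hK (by linarith) hal.le
    nlinarith [mul_nonneg (sub_nonneg.2 hAA) (sub_nonneg.2 hmono), mul_pos hAc (sub_pos.2 h)]
  have gainH : ∀ s : ℝ, 0 < s → H < H' - s →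
      w * Ah * H ^ ah + w * Ah * H' ^ ah < w * Ah * (H + s) ^ ah + w * Ah * (H' - s) ^ ah := by
    intro s hs hlt
    have h := rpow_shift_exchange hah hah1 hH hlt hs
    rw [sub_add_cancel] at h
    nlinarith [mul_pos hB (sub_pos.2 h)]
  rcases lt_or_ge (S₂ - S₁) (H' - H) with hcase | hcase
  · obtain ⟨h₁, h₂⟩ := key 0 (S₂ - S₁) le_rfl (by linarith) (by ring) hK' (by linarith)
    have h₃ := gainH (S₂ - S₁) (by linarith) (by linarith)
    rw [add_zero] at h₁
    rw [sub_zero] at h₂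
    linarith
  rcases le_or_gt (H' - H) (N / 2) with hcase' | hcase'
  · have hr : p * ((S₂ - S₁) / p) = S₂ - S₁ := mul_div_cancel₀ _ hp.ne'
    have hlt : K < K' - (S₂ - S₁) / p :=
      lt_of_mul_lt_mul_left (by rw [mul_sub, hr]; linarith) hp.le
    have hrpos : 0 < (S₂ - S₁) / p := div_pos (by linarith) hp
    obtain ⟨h₁, h₂⟩ := key _ 0 hrpos.le le_rfl (by rw [hr, add_zero]) (by linarith) (by linarith)
    have h₃ := gainK _ hrpos hlt
    rw [add_zero] at h₁
    rw [sub_zero] at h₂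
    linarith
  · obtain ⟨s, hs⟩ : ∃ s, s = H' - H - N / 2 := ⟨_, rfl⟩
    have hr : p * ((S₂ - S₁ - s) / p) = S₂ - S₁ - s := mul_div_cancel₀ _ hp.ne'
    have hlt : K < K' - (S₂ - S₁ - s) / p :=
      lt_of_mul_lt_mul_left (by rw [mul_sub, hr]; linarith) hp.le
    have hrpos : 0 < (S₂ - S₁ - s) / p := div_pos (by linarith) hp
    obtain ⟨h₁, h₂⟩ := key _ s hrpos.le (by linarith) (by rw [hr]; ring) (by linarith)
      (by linarith)
    have h₃ := gainK _ hrpos hlt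
    have h₄ := gainH s (by linarith) (by linarith)
    linarith
end

section
/- Assume a·x̄ > A_c, and set x_1 := N_1·((α+σ)/σ − (α/σ)·(a·x̄ − A_c)/(a·x̄)). Then x_1 ≥ N_1, G_1(N_1) = 0, and: (i) for every x with N_1 < x ≤ x_1, G_1(x) = A_c·(x − N_1)^α / p^α; (ii) G_1 is strictly increasing and continuously differentiable on (N_1, ∞), and G_1'(x) > α·A_c·x^{α−1}/p^α for every x > N_1. -/
open Set Filter Topology

/-- The concave power function lies below its tangents. -/
theorem rpow_le_tangent {s u v : ℝ} (hs : 0 ≤ s) (hs1 : s ≤ 1) (hu : 0 < u) (hv : 0 ≤ v) :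
    v ^ s ≤ u ^ s + s * u ^ (s - 1) * (v - u) := by
  have h := rpow_one_add_le_one_add_mul_self (s := v / u - 1)
    (by linarith [div_nonneg hv hu.le]) hs hs1
  rw [add_sub_cancel, Real.div_rpow hv hu.le, div_le_iff₀ (Real.rpow_pos_of_pos hu s)] at h
  refine h.trans_eq ?_
  rw [Real.rpow_sub_one hu.ne']
  field_simp

/-- A function whose increments at `x` are squeezed between `A y * (y - x)` and `B y * (y - x)`,
with `A` and `B` tending to `L`, has derivative `L` at `x`. -/
theorem hasDerivAt_of_increment_squeeze {f A B : ℝ → ℝ} {x L : ℝ}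
    (hA : Tendsto A (𝓝 x) (𝓝 L)) (hB : Tendsto B (𝓝 x) (𝓝 L))
    (hl : ∀ᶠ y in 𝓝 x, A y * (y - x) ≤ f y - f x)
    (hu : ∀ᶠ y in 𝓝 x, f y - f x ≤ B y * (y - x)) : HasDerivAt f L x := by
  rw [hasDerivAt_iff_isLittleO, Asymptotics.isLittleO_iff]
  intro ε hε
  filter_upwards [hl, hu, Metric.tendsto_nhds.1 hA ε hε, Metric.tendsto_nhds.1 hB ε hε]
    with y h1 h2 h3 h4
  rw [Real.dist_eq] at h3 h4
  have e1 : |(A y - L) * (y - x)| ≤ ε * |y - x| := by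
    rw [abs_mul]; gcongr
  have e2 : |(B y - L) * (y - x)| ≤ ε * |y - x| := by
    rw [abs_mul]; gcongr
  rw [abs_le] at e1 e2
  simp only [smul_eq_mul, Real.norm_eq_abs]
  rw [abs_le]
  constructor <;> nlinarith

/-- First-order condition for maximizing `f N * (x - N) ^ α` over `N ∈ [m, x]`, where
`r = α f / f'`: either the constraint `m ≤ N` binds or `x - N = r N`. -/
def IsCritical (m : ℝ) (r : ℝ → ℝ) (x N : ℝ) : Prop :=
  m ≤ N ∧ x - N ≤ r N ∧ (N = m ∨ x - N = r N)

section Critical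

variable {m al : ℝ} {f r : ℝ → ℝ}

theorem IsCritical.lt {x N : ℝ} (hr : ∀ N, m ≤ N → 0 < r N) (hx : m < x)
    (h : IsCritical m r x N) : N < x := by
  obtain ⟨h1, -, h3 | h3⟩ := h
  · rwa [h3]
  · linarith [hr N h1]

theorem exists_isCritical {x : ℝ} (hr : ∀ N, m ≤ N → 0 < r N) (hc : ContinuousOn r (Ici m))
    (hx : m < x) : ∃ N, IsCritical m r x N := by
  by_cases h : x - m ≤ r m
  · exact ⟨m, le_rfl, h, Or.inl rfl⟩
  · have hcont : ContinuousOn (fun N => N + r N) (Icc m x) :=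
      continuousOn_id.add (hc.mono Icc_subset_Ici_self)
    obtain ⟨N, hN, hN'⟩ := intermediate_value_Icc hx.le hcont
      (show x ∈ Icc (m + r m) (x + r x) from ⟨by linarith, by linarith [hr x hx.le]⟩)
    have hN' : N + r N = x := hN'
    exact ⟨N, hN.1, by linarith, Or.inr (by linarith)⟩

theorem IsCritical.le_of_le {x y N M : ℝ} (hmono : MonotoneOn r (Ici m)) (hxy : x ≤ y)
    (hN : IsCritical m r x N) (hM : IsCritical m r y M) : N ≤ M ∧ M ≤ N + (y - x) := by
  constructor
  · by_contra! hlt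
    obtain h | h := hN.2.2
    · linarith [hM.1]
    · linarith [hmono hM.1 hN.1 hlt.le, hM.2.1]
  · by_contra! hlt
    obtain h | h := hM.2.2
    · linarith [hN.1]
    · linarith [hmono hN.1 hM.1 (by linarith), hN.2.1]

theorem IsCritical.abs_sub_le {x y N M : ℝ} (hmono : MonotoneOn r (Ici m))
    (hN : IsCritical m r x N) (hM : IsCritical m r y M) : |M - N| ≤ |y - x| := by
  obtain h | h := le_total x y
  · have := hN.le_of_le hmono h hM
    rw [abs_of_nonneg (by linarith), abs_of_nonneg (by linarith)]
    linarith
  · have := hM.le_of_le hmono h hN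
    rw [abs_of_nonpos (by linarith), abs_of_nonpos (by linarith)]
    linarith

/-- A critical point is a global maximizer. -/
theorem IsCritical.mul_rpow_le {x N M : ℝ} (hal : 0 < al) (hr : ∀ N, m ≤ N → 0 < r N)
    (hf : ∀ N, m ≤ N → 0 < f N)
    (htan : ∀ N M, m ≤ N → m ≤ M → f M ≤ f N * (1 + al * (M - N) / r N))
    (hx : m < x) (hN : IsCritical m r x N) (hM : m ≤ M) (hMx : M ≤ x) :
    f M * (x - M) ^ al ≤ f N * (x - N) ^ al := by
  have hNx : 0 < x - N := sub_pos.2 (hN.lt hr hx)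
  have hrN := hr N hN.1
  have hfN := hf N hN.1
  have h1 : f M ≤ f N * Real.exp (al * (M - N) / r N) := by
    refine (htan N M hN.1 hM).trans ?_
    gcongr
    linarith [Real.add_one_le_exp (al * (M - N) / r N)]
  have h2 : (x - M) ^ al ≤ (x - N) ^ al * Real.exp (-(al * (M - N) / (x - N))) := by
    have e : x - M ≤ (x - N) * Real.exp (-((M - N) / (x - N))) := by
      have := Real.add_one_le_exp (-((M - N) / (x - N)))
      calc x - M = (x - N) * (-((M - N) / (x - N)) + 1) := by field_simp; ring
        _ ≤ _ := by gcongr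
    calc (x - M) ^ al ≤ ((x - N) * Real.exp (-((M - N) / (x - N)))) ^ al :=
          Real.rpow_le_rpow (by linarith) e hal.le
      _ = _ := by
          rw [Real.mul_rpow hNx.le (Real.exp_pos _).le, ← Real.exp_mul]
          congr 2
          ring
  have h3 : al * (M - N) / r N - al * (M - N) / (x - N) ≤ 0 := by
    obtain h | h := hN.2.2
    · have : 0 ≤ al * (M - N) := mul_nonneg hal.le (by linarith)
      linarith [div_le_div_of_nonneg_left this hNx hN.2.1]
    · rw [h, sub_self]
  calc f M * (x - M) ^ al
      ≤ (f N * Real.exp (al * (M - N) / r N)) *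
        ((x - N) ^ al * Real.exp (-(al * (M - N) / (x - N)))) :=
        mul_le_mul h1 h2 (Real.rpow_nonneg (by linarith) _) (by positivity)
    _ = f N * (x - N) ^ al * Real.exp (al * (M - N) / r N - al * (M - N) / (x - N)) := by
        rw [sub_eq_add_neg (al * (M - N) / r N), Real.exp_add]; ring
    _ ≤ f N * (x - N) ^ al * 1 := by
        gcongr
        exact Real.exp_le_one_iff.2 h3
    _ = _ := mul_one _

theorem continuousOn_of_isCritical {n : ℝ → ℝ} (hmono : MonotoneOn r (Ici m))
    (hn : ∀ x, m < x → IsCritical m r x (n x)) : ContinuousOn n (Ioi m) := by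
  refine (LipschitzOnWith.of_dist_le_mul (K := 1) fun y hy x hx => ?_).continuousOn
  simpa [Real.dist_eq] using (hn x hx).abs_sub_le hmono (hn y hy)

/-- Envelope theorem for the value function `x ↦ f (n x) * (x - n x) ^ α`. -/
theorem hasDerivAt_value {n : ℝ → ℝ} (hal : 0 < al) (hal1 : al < 1)
    (hr : ∀ N, m ≤ N → 0 < r N) (hmono : MonotoneOn r (Ici m))
    (hf : ∀ N, m ≤ N → 0 < f N) (hfc : ContinuousOn f (Ici m))
    (htan : ∀ N M, m ≤ N → m ≤ M → f M ≤ f N * (1 + al * (M - N) / r N))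
    (hn : ∀ x, m < x → IsCritical m r x (n x)) {x : ℝ} (hx : m < x) :
    HasDerivAt (fun y => f (n y) * (y - n y) ^ al)
      (f (n x) * (al * (x - n x) ^ (al - 1))) x := by
  have hxn : 0 < x - n x := sub_pos.2 ((hn x hx).lt hr hx)
  have hnc : ContinuousAt n x :=
    (continuousOn_of_isCritical hmono hn).continuousAt (Ioi_mem_nhds hx)
  have hgt : ∀ᶠ y in 𝓝 x, m < y := Ioi_mem_nhds hx
  have hfn : ContinuousAt (fun y => f (n y)) x :=
    ((hfc.comp (continuousOn_of_isCritical hmono hn) fun y hy => (hn y hy).1).continuousAt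
      (Ioi_mem_nhds hx) :)
  have hpos1 : ∀ᶠ y in 𝓝 x, 0 < y - n x :=
    (continuousAt_id.sub continuousAt_const).eventually (lt_mem_nhds hxn)
  have hpos2 : ∀ᶠ y in 𝓝 x, 0 < x - n y :=
    (continuousAt_const.sub hnc).eventually (lt_mem_nhds hxn)
  refine hasDerivAt_of_increment_squeeze
    (A := fun y => f (n x) * (al * (y - n x) ^ (al - 1)))
    (B := fun y => f (n y) * (al * (x - n y) ^ (al - 1))) ?_ ?_ ?_ ?_
  · exact (continuousAt_const.mul (continuousAt_const.mul
      ((continuousAt_id.sub continuousAt_const).rpow_const (Or.inl hxn.ne'))) :)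
  · exact (hfn.mul (continuousAt_const.mul
      ((continuousAt_const.sub hnc).rpow_const (Or.inl hxn.ne'))) :)
  · filter_upwards [hgt, hpos1] with y hy hyn
    have h1 := (hn y hy).mul_rpow_le hal hr hf htan hy (hn x hx).1 (by linarith)
    have h2 := mul_le_mul_of_nonneg_left (rpow_le_tangent hal.le hal1.le hyn hxn.le)
      (hf _ (hn x hx).1).le
    linear_combination h1 + h2
  · filter_upwards [hgt, hpos2] with y hy hyn
    have h1 := (hn x hx).mul_rpow_le hal hr hf htan hx (hn y hy).1 (by linarith)
    have h2 := mul_le_mul_of_nonneg_left (rpow_le_tangent hal.le hal1.le hyn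
      (sub_pos.2 ((hn y hy).lt hr hy)).le) (hf _ (hn y hy).1).le
    linear_combination h1 + h2

end Critical

/-- With N_1 = (x̄/b)^{1/σ}, x_1 = N_1·((α+σ)/σ − (α/σ)·(a·x̄ − A_c)/(a·x̄))
and a·x̄ > A_c, one has x_1 ≥ N_1, G_1(N_1) = 0,
(i) G_1(x) = A_c·(x − N_1)^α/p^α for N_1 < x ≤ x_1, and
(ii) G_1 is strictly increasing and continuously differentiable on (N_1, ∞),
with G_1'(x) > α·A_c·x^{α−1}/p^α for all x > N_1. -/
theorem stmt9 (p Ac a b xbar al sg : ℝ)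
    (hp : 0 < p) (hAc : 0 < Ac) (ha : 0 < a) (hb : 0 < b) (hxbar : 0 < xbar)
    (hal : 0 < al) (hal1 : al < 1) (hsg : 0 < sg) (hsg1 : sg < 1)
    (hax : a * xbar > Ac)
    (N1 x1 : ℝ)
    (hN1 : N1 = (xbar / b) ^ (1 / sg))
    (hx1 : x1 = N1 * ((al + sg) / sg - (al / sg) * (a * xbar - Ac) / (a * xbar)))
    (G1 : ℝ → ℝ)
    (hG1 : ∀ x : ℝ, N1 ≤ x →
      G1 x = sSup {y : ℝ | ∃ K N : ℝ,
        0 ≤ K ∧ 0 ≤ N ∧ b * N ^ sg ≥ xbar ∧ p * K + N ≤ x ∧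
        y = (Ac + a * (b * N ^ sg - xbar)) * K ^ al}) :
    N1 ≤ x1 ∧ G1 N1 = 0 ∧
    (∀ x : ℝ, N1 < x → x ≤ x1 → G1 x = Ac * (x - N1) ^ al / p ^ al) ∧
    StrictMonoOn G1 (Set.Ioi N1) ∧
    (∃ G1' : ℝ → ℝ, ContinuousOn G1' (Set.Ioi N1) ∧
      (∀ x : ℝ, N1 < x → HasDerivAt G1 (G1' x) x) ∧
      (∀ x : ℝ, N1 < x → G1' x > al * Ac * x ^ (al - 1) / p ^ al)) := by
  have hm : 0 < N1 := hN1 ▸ Real.rpow_pos_of_pos (div_pos hxbar hb) _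
  have hmsg : N1 ^ sg = xbar / b := by
    rw [hN1, ← Real.rpow_mul (div_pos hxbar hb).le, one_div_mul_cancel hsg.ne', Real.rpow_one]
  have hbm : b * N1 ^ sg = xbar := by rw [hmsg]; field_simp
  have hfeas : ∀ M, 0 ≤ M → xbar ≤ b * M ^ sg → N1 ≤ M := fun M hM hbM => by
    rw [← Real.rpow_le_rpow_iff hm.le hM hsg]
    exact le_of_mul_le_mul_left (hbm.trans_le hbM) hb
  set c : ℝ := (a * xbar - Ac) / (a * b) with hc
  have hcm : c < N1 ^ sg := by
    rw [hmsg, hc, div_lt_div_iff₀ (by positivity) hb]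
    nlinarith [mul_pos hAc hb]
  set f : ℝ → ℝ := fun N => Ac + a * (b * N ^ sg - xbar) with hfdef
  set r : ℝ → ℝ := fun N => al / sg * (N ^ (1 - sg) * (N ^ sg - c)) with hrdef
  have hfm : f N1 = Ac := by simp [hfdef, hbm]
  have hfeq : ∀ N, f N = a * b * (N ^ sg - c) := fun N => by
    simp only [hfdef, hc]; field_simp; ring
  have hpow : ∀ N, N1 ≤ N → N1 ^ sg ≤ N ^ sg := fun N hN =>
    Real.rpow_le_rpow hm.le hN hsg.le
  have hfAc : ∀ N, N1 ≤ N → Ac ≤ f N := fun N hN => by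
    rw [← hfm, hfeq, hfeq]
    have := hpow N hN
    gcongr
  have hf : ∀ N, N1 ≤ N → 0 < f N := fun N hN => hAc.trans_le (hfAc N hN)
  have hr : ∀ N, N1 ≤ N → 0 < r N := fun N hN => by
    have h1 : 0 < N ^ sg - c := by linarith [hpow N hN]
    have h2 : 0 < N := hm.trans_le hN
    simp only [hrdef]
    positivity
  have hmono : MonotoneOn r (Ici N1) := by
    intro N hN M hM hNM
    have hN0 : 0 < N := hm.trans_le hN
    have h1 : 0 < N ^ sg - c := by linarith [hpow N hN]
    have h2 : N ^ sg ≤ M ^ sg := Real.rpow_le_rpow hN0.le hNM hsg.le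
    have h3 : N ^ (1 - sg) ≤ M ^ (1 - sg) := Real.rpow_le_rpow hN0.le hNM (by linarith)
    have h4 : 0 ≤ M ^ (1 - sg) := Real.rpow_nonneg (hN0.le.trans hNM) _
    simp only [hrdef]
    gcongr
  have hfc : ContinuousOn f (Ici N1) := by
    have := Real.continuous_rpow_const hsg.le
    exact (by fun_prop : Continuous f).continuousOn
  have hrc : ContinuousOn r (Ici N1) := by
    have := Real.continuous_rpow_const hsg.le
    have := Real.continuous_rpow_const (sub_pos.2 hsg1).le
    exact (by fun_prop : Continuous r).continuousOn
  have htan : ∀ N M, N1 ≤ N → N1 ≤ M → f M ≤ f N * (1 + al * (M - N) / r N) := by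
    intro N M hN hM
    have hN0 : 0 < N := hm.trans_le hN
    have h1 : N ^ sg - c ≠ 0 := by linarith [hpow N hN]
    have h2 : N ^ (1 - sg) ≠ 0 := (Real.rpow_pos_of_pos hN0 _).ne'
    have h3 := rpow_le_tangent hsg.le hsg1.le hN0 (hm.le.trans hM)
    have h4 : N ^ (sg - 1) = (N ^ (1 - sg))⁻¹ := by
      rw [← Real.rpow_neg hN0.le, neg_sub]
    have h5 : f N * (1 + al * (M - N) / r N)
        = a * b * (N ^ sg + sg * N ^ (sg - 1) * (M - N) - c) := by
      rw [hfeq, h4]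
      simp only [hrdef]
      field_simp
      ring
    rw [h5, hfeq]
    gcongr
  have hx1r : x1 = N1 + r N1 := by
    have h1 : N1 ^ (1 - sg) * N1 ^ sg = N1 := by
      rw [← Real.rpow_add hm, sub_add_cancel, Real.rpow_one]
    have h2 : N1 ^ (1 - sg) = N1 * b / xbar := by
      rw [hmsg] at h1
      field_simp at h1 ⊢
      linarith
    simp only [hrdef]
    rw [hx1, hmsg, h2, hc]
    field_simp
    ring
  have hpal : 0 < p ^ al := Real.rpow_pos_of_pos hp _
  have hGval : ∀ x N, N1 < x → IsCritical N1 r x N →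
      G1 x = f N * (x - N) ^ al / p ^ al := by
    intro x N hx hN
    have hNx := hN.lt hr hx
    rw [hG1 x hx.le]
    refine IsGreatest.csSup_eq ⟨⟨(x - N) / p, N, div_nonneg (by linarith) hp.le,
      hm.le.trans hN.1, ?_, ?_, ?_⟩, ?_⟩
    · have := mul_le_mul_of_nonneg_left (hpow N hN.1) hb.le
      linarith
    · rw [mul_div_cancel₀ _ hp.ne']; linarith
    · rw [Real.div_rpow (by linarith) hp.le, mul_div_assoc]
    · rintro y ⟨K, M, hK, hM, hbM, hKM, rfl⟩
      have hM1 := hfeas M hM hbM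
      have hpK := mul_nonneg hp.le hK
      rw [le_div_iff₀ hpal, mul_assoc, ← Real.mul_rpow hK hp.le]
      refine le_trans ?_ (hN.mul_rpow_le hal hr hf htan hx hM1 (by linarith))
      exact mul_le_mul_of_nonneg_left
        (Real.rpow_le_rpow (mul_nonneg hK hp.le) (by linarith) hal.le) (hf M hM1).le
  have hex : ∀ x, ∃ N, N1 < x → IsCritical N1 r x N := fun x => by
    by_cases hx : N1 < x
    · obtain ⟨N, hN⟩ := exists_isCritical hr hrc hx
      exact ⟨N, fun _ => hN⟩
    · exact ⟨0, fun h => absurd h hx⟩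
  choose n hn using hex
  have hnc := continuousOn_of_isCritical hmono hn
  have hderiv : ∀ x, N1 < x →
      HasDerivAt G1 (f (n x) * (al * (x - n x) ^ (al - 1)) / p ^ al) x := fun x hx => by
    refine HasDerivAt.congr_of_eventuallyEq
      ((hasDerivAt_value hal hal1 hr hmono hf hfc htan hn hx).div_const _) ?_
    filter_upwards [Ioi_mem_nhds hx] with y hy using hGval y _ hy (hn y hy)
  have hlow : ∀ x, N1 < x → f (n x) * (al * (x - n x) ^ (al - 1)) / p ^ al >
      al * Ac * x ^ (al - 1) / p ^ al := fun x hx => by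
    have hnx : n x < x := (hn x hx).lt hr hx
    have h1 := hfAc _ (hn x hx).1
    have h2 : x ^ (al - 1) < (x - n x) ^ (al - 1) :=
      Real.rpow_lt_rpow_of_neg (by linarith) (by linarith [(hn x hx).1]) (by linarith)
    have h3 : 0 < x ^ (al - 1) := Real.rpow_pos_of_pos (hm.trans hx) _
    refine div_lt_div_of_pos_right ?_ hpal
    calc al * Ac * x ^ (al - 1) = Ac * (al * x ^ (al - 1)) := by ring
      _ < Ac * (al * (x - n x) ^ (al - 1)) := by gcongr
      _ ≤ _ := mul_le_mul_of_nonneg_right h1 (mul_nonneg hal.le (h3.trans h2).le)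
  refine ⟨by linarith [hr N1 le_rfl], ?_, ?_, ?_, _, ?_, hderiv, hlow⟩
  · rw [hG1 N1 le_rfl]
    refine IsGreatest.csSup_eq ⟨⟨0, N1, le_rfl, hm.le, hbm.ge, by simp, ?_⟩, ?_⟩
    · rw [Real.zero_rpow hal.ne', mul_zero]
    · rintro y ⟨K, M, hK, hM, hbM, hKM, rfl⟩
      have hM1 := hfeas M hM hbM
      have hK0 : K = 0 := le_antisymm (by by_contra! h; nlinarith) hK
      rw [hK0, Real.zero_rpow hal.ne', mul_zero]
  · intro x hx hxx1
    rw [hGval x N1 hx ⟨le_rfl, by linarith, Or.inl rfl⟩, hfm]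
  · refine strictMonoOn_of_deriv_pos (convex_Ioi N1)
      (fun x hx => (hderiv x hx).continuousAt.continuousWithinAt) fun x hx => ?_
    rw [interior_Ioi] at hx
    rw [(hderiv x hx).deriv]
    have h0 : 0 < x := hm.trans hx
    exact lt_trans (by positivity) (hlow x hx)
  · refine ((hfc.comp hnc fun x hx => (hn x hx).1).mul (continuousOn_const.mul
      ((continuousOn_id.sub hnc).rpow_const fun x hx => Or.inl ?_))).div_const _
    exact (sub_pos.2 ((hn x hx).lt hr hx)).ne'
end

section
/- Assume a·x̄ > A_c. Then the function x ↦ G_1(x) − A_c·x^α/p^α is strictly increasing on [N_1, ∞), and there exists a unique x_2 > N_1 such that G_1(x_2) = A_c·x_2^α/p^α; moreover b·x_2^σ > x̄. -/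
/-- The increment of `t ↦ t ^ al` over an interval of fixed length strictly decreases
when the interval moves right. -/
lemma rpow_increment_lt {al u v c : ℝ} (hal : 0 < al) (hal1 : al < 1) (hu : 0 ≤ u)
    (huv : u < v) (hc : 0 < c) :
    (v + c) ^ al - (u + c) ^ al < v ^ al - u ^ al := by
  have hconc := (Real.strictConcaveOn_rpow hal hal1).2
  have hd : 0 < v + c - u := by linarith
  have ht : 0 < c / (v + c - u) := div_pos hc hd
  have ht' : 0 < (v - u) / (v + c - u) := div_pos (by linarith) hd
  have hsum : c / (v + c - u) + (v - u) / (v + c - u) = 1 := by field_simp; ring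
  have hv : (v + c : ℝ) ∈ Set.Ici (0 : ℝ) := by simp only [Set.mem_Ici]; linarith
  have h1 := hconc (x := u) hu hv (by linarith) ht ht' hsum
  have h2 := hconc (x := u) hu hv (by linarith) ht' ht (by rw [add_comm]; exact hsum)
  have e1 : c / (v + c - u) * u + (v - u) / (v + c - u) * (v + c) = v := by
    field_simp; ring
  have e2 : (v - u) / (v + c - u) * u + c / (v + c - u) * (v + c) = u + c := by
    field_simp; ring
  simp only [smul_eq_mul, e1, e2] at h1 h2
  have hs' : c / (v + c - u) = 1 - (v - u) / (v + c - u) := by linarith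
  rw [hs'] at h1 h2
  linarith

lemma rpow_increment_anti {al u w d : ℝ} (hal : 0 < al) (hal1 : al < 1) (hu : 0 ≤ u)
    (huw : u ≤ w) (hd : 0 < d) :
    (w + d) ^ al - w ^ al ≤ (u + d) ^ al - u ^ al := by
  rcases huw.eq_or_lt with rfl | h
  · exact le_rfl
  · have := rpow_increment_lt hal hal1 hu (show u < u + d by linarith) (sub_pos.2 h)
    rw [show u + d + (w - u) = w + d by ring, show u + (w - u) = w by ring] at this
    exact this.le

/-- The outputs `f N * K ^ al` attainable with budget `x`, when `K` has unit price `p` and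
`N` is at least `N1`. -/
def outputs (p al N1 : ℝ) (f : ℝ → ℝ) (x : ℝ) : Set ℝ :=
  {y | ∃ K N : ℝ, 0 ≤ K ∧ N1 ≤ N ∧ p * K + N ≤ x ∧ y = f N * K ^ al}

section Outputs

variable {p al N1 : ℝ} {f : ℝ → ℝ}

lemma zero_mem_outputs (hal : 0 < al) {x : ℝ} (hx : N1 ≤ x) :
    0 ∈ outputs p al N1 f x :=
  ⟨0, N1, le_rfl, le_rfl, by simpa using hx, by simp [Real.zero_rpow hal.ne']⟩

lemma bddAbove_outputs (hp : 0 < p) (hal : 0 < al) (hf : MonotoneOn f (Set.Ici N1))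
    (hf0 : 0 < f N1) (x : ℝ) : BddAbove (outputs p al N1 f x) := by
  refine ⟨f x * ((x - N1) / p) ^ al, ?_⟩
  rintro y ⟨K, N, hK, hN, hb, rfl⟩
  have hpK : 0 ≤ p * K := by positivity
  have hNx : N ≤ x := by linarith
  have h1 : f N ≤ f x := hf hN (hN.trans hNx) hNx
  have h2 : f N1 ≤ f N := hf Set.self_mem_Ici hN hN
  have h3 : K ≤ (x - N1) / p := by rw [le_div_iff₀ hp]; linarith
  have h4 : K ^ al ≤ ((x - N1) / p) ^ al := Real.rpow_le_rpow hK h3 hal.le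
  exact mul_le_mul h1 h4 (by positivity) (by linarith)

lemma sSup_outputs_nonneg (hp : 0 < p) (hal : 0 < al) (hf : MonotoneOn f (Set.Ici N1))
    (hf0 : 0 < f N1) {x : ℝ} (hx : N1 ≤ x) : 0 ≤ sSup (outputs p al N1 f x) :=
  le_csSup (bddAbove_outputs hp hal hf hf0 x) (zero_mem_outputs hal hx)

lemma sSup_outputs_self (hp : 0 < p) (hal : 0 < al) :
    sSup (outputs p al N1 f N1) = 0 := by
  have : outputs p al N1 f N1 = {0} := by
    refine Set.eq_singleton_iff_unique_mem.2 ⟨zero_mem_outputs hal le_rfl, ?_⟩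
    rintro y ⟨K, N, hK, hN, hb, rfl⟩
    have hK0 : K = 0 := le_antisymm (by by_contra! h; nlinarith [mul_pos hp h]) hK
    simp [hK0, Real.zero_rpow hal.ne']
  rw [this, csSup_singleton]

lemma strictMonoOn_sSup_outputs_sub (hp : 0 < p) (hal : 0 < al) (hal1 : al < 1)
    (hN1 : 0 < N1) (hf : MonotoneOn f (Set.Ici N1)) (hf0 : 0 < f N1) :
    StrictMonoOn (fun x => sSup (outputs p al N1 f x) - f N1 * (x / p) ^ al)
      (Set.Ici N1) := by
  intro x hx y hy hxy
  simp only [Set.mem_Ici] at hx hy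
  have hd : 0 < (y - x) / p := div_pos (by linarith) hp
  have hw : 0 ≤ (x - N1) / p := div_nonneg (by linarith) hp.le
  have hsup : sSup (outputs p al N1 f x) ≤ sSup (outputs p al N1 f y) -
      f N1 * (((x - N1) / p + (y - x) / p) ^ al - ((x - N1) / p) ^ al) := by
    refine csSup_le ⟨0, zero_mem_outputs hal hx⟩ ?_
    rintro z ⟨K, N, hK, hN, hb, rfl⟩
    have hmem : f N * (K + (y - x) / p) ^ al ≤ sSup (outputs p al N1 f y) := by
      refine le_csSup (bddAbove_outputs hp hal hf hf0 y) ⟨_, N, by positivity, hN, ?_, rfl⟩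
      rw [mul_add, mul_div_cancel₀ _ hp.ne']
      linarith
    have hKw : K ≤ (x - N1) / p := by rw [le_div_iff₀ hp]; linarith
    have hinc := rpow_increment_anti hal hal1 hK hKw hd
    have hfN : f N1 ≤ f N := hf Set.self_mem_Ici hN hN
    have hpos : 0 ≤ (K + (y - x) / p) ^ al - K ^ al :=
      sub_nonneg.2 (Real.rpow_le_rpow hK (by linarith) hal.le)
    have h1 := mul_le_mul_of_nonneg_left hinc hf0.le
    have h2 := mul_le_mul_of_nonneg_right hfN hpos
    linarith
  have hstrict := rpow_increment_lt hal hal1 hw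
    (show (x - N1) / p < (x - N1) / p + (y - x) / p by linarith) (div_pos hN1 hp)
  rw [show (x - N1) / p + (y - x) / p + N1 / p = y / p by ring,
    show (x - N1) / p + N1 / p = x / p by ring] at hstrict
  have := mul_lt_mul_of_pos_left hstrict hf0
  simp only
  linarith

lemma sSup_outputs_mono (hp : 0 < p) (hal : 0 < al) (hf : MonotoneOn f (Set.Ici N1))
    (hf0 : 0 < f N1) {x y : ℝ} (hx : N1 ≤ x) (hxy : x ≤ y) :
    sSup (outputs p al N1 f x) ≤ sSup (outputs p al N1 f y) :=
  csSup_le_csSup (bddAbove_outputs hp hal hf hf0 y) ⟨0, zero_mem_outputs hal hx⟩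
    fun _ ⟨K, N, hK, hN, hb, hz⟩ => ⟨K, N, hK, hN, hb.trans hxy, hz⟩

lemma sSup_outputs_le_add (hp : 0 < p) (hal : 0 < al) (hal1 : al < 1)
    (hf : MonotoneOn f (Set.Ici N1)) (hf0 : 0 < f N1) {x y : ℝ} (hx : N1 ≤ x)
    (hxy : x ≤ y) :
    sSup (outputs p al N1 f y) ≤
      sSup (outputs p al N1 f x) + f y * ((y - x) / p) ^ al := by
  refine csSup_le ⟨0, zero_mem_outputs hal (hx.trans hxy)⟩ ?_
  rintro z ⟨K, N, hK, hN, hb, rfl⟩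
  have hpK : 0 ≤ p * K := by positivity
  have hNy : N ≤ y := by linarith
  have h1 : f N ≤ f y := hf hN (hN.trans hNy) hNy
  have h2 : f N1 ≤ f N := hf Set.self_mem_Ici hN hN
  have hd : 0 ≤ (y - x) / p := div_nonneg (by linarith) hp.le
  have hdal : 0 ≤ ((y - x) / p) ^ al := Real.rpow_nonneg hd _
  rcases le_total N x with hNx | hNx
  · have hw : 0 ≤ (x - N) / p := div_nonneg (by linarith) hp.le
    have hKle : K ≤ (x - N) / p + (y - x) / p := by
      rw [← add_div, le_div_iff₀ hp]; linarith
    have hKal : K ^ al ≤ ((x - N) / p) ^ al + ((y - x) / p) ^ al :=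
      (Real.rpow_le_rpow hK hKle hal.le).trans
        (Real.rpow_add_le_add_rpow hw hd hal.le hal1.le)
    have hmem : f N * ((x - N) / p) ^ al ≤ sSup (outputs p al N1 f x) := by
      refine le_csSup (bddAbove_outputs hp hal hf hf0 x) ⟨_, N, hw, hN, ?_, rfl⟩
      rw [mul_div_cancel₀ _ hp.ne']
      linarith
    have h3 := mul_le_mul_of_nonneg_left hKal (hf0.le.trans h2)
    have h4 := mul_le_mul_of_nonneg_right h1 hdal
    linarith
  · have hKle : K ≤ (y - x) / p := by rw [le_div_iff₀ hp]; linarith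
    have h3 : f N * K ^ al ≤ f y * ((y - x) / p) ^ al :=
      mul_le_mul h1 (Real.rpow_le_rpow hK hKle hal.le) (by positivity) (by linarith)
    linarith [sSup_outputs_nonneg hp hal hf hf0 hx]

lemma continuousOn_sSup_outputs (hp : 0 < p) (hal : 0 < al) (hal1 : al < 1)
    (hf : MonotoneOn f (Set.Ici N1)) (hf0 : 0 < f N1) (M : ℝ) :
    ContinuousOn (fun x => sSup (outputs p al N1 f x)) (Set.Icc N1 M) := by
  have key : ∀ x ∈ Set.Icc N1 M, ∀ y ∈ Set.Icc N1 M, x ≤ y →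
      dist (sSup (outputs p al N1 f y)) (sSup (outputs p al N1 f x)) ≤
        f M * (|y - x| / p) ^ al := by
    intro x hx y hy hxy
    have h1 := sSup_outputs_mono hp hal hf hf0 hx.1 hxy
    have h2 := sSup_outputs_le_add hp hal hal1 hf hf0 hx.1 hxy
    have h3 : f y ≤ f M := hf hy.1 (hy.1.trans hy.2) hy.2
    have hd : 0 ≤ (y - x) / p := div_nonneg (by linarith) hp.le
    have h4 := mul_le_mul_of_nonneg_right h3 (Real.rpow_nonneg hd al)
    rw [Real.dist_eq, abs_of_nonneg (by linarith), abs_of_nonneg (sub_nonneg.2 hxy)]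
    linarith
  intro x hx
  rw [ContinuousWithinAt, tendsto_iff_dist_tendsto_zero]
  have hlim : Filter.Tendsto (fun y => f M * (|y - x| / p) ^ al)
      (nhdsWithin x (Set.Icc N1 M)) (nhds 0) := by
    have hc : Continuous fun y : ℝ => f M * (|y - x| / p) ^ al := by
      refine continuous_const.mul (Continuous.rpow_const (by fun_prop) fun _ => Or.inr hal.le)
    have := hc.tendsto x
    simp only [sub_self, abs_zero, zero_div, Real.zero_rpow hal.ne', mul_zero] at this
    exact this.mono_left nhdsWithin_le_nhds
  refine squeeze_zero' (Filter.Eventually.of_forall fun _ => dist_nonneg) ?_ hlim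
  filter_upwards [self_mem_nhdsWithin] with y hy
  rcases le_total x y with h | h
  · exact key x hx y hy h
  · rw [dist_comm, abs_sub_comm]
    exact key y hy x hx h

lemma exists_lt_sSup_outputs (hp : 0 < p) (hal : 0 < al) (hN1 : 0 < N1)
    (hf : MonotoneOn f (Set.Ici N1)) (hf0 : 0 < f N1)
    (hftop : Filter.Tendsto f Filter.atTop Filter.atTop) :
    ∃ M, N1 < M ∧ f N1 * (M / p) ^ al < sSup (outputs p al N1 f M) := by
  obtain ⟨N, hfN, hN⟩ := ((hftop.eventually_gt_atTop (f N1 * 2 ^ al)).and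
    (Filter.eventually_ge_atTop N1)).exists
  have hNp : 0 < N / p := div_pos (hN1.trans_le hN) hp
  refine ⟨2 * N, by linarith, ?_⟩
  have hmem : f N * (N / p) ^ al ≤ sSup (outputs p al N1 f (2 * N)) := by
    refine le_csSup (bddAbove_outputs hp hal hf hf0 _) ⟨_, N, hNp.le, hN, ?_, rfl⟩
    rw [mul_div_cancel₀ _ hp.ne']
    linarith
  rw [mul_div_assoc, Real.mul_rpow two_pos.le hNp.le, ← mul_assoc]
  exact (mul_lt_mul_of_pos_right hfN (Real.rpow_pos_of_pos hNp _)).trans_le hmem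

lemma exists_sSup_outputs_eq (hp : 0 < p) (hal : 0 < al) (hal1 : al < 1) (hN1 : 0 < N1)
    (hf : MonotoneOn f (Set.Ici N1)) (hf0 : 0 < f N1)
    (hftop : Filter.Tendsto f Filter.atTop Filter.atTop) :
    ∃ x, N1 < x ∧ sSup (outputs p al N1 f x) = f N1 * (x / p) ^ al := by
  obtain ⟨M, hM, hlt⟩ := exists_lt_sSup_outputs hp hal hN1 hf hf0 hftop
  have hcont : ContinuousOn
      (fun x => sSup (outputs p al N1 f x) - f N1 * (x / p) ^ al) (Set.Icc N1 M) := by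
    refine (continuousOn_sSup_outputs hp hal hal1 hf hf0 M).sub (Continuous.continuousOn ?_)
    exact continuous_const.mul
      (Continuous.rpow_const (by fun_prop) fun _ => Or.inr hal.le)
  have hneg : 0 < f N1 * (N1 / p) ^ al := by positivity
  obtain ⟨x, hx, hx0⟩ := intermediate_value_Ioo hM.le hcont
    (show (0 : ℝ) ∈ Set.Ioo _ _ from
      ⟨by simp only [sSup_outputs_self hp hal]; linarith, by linarith⟩)
  exact ⟨x, hx.1, by simp only at hx0; linarith⟩

end Outputs

/-- If a·x̄ > A_c, then x ↦ G_1(x) − A_c·x^α/p^α is strictly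
increasing on [N_1, ∞), there is a unique x_2 > N_1 with G_1(x_2) = A_c·x_2^α/p^α,
and b·x_2^σ > x̄. -/
theorem stmt10 (p Ac a b xbar al sg : ℝ)
    (hp : 0 < p) (hAc : 0 < Ac) (ha : 0 < a) (hb : 0 < b) (hxbar : 0 < xbar)
    (hal : 0 < al) (hal1 : al < 1) (hsg : 0 < sg) (hsg1 : sg < 1)
    (hax : a * xbar > Ac)
    (N1 : ℝ) (hN1 : N1 = (xbar / b) ^ (1 / sg))
    (G1 : ℝ → ℝ)
    (hG1 : ∀ x : ℝ, N1 ≤ x →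
      G1 x = sSup {y : ℝ | ∃ K N : ℝ,
        0 ≤ K ∧ 0 ≤ N ∧ b * N ^ sg ≥ xbar ∧ p * K + N ≤ x ∧
        y = (Ac + a * (b * N ^ sg - xbar)) * K ^ al}) :
    StrictMonoOn (fun x => G1 x - Ac * x ^ al / p ^ al) (Set.Ici N1) ∧
    (∃! x2 : ℝ, N1 < x2 ∧ G1 x2 = Ac * x2 ^ al / p ^ al) ∧
    (∀ x2 : ℝ, N1 < x2 → G1 x2 = Ac * x2 ^ al / p ^ al → b * x2 ^ sg > xbar) := by
  have hN1pos : 0 < N1 := by rw [hN1]; positivity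
  have hN1sg : b * N1 ^ sg = xbar := by
    rw [hN1, ← Real.rpow_mul (by positivity), one_div_mul_cancel hsg.ne', Real.rpow_one]
    field_simp
  have hfeas : ∀ N, 0 ≤ N → (xbar ≤ b * N ^ sg ↔ N1 ≤ N) := fun N hN => by
    rw [← hN1sg, mul_le_mul_iff_right₀ hb, Real.rpow_le_rpow_iff hN1pos.le hN hsg]
  set f : ℝ → ℝ := fun N => Ac + a * (b * N ^ sg - xbar) with hfdef
  have hfN1 : f N1 = Ac := by simp [hfdef, hN1sg]
  have hf0 : 0 < f N1 := hfN1 ▸ hAc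
  have hf : MonotoneOn f (Set.Ici N1) := by
    intro N hN N' _ hNN'
    have := Real.rpow_le_rpow (hN1pos.le.trans hN) hNN' hsg.le
    simp only [hfdef]
    gcongr
  have hftop : Filter.Tendsto f Filter.atTop Filter.atTop :=
    Filter.tendsto_atTop_add_const_left _ _ <| Filter.Tendsto.const_mul_atTop ha <|
      Filter.tendsto_atTop_add_const_right _ _ <|
        Filter.Tendsto.const_mul_atTop hb (tendsto_rpow_atTop hsg)
  have hG : ∀ x, N1 ≤ x → G1 x = sSup (outputs p al N1 f x) := fun x hx => by
    rw [hG1 x hx]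
    congr 1
    ext y
    constructor
    · rintro ⟨K, N, hK, hN, hNx, hbud, rfl⟩
      exact ⟨K, N, hK, (hfeas N hN).1 hNx, hbud, rfl⟩
    · rintro ⟨K, N, hK, hN, hbud, rfl⟩
      have hN0 := hN1pos.le.trans hN
      exact ⟨K, N, hK, hN0, (hfeas N hN0).2 hN, hbud, rfl⟩
  have hdiv : ∀ x, N1 ≤ x → Ac * x ^ al / p ^ al = f N1 * (x / p) ^ al := fun x hx => by
    rw [hfN1, Real.div_rpow (hN1pos.le.trans hx) hp.le, mul_div_assoc]
  have hmono : StrictMonoOn (fun x => G1 x - Ac * x ^ al / p ^ al) (Set.Ici N1) :=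
    (strictMonoOn_sSup_outputs_sub hp hal hal1 hN1pos hf hf0).congr fun x hx => by
      simp only [hG x hx, hdiv x hx]
  refine ⟨hmono, ?_, fun x hx _ => ?_⟩
  · obtain ⟨x, hx, hxeq⟩ := exists_sSup_outputs_eq hp hal hal1 hN1pos hf hf0 hftop
    have hxG : G1 x = Ac * x ^ al / p ^ al := by rw [hG x hx.le, hdiv x hx.le, hxeq]
    refine ⟨x, ⟨hx, hxG⟩, fun y ⟨hy, hyG⟩ => ?_⟩
    exact hmono.injOn hy.le hx.le (by simp only [hyG, hxG, sub_self])
  · rw [gt_iff_lt, ← hN1sg]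
    exact mul_lt_mul_of_pos_left (Real.rpow_lt_rpow hN1pos.le hx hsg) hb
end

section
/- Assume a·x̄ > A_c, let N_1 := (x̄/b)^{1/σ} and x_1 := N_1·((α+σ)/σ − (α/σ)·(a·x̄ − A_c)/(a·x̄)). For every x > x_1, the function N ↦ σ·a·b·(x − N)/N + α·(a·x̄ − A_c)/N^σ − α·a·b is strictly decreasing on (0, x], is strictly positive at N = N_1, strictly negative at N = x, and has a unique zero N_x in the open interval (N_1, x). -/
/-- For positive `c` and `x` and nonnegative `d` and `s`, the function
`N ↦ c * (x - N) / N + d / N ^ s - e` is strictly decreasing on the positive reals. -/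
theorem strictAntiOn_mul_sub_div_add_div_rpow {c d e s x : ℝ} (hc : 0 < c) (hd : 0 ≤ d)
    (hs : 0 ≤ s) (hx : 0 < x) :
    StrictAntiOn (fun N : ℝ => c * (x - N) / N + d / N ^ s - e) (Set.Ioi 0) := by
  intro u (hu : 0 < u) v (hv : 0 < v) huv
  have linear_part : c * (x - v) / v < c * (x - u) / u := by
    rw [div_lt_div_iff₀ hv hu]
    nlinarith [mul_pos (mul_pos hc hx) (sub_pos.2 huv)]
  have power_part : d / v ^ s ≤ d / u ^ s :=
    div_le_div_of_nonneg_left hd (Real.rpow_pos_of_pos hu s)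
      (Real.rpow_le_rpow hu.le huv.le hs)
  dsimp only
  linarith

/-- The function `N ↦ c * (x - N) / N + d / N ^ s - e` is continuous on the positive reals. -/
theorem continuousOn_mul_sub_div_add_div_rpow (c d e s x : ℝ) :
    ContinuousOn (fun N : ℝ => c * (x - N) / N + d / N ^ s - e) (Set.Ioi 0) := by
  intro N (hN : 0 < N)
  have hpow : ContinuousAt (fun N : ℝ => N ^ s) N := Real.continuousAt_rpow_const N s (.inl hN.ne')
  have hfrac : ContinuousAt (fun N : ℝ => c * (x - N) / N) N :=
    ContinuousAt.div (by fun_prop) continuousAt_id hN.ne'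
  exact ((hfrac.add (continuousAt_const.div hpow (Real.rpow_pos_of_pos hN s).ne')).sub
    continuousAt_const).continuousWithinAt

/-- With a·x̄ > A_c, N_1 = (x̄/b)^{1/σ} and
x_1 = N_1·((α+σ)/σ − (α/σ)·(a·x̄ − A_c)/(a·x̄)), for every x > x_1 the function
φ(N) = σ·a·b·(x − N)/N + α·(a·x̄ − A_c)/N^σ − α·a·b is strictly decreasing on
(0, x], strictly positive at N_1, strictly negative at x, and has a unique zero
in (N_1, x). -/
theorem stmt11 (a b xbar Ac al sg : ℝ)
    (ha : 0 < a) (hb : 0 < b) (hxbar : 0 < xbar) (hAc : 0 < Ac)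
    (hal : 0 < al) (hal1 : al < 1) (hsg : 0 < sg) (hsg1 : sg < 1)
    (hax : a * xbar > Ac)
    (N1 x1 : ℝ)
    (hN1 : N1 = (xbar / b) ^ (1 / sg))
    (hx1 : x1 = N1 * ((al + sg) / sg - (al / sg) * (a * xbar - Ac) / (a * xbar))) :
    ∀ x : ℝ, x1 < x →
      StrictAntiOn
        (fun N : ℝ => sg * a * b * (x - N) / N + al * (a * xbar - Ac) / N ^ sg - al * a * b)
        (Set.Ioc 0 x) ∧
      0 < sg * a * b * (x - N1) / N1 + al * (a * xbar - Ac) / N1 ^ sg - al * a * b ∧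
      sg * a * b * (x - x) / x + al * (a * xbar - Ac) / x ^ sg - al * a * b < 0 ∧
      ∃! Nx : ℝ, Nx ∈ Set.Ioo N1 x ∧
        sg * a * b * (x - Nx) / Nx + al * (a * xbar - Ac) / Nx ^ sg - al * a * b = 0 := by
  intro x hx
  have hratio : 0 < xbar / b := div_pos hxbar hb
  have hN1pos : 0 < N1 := hN1 ▸ Real.rpow_pos_of_pos hratio _
  have hN1pow : N1 ^ sg = xbar / b := by
    rw [hN1, ← Real.rpow_mul hratio.le, one_div_mul_cancel hsg.ne', Real.rpow_one]
  have hx1_eq : x1 = N1 * (sg * a * xbar + al * Ac) / (sg * a * xbar) := by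
    rw [hx1]
    field_simp
    ring
  have hthreshold : N1 * (sg * a * xbar + al * Ac) < x * (sg * a * xbar) := by
    rwa [hx1_eq, div_lt_iff₀ (by positivity)] at hx
  have hN1x : N1 < x := by
    have hpos : 0 < sg * a * xbar := by positivity
    have hextra : 0 < N1 * (al * Ac) := by positivity
    refine lt_of_mul_lt_mul_right ?_ hpos.le
    linarith
  have hxpos : 0 < x := hN1pos.trans hN1x
  have hanti := strictAntiOn_mul_sub_div_add_div_rpow (c := sg * a * b)
    (d := al * (a * xbar - Ac)) (e := al * a * b) (by positivity)
    (mul_nonneg hal.le (sub_pos.2 hax).le) hsg.le hxpos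
  have hpos_N1 :
      0 < sg * a * b * (x - N1) / N1 + al * (a * xbar - Ac) / N1 ^ sg - al * a * b := by
    have hvalue : sg * a * b * (x - N1) / N1 + al * (a * xbar - Ac) / N1 ^ sg - al * a * b =
        b * (x * (sg * a * xbar) - N1 * (sg * a * xbar + al * Ac)) / (N1 * xbar) := by
      rw [hN1pow]
      field_simp
      ring
    rw [hvalue]
    exact div_pos (mul_pos hb (sub_pos.2 hthreshold)) (mul_pos hN1pos hxbar)
  have hneg_x : sg * a * b * (x - x) / x + al * (a * xbar - Ac) / x ^ sg - al * a * b < 0 := by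
    have hpow : xbar < x ^ sg * b := by
      rw [← div_lt_iff₀ hb, ← hN1pow]
      exact Real.rpow_lt_rpow hN1pos.le hN1x hsg
    have hfrac : al * (a * xbar - Ac) / x ^ sg < al * a * b := by
      rw [div_lt_iff₀ (Real.rpow_pos_of_pos hxpos sg)]
      nlinarith [mul_pos (mul_pos hal ha) (sub_pos.2 hpow), mul_pos hal hAc]
    rw [sub_self, mul_zero, zero_div]
    linarith
  refine ⟨hanti.mono Set.Ioc_subset_Ioi_self, hpos_N1, hneg_x, ?_⟩
  obtain ⟨Nx, hNx, hzero⟩ := intermediate_value_Ioo' hN1x.le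
    ((continuousOn_mul_sub_div_add_div_rpow (sg * a * b) (al * (a * xbar - Ac))
      (al * a * b) sg x).mono fun N hN => hN1pos.trans_le hN.1) ⟨hneg_x, hpos_N1⟩
  refine ⟨Nx, ⟨hNx, hzero⟩, fun M ⟨hM, hMzero⟩ => ?_⟩
  exact hanti.injOn (hN1pos.trans hM.1) (hN1pos.trans hNx.1) (hMzero.trans hzero.symm)
end

section
/- There exists a unique x* > 0 such that F(x*) = x*. Moreover, F(x) ≤ x* for every x with 0 ≤ x ≤ x*, and F(x) ≤ x for every x ≥ x*. -/
/-- A function monotone on `[0, ∞)` that is subhomogeneous of degree `b < 1` and satisfies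
`x ≤ f x` at some `x > 0` has a positive fixed point. -/
theorem exists_pos_fixedPoint_of_subhomogeneous {f : ℝ → ℝ} {b x₀ : ℝ} (hb1 : b < 1)
    (hmono : ∀ S T, 0 ≤ S → S ≤ T → f S ≤ f T)
    (hscale : ∀ S l, 1 ≤ l → f (l * S) ≤ l ^ b * f S)
    (hx₀ : 0 < x₀) (hfx₀ : x₀ ≤ f x₀) :
    ∃ x : ℝ, 0 < x ∧ f x = x := by
  set A : Set ℝ := {x | 0 < x ∧ x ≤ f x}
  have hbdd : BddAbove A := by
    refine ⟨max 1 (f 1 ^ (1 - b)⁻¹), fun x hx => ?_⟩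
    obtain ⟨hx0, hxf⟩ := hx
    rcases le_total x 1 with h | h
    · exact h.trans (le_max_left _ _)
    refine le_trans ?_ (le_max_right _ _)
    have hs := hxf.trans (by simpa using hscale 1 x h)
    have hpow : x ^ (1 - b) ≤ f 1 := by
      rw [Real.rpow_sub hx0, Real.rpow_one, div_le_iff₀ (Real.rpow_pos_of_pos hx0 b)]
      linarith
    calc x = (x ^ (1 - b)) ^ (1 - b)⁻¹ := by
          rw [Real.rpow_rpow_inv hx0.le (by linarith)]
      _ ≤ f 1 ^ (1 - b)⁻¹ :=
          Real.rpow_le_rpow (by positivity) hpow (by simpa using hb1.le)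
  have hpos : 0 < sSup A := hx₀.trans_le (le_csSup hbdd ⟨hx₀, hfx₀⟩)
  have hle : sSup A ≤ f (sSup A) :=
    csSup_le ⟨x₀, hx₀, hfx₀⟩ fun x hx =>
      hx.2.trans (hmono _ _ hx.1.le (le_csSup hbdd hx))
  exact ⟨sSup A, hpos, le_antisymm
    (le_csSup hbdd ⟨hpos.trans_le hle, hmono _ _ hpos.le hle⟩) hle⟩

/-- Beyond a positive fixed point, a function subhomogeneous of degree `b < 1` lies strictly
below the diagonal. -/
theorem lt_self_of_subhomogeneous {f : ℝ → ℝ} {b x y : ℝ} (hb1 : b < 1)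
    (hscale : ∀ S l, 1 ≤ l → f (l * S) ≤ l ^ b * f S)
    (hx : 0 < x) (hfx : f x = x) (hxy : x < y) : f y < y := by
  have hl : 1 < y / x := (one_lt_div hx).2 hxy
  have hs := hscale x (y / x) hl.le
  have hlt : (y / x) ^ b < y / x := by
    simpa using Real.rpow_lt_rpow_of_exponent_lt hl hb1
  rw [div_mul_cancel₀ _ hx.ne', hfx] at hs
  calc f y ≤ (y / x) ^ b * x := hs
    _ < y / x * x := mul_lt_mul_of_pos_right hlt hx
    _ = y := div_mul_cancel₀ _ hx.ne'

/-- The output values attainable with budget `S` when the technologies are `a * K ^ α` and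
`c * H ^ β` and the first input costs `p` per unit. -/
def attainableOutputs (p a c α β S : ℝ) : Set ℝ :=
  {y | ∃ K H : ℝ, 0 ≤ K ∧ 0 ≤ H ∧ p * K + H ≤ S ∧ y = a * K ^ α + c * H ^ β}

section attainableOutputs

variable {p a c α β S : ℝ}

theorem attainableOutputs_mono {T : ℝ} (hST : S ≤ T) :
    attainableOutputs p a c α β S ⊆ attainableOutputs p a c α β T := by
  rintro y ⟨K, H, hK, hH, hKH, rfl⟩
  exact ⟨K, H, hK, hH, hKH.trans hST, rfl⟩

theorem mem_attainableOutputs_of_nonneg (hα : 0 < α) (hS : 0 ≤ S) :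
    c * S ^ β ∈ attainableOutputs p a c α β S :=
  ⟨0, S, le_rfl, hS, by simp, by simp [Real.zero_rpow hα.ne']⟩

theorem attainableOutputs_eq_empty (hp : 0 < p) (hS : S < 0) :
    attainableOutputs p a c α β S = ∅ := by
  refine Set.eq_empty_of_forall_notMem ?_
  rintro y ⟨K, H, hK, hH, hKH, -⟩
  have := mul_nonneg hp.le hK
  linarith

theorem bddAbove_attainableOutputs (hp : 0 < p) (ha : 0 ≤ a) (hc : 0 ≤ c) (hα : 0 ≤ α)
    (hβ : 0 ≤ β) : BddAbove (attainableOutputs p a c α β S) := by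
  refine ⟨a * (S / p) ^ α + c * S ^ β, ?_⟩
  rintro y ⟨K, H, hK, hH, hKH, rfl⟩
  have hpK := mul_nonneg hp.le hK
  have hKS : K ≤ S / p := by rw [le_div_iff₀ hp]; linarith
  have hHS : H ≤ S := by linarith
  gcongr

theorem sSup_attainableOutputs_mul_le (hp : 0 < p) (ha : 0 ≤ a) (hc : 0 ≤ c) (hα : 0 < α)
    (hβ : 0 < β) {l : ℝ} (hl : 1 ≤ l) :
    sSup (attainableOutputs p a c α β (l * S)) ≤
      l ^ max α β * sSup (attainableOutputs p a c α β S) := by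
  have hl0 : 0 < l := by linarith
  rcases lt_or_ge S 0 with hS | hS
  · simp [attainableOutputs_eq_empty hp hS,
      attainableOutputs_eq_empty hp (mul_neg_of_pos_of_neg hl0 hS)]
  refine csSup_le ⟨_, mem_attainableOutputs_of_nonneg hα (by positivity)⟩ ?_
  rintro y ⟨K, H, hK, hH, hKH, rfl⟩
  have hmem : a * (K / l) ^ α + c * (H / l) ^ β ∈ attainableOutputs p a c α β S := by
    refine ⟨K / l, H / l, by positivity, by positivity, ?_, rfl⟩
    rw [← mul_div_assoc, ← add_div, div_le_iff₀ hl0]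
    linarith
  have hpow : ∀ {x γ : ℝ}, 0 ≤ x → γ ≤ max α β → x ^ γ ≤ l ^ max α β * (x / l) ^ γ := by
    intro x γ hx hγ
    calc x ^ γ = l ^ γ * (x / l) ^ γ := by
          rw [← Real.mul_rpow hl0.le (by positivity), mul_div_cancel₀ _ hl0.ne']
      _ ≤ l ^ max α β * (x / l) ^ γ := by gcongr
  calc a * K ^ α + c * H ^ β
      ≤ a * (l ^ max α β * (K / l) ^ α) + c * (l ^ max α β * (H / l) ^ β) := by
        gcongr
        · exact hpow hK (le_max_left _ _)
        · exact hpow hH (le_max_right _ _)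
    _ = l ^ max α β * (a * (K / l) ^ α + c * (H / l) ^ β) := by ring
    _ ≤ l ^ max α β * sSup (attainableOutputs p a c α β S) := by
        gcongr
        exact le_csSup (bddAbove_attainableOutputs hp ha hc hα.le hβ.le) hmem

end attainableOutputs

/-- There exists a unique x* > 0 with F(x*) = x*; moreover
F(x) ≤ x* for all 0 ≤ x ≤ x* and F(x) ≤ x for all x ≥ x*. -/
theorem stmt12 (p Ac w Ah al ah : ℝ)
    (hp : 0 < p) (hAc : 0 < Ac) (hw : 0 < w) (hAh : 0 < Ah)
    (hal : 0 < al) (hal1 : al < 1) (hah : 0 < ah) (hah1 : ah < 1)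
    (F : ℝ → ℝ)
    (hF : ∀ S : ℝ, F S = sSup {y : ℝ | ∃ K H : ℝ,
      0 ≤ K ∧ 0 ≤ H ∧ p * K + H ≤ S ∧ y = Ac * K ^ al + w * Ah * H ^ ah}) :
    ∃ xstar : ℝ, 0 < xstar ∧ F xstar = xstar ∧
      (∀ y : ℝ, 0 < y → F y = y → y = xstar) ∧
      (∀ x : ℝ, 0 ≤ x → x ≤ xstar → F x ≤ xstar) ∧
      (∀ x : ℝ, xstar ≤ x → F x ≤ x) := by
  have hc : 0 < w * Ah := mul_pos hw hAh
  have hb1 : max al ah < 1 := max_lt hal1 hah1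
  have hF_eq : ∀ S, F S = sSup (attainableOutputs p Ac (w * Ah) al ah S) := hF
  have hbdd : ∀ S, BddAbove (attainableOutputs p Ac (w * Ah) al ah S) := fun _ =>
    bddAbove_attainableOutputs hp hAc.le hc.le hal.le hah.le
  have hmono : ∀ S T, 0 ≤ S → S ≤ T → F S ≤ F T := by
    intro S T hS hST
    rw [hF_eq, hF_eq]
    exact csSup_le_csSup (hbdd T) ⟨_, mem_attainableOutputs_of_nonneg hal hS⟩
      (attainableOutputs_mono hST)
  have hscale : ∀ S l, 1 ≤ l → F (l * S) ≤ l ^ max al ah * F S := by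
    intro S l hl
    rw [hF_eq, hF_eq]
    exact sSup_attainableOutputs_mul_le hp hAc.le hc.le hal hah hl
  set x₀ : ℝ := (w * Ah) ^ (1 - ah)⁻¹
  have hx₀ : 0 < x₀ := Real.rpow_pos_of_pos hc _
  have hfx₀ : x₀ ≤ F x₀ := by
    have heq : w * Ah * x₀ ^ ah = x₀ := by
      have hroot : x₀ ^ (1 - ah) = w * Ah := Real.rpow_inv_rpow hc.le (by linarith)
      rw [← hroot, ← Real.rpow_add hx₀, sub_add_cancel, Real.rpow_one]
    calc x₀ = w * Ah * x₀ ^ ah := heq.symm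
      _ ≤ F x₀ := by
        rw [hF_eq]
        exact le_csSup (hbdd _) (mem_attainableOutputs_of_nonneg hal hx₀.le)
  obtain ⟨x, hx, hfx⟩ := exists_pos_fixedPoint_of_subhomogeneous hb1 hmono hscale hx₀ hfx₀
  refine ⟨x, hx, hfx, fun y hy hfy => ?_, fun y hy hyx => (hmono y x hy hyx).trans hfx.le,
    fun y hxy => ?_⟩
  · rcases lt_trichotomy y x with h | h | h
    · exact absurd hfx (lt_self_of_subhomogeneous hb1 hscale hy hfy h).ne
    · exact h
    · exact absurd hfy (lt_self_of_subhomogeneous hb1 hscale hx hfx h).ne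
  · rcases hxy.eq_or_lt with rfl | h
    · exact hfx.le
    · exact (lt_self_of_subhomogeneous hb1 hscale hx hfx h).le
end

section
/- Let x* > 0 be the unique positive fixed point of F, and assume b·(x*)^σ ≤ x̄. Then for every S ∈ [0, x*] one has G(S) = F(S) and G(S) ≤ x*. Consequently, every sequence (S_t)_{t≥0} of nonnegative reals with S_0 ≤ x* and S_{t+1} ≤ G(S_t) for all t satisfies S_t ≤ x* for all t. -/
/-- Let x* > 0 be the unique positive fixed point of F and
assume b·(x*)^σ ≤ x̄. Then G(S) = F(S) and G(S) ≤ x* for every S ∈ [0, x*], and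
every sequence (S_t) of nonnegative reals with S_0 ≤ x* and S_{t+1} ≤ G(S_t)
stays below x*. -/
theorem stmt13 (p Ac w Ah a b xbar al ah sg : ℝ)
    (hp : 0 < p) (hAc : 0 < Ac) (hw : 0 < w) (hAh : 0 < Ah)
    (ha : 0 < a) (hb : 0 < b) (hxbar : 0 < xbar)
    (hal : 0 < al) (hal1 : al < 1) (hah : 0 < ah) (hah1 : ah < 1)
    (hsg : 0 < sg) (hsg1 : sg < 1)
    (F G : ℝ → ℝ)
    (hF : ∀ S : ℝ, F S = sSup {y : ℝ | ∃ K H : ℝ,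
      0 ≤ K ∧ 0 ≤ H ∧ p * K + H ≤ S ∧ y = Ac * K ^ al + w * Ah * H ^ ah})
    (hG : ∀ S : ℝ, G S = sSup {y : ℝ | ∃ K N H : ℝ,
      0 ≤ K ∧ 0 ≤ N ∧ 0 ≤ H ∧ p * K + N + H ≤ S ∧
      y = (Ac + a * max (b * N ^ sg - xbar) 0) * K ^ al + w * Ah * H ^ ah})
    (xstar : ℝ) (hxstar : 0 < xstar) (hfix : F xstar = xstar)
    (huniq : ∀ y : ℝ, 0 < y → F y = y → y = xstar)
    (hcond : b * xstar ^ sg ≤ xbar) :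
    (∀ S : ℝ, 0 ≤ S → S ≤ xstar → G S = F S ∧ G S ≤ xstar) ∧
    (∀ Sseq : ℕ → ℝ, (∀ t, 0 ≤ Sseq t) → Sseq 0 ≤ xstar →
      (∀ t, Sseq (t + 1) ≤ G (Sseq t)) → ∀ t, Sseq t ≤ xstar) := by
  have hmono : ∀ S : ℝ, 0 ≤ S → S ≤ xstar → F S ≤ xstar := by
    intro S hS hSx
    rw [← hfix, hF S, hF xstar]
    refine csSup_le_csSup ?_ ⟨_, 0, 0, le_rfl, le_rfl, by simpa using hS, rfl⟩ ?_
    · refine ⟨Ac * (xstar / p) ^ al + w * Ah * xstar ^ ah, ?_⟩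
      rintro y ⟨K, H, hK, hH, hKH, rfl⟩
      have hpK : 0 ≤ p * K := by positivity
      have hKx : K ≤ xstar / p := by
        rw [le_div_iff₀ hp]
        linarith
      have hHx : H ≤ xstar := by linarith
      gcongr
    · rintro y ⟨K, H, hK, hH, hKH, rfl⟩
      exact ⟨K, H, hK, hH, hKH.trans hSx, rfl⟩
  have heq : ∀ S : ℝ, S ≤ xstar → G S = F S := by
    intro S hSx
    rw [hG, hF]
    congr 1
    ext y
    constructor
    · rintro ⟨K, N, H, hK, hN, hH, hKNH, rfl⟩
      have hpK : 0 ≤ p * K := by positivity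
      have hNx : N ≤ xstar := by linarith
      have hbN : b * N ^ sg ≤ b * xstar ^ sg := by gcongr
      refine ⟨K, H, hK, hH, by linarith, ?_⟩
      rw [max_eq_right (by linarith), mul_zero, add_zero]
    · rintro ⟨K, H, hK, hH, hKH, rfl⟩
      refine ⟨K, 0, H, hK, le_rfl, hH, by linarith, ?_⟩
      rw [Real.zero_rpow hsg.ne', max_eq_right (by linarith), mul_zero, add_zero]
  have hle : ∀ S : ℝ, 0 ≤ S → S ≤ xstar → G S ≤ xstar := fun S hS hSx =>
    (heq S hSx).trans_le (hmono S hS hSx)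
  refine ⟨fun S hS hSx => ⟨heq S hSx, hle S hS hSx⟩, ?_⟩
  intro Sseq hnonneg hinit hstep t
  induction t with
  | zero => exact hinit
  | succ t ih => exact (hstep t).trans (hle _ (hnonneg t) ih)
end

section
/- Assume α + σ ≥ 1 and a·x̄ > A_c. Then for every ε > 0 there exists M > 0 such that for every S > M and every maximizer (K, N, H) of the problem defining G(S), the shares θ_c := p·K/S, θ_n := N/S, θ_h := H/S satisfy |θ_c − α/(α+σ)| < ε, |θ_n − σ/(α+σ)| < ε and θ_h < ε. -/
open Filter Topology

/-- Strict weighted AM-GM: on the triangle `x, y ≥ 0`, `x + y ≤ 1`, the Cobb-Douglas function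
`x ^ s * y ^ t` has its only maximum at `(s / (s + t), t / (s + t))`. -/
theorem rpow_mul_rpow_lt_of_ne {s t x y : ℝ} (hs : 0 < s) (ht : 0 < t) (hx : 0 ≤ x) (hy : 0 ≤ y)
    (hxy : x + y ≤ 1) (hne : x ≠ s / (s + t) ∨ y ≠ t / (s + t)) :
    x ^ s * y ^ t < (s / (s + t)) ^ s * (t / (s + t)) ^ t := by
  have hst : 0 < s + t := by positivity
  rcases hx.eq_or_lt with rfl | hx
  · rw [Real.zero_rpow hs.ne', zero_mul]
    positivity
  rcases hy.eq_or_lt with rfl | hy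
  · rw [Real.zero_rpow ht.ne', mul_zero]
    positivity
  set u := x / (s / (s + t)) with hu
  set v := y / (t / (s + t)) with hv
  have hu0 : 0 < u := by positivity
  have hv0 : 0 < v := by positivity
  have hsu : s * u = (s + t) * x := by rw [hu]; field_simp
  have htv : t * v = (s + t) * y := by rw [hv]; field_simp
  have hlog : s * Real.log u + t * Real.log v < 0 := by
    have hle : s * (u - 1) + t * (v - 1) ≤ 0 := by nlinarith
    have h1 := mul_le_mul_of_nonneg_left (Real.log_le_sub_one_of_pos hu0) hs.le
    have h2 := mul_le_mul_of_nonneg_left (Real.log_le_sub_one_of_pos hv0) ht.le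
    rcases hne with h | h
    · have : u ≠ 1 := fun h' => h ((div_eq_one_iff_eq (by positivity)).1 h')
      have := mul_lt_mul_of_pos_left (Real.log_lt_sub_one_of_pos hu0 this) hs
      linarith
    · have : v ≠ 1 := fun h' => h ((div_eq_one_iff_eq (by positivity)).1 h')
      have := mul_lt_mul_of_pos_left (Real.log_lt_sub_one_of_pos hv0 this) ht
      linarith
  have hlt : u ^ s * v ^ t < 1 := by
    rw [Real.rpow_def_of_pos hu0, Real.rpow_def_of_pos hv0, ← Real.exp_add, Real.exp_lt_one_iff]
    linarith
  have hprod : u ^ s * v ^ t =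
      x ^ s * y ^ t / ((s / (s + t)) ^ s * (t / (s + t)) ^ t) := by
    rw [hu, hv, Real.div_rpow hx.le (by positivity), Real.div_rpow hy.le (by positivity),
      div_mul_div_comm]
  rwa [hprod, div_lt_one (by positivity)] at hlt

/-- Near-maximizers of `x ^ s * y ^ t` on the triangle are near the maximizer. -/
theorem exists_pos_forall_abs_sub_lt_of_rpow_mul_rpow {s t ε : ℝ} (hs : 0 < s) (ht : 0 < t)
    (hε : 0 < ε) :
    ∃ δ : ℝ, 0 < δ ∧ ∀ x y : ℝ, 0 ≤ x → 0 ≤ y → x + y ≤ 1 →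
      (s / (s + t)) ^ s * (t / (s + t)) ^ t < x ^ s * y ^ t + δ →
      |x - s / (s + t)| < ε ∧ |y - t / (s + t)| < ε := by
  set T : Set (ℝ × ℝ) := {q | 0 ≤ q.1 ∧ 0 ≤ q.2 ∧ q.1 + q.2 ≤ 1 ∧
    (ε ≤ |q.1 - s / (s + t)| ∨ ε ≤ |q.2 - t / (s + t)|)} with hT
  have hclosed : IsClosed T := by
    simp only [hT, Set.ofPred_and, Set.ofPred_or]
    refine IsClosed.inter ?_ (IsClosed.inter ?_ (IsClosed.inter ?_ (IsClosed.union ?_ ?_))) <;>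
      exact isClosed_le (by fun_prop) (by fun_prop)
  have hcompact : IsCompact T := by
    refine (isCompact_Icc (a := ((0 : ℝ), (0 : ℝ))) (b := (1, 1))).of_isClosed_subset hclosed ?_
    rintro ⟨x, y⟩ ⟨hx, hy, hxy, -⟩
    simp only at hx hy hxy
    exact ⟨⟨hx, hy⟩, ⟨by simp only; linarith, by simp only; linarith⟩⟩
  have hcont : Continuous fun q : ℝ × ℝ => q.1 ^ s * q.2 ^ t :=
    (continuous_fst.rpow_const fun _ => Or.inr hs.le).mul
      (continuous_snd.rpow_const fun _ => Or.inr ht.le)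
  suffices h : ∃ δ : ℝ, 0 < δ ∧ ∀ q ∈ T,
      q.1 ^ s * q.2 ^ t + δ ≤ (s / (s + t)) ^ s * (t / (s + t)) ^ t by
    obtain ⟨δ, hδ, h⟩ := h
    refine ⟨δ, hδ, fun x y hx hy hxy hlt => ?_⟩
    by_contra hcon
    rw [not_and_or, not_lt, not_lt] at hcon
    exact (h (x, y) ⟨hx, hy, hxy, hcon⟩).not_gt hlt
  rcases T.eq_empty_or_nonempty with hempty | hne
  · exact ⟨1, one_pos, by simp [hempty]⟩
  obtain ⟨q, ⟨hq1, hq2, hq, hfar⟩, hmax⟩ := hcompact.exists_isMaxOn hne hcont.continuousOn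
  have hqne : q.1 ≠ s / (s + t) ∨ q.2 ≠ t / (s + t) := by
    refine hfar.imp ?_ ?_ <;>
    · intro h h'
      rw [h', sub_self, abs_zero] at h
      exact h.not_gt hε
  refine ⟨_, sub_pos.2 (rpow_mul_rpow_lt_of_ne hs ht hq1 hq2 hq hqne), fun r hr => ?_⟩
  have : r.1 ^ s * r.2 ^ t ≤ q.1 ^ s * q.2 ^ t := hmax hr
  linarith

/-- Two lower powers are eventually negligible against a higher one. -/
theorem eventually_add_mul_rpow_lt {r₁ r₂ r c₁ c₂ δ : ℝ} (h₁ : r₁ < r) (h₂ : r₂ < r)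
    (hδ : 0 < δ) : ∀ᶠ S : ℝ in atTop, c₁ * S ^ r₁ + c₂ * S ^ r₂ < δ * S ^ r := by
  have hlim : Tendsto (fun S : ℝ => c₁ * S ^ (-(r - r₁)) + c₂ * S ^ (-(r - r₂))) atTop (𝓝 0) := by
    simpa using ((tendsto_rpow_neg_atTop (sub_pos.2 h₁)).const_mul c₁).add
      ((tendsto_rpow_neg_atTop (sub_pos.2 h₂)).const_mul c₂)
  filter_upwards [hlim.eventually (gt_mem_nhds hδ), eventually_gt_atTop 0] with S hS hpos
  have h := mul_lt_mul_of_pos_right hS (Real.rpow_pos_of_pos hpos r)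
  rwa [add_mul, mul_assoc, mul_assoc, ← Real.rpow_add hpos, ← Real.rpow_add hpos,
    show -(r - r₁) + r = r₁ by ring, show -(r - r₂) + r = r₂ by ring] at h

/-- The objective is at most its Cobb-Douglas part plus terms of lower order in the budget. -/
theorem objective_le {p Ac w Ah a b xbar al ah sg S K N H : ℝ}
    (hp : 0 < p) (hAc : 0 < Ac) (hw : 0 < w) (hAh : 0 < Ah) (ha : 0 < a) (hb : 0 < b)
    (hxbar : 0 < xbar) (hal : 0 < al) (hah : 0 < ah) (hK : 0 ≤ K) (hN : 0 ≤ N) (hH : 0 ≤ H)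
    (hS : p * K + N + H ≤ S) :
    (Ac + a * max (b * N ^ sg - xbar) 0) * K ^ al + w * Ah * H ^ ah ≤
      a * b * (K ^ al * N ^ sg) + (Ac * (S / p) ^ al + w * Ah * S ^ ah) := by
  have hpK : 0 ≤ p * K := by positivity
  have hKS : K ^ al ≤ (S / p) ^ al :=
    Real.rpow_le_rpow hK (by rw [le_div_iff₀ hp]; linarith) hal.le
  have hHS : H ^ ah ≤ S ^ ah := Real.rpow_le_rpow hH (by linarith) hah.le
  have hmax : max (b * N ^ sg - xbar) 0 ≤ b * N ^ sg := max_le (by linarith) (by positivity)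
  calc (Ac + a * max (b * N ^ sg - xbar) 0) * K ^ al + w * Ah * H ^ ah
      ≤ (Ac + a * (b * N ^ sg)) * K ^ al + w * Ah * H ^ ah := by gcongr
    _ = a * b * (K ^ al * N ^ sg) + (Ac * K ^ al + w * Ah * H ^ ah) := by ring
    _ ≤ _ := by gcongr

/-- Under α + σ ≥ 1 and a·x̄ > A_c, for every ε > 0 there is
M > 0 such that for all S > M and all maximizers (K, N, H) of the problem
defining G(S): |p·K/S − α/(α+σ)| < ε, |N/S − σ/(α+σ)| < ε and H/S < ε. -/
theorem stmt14 (p Ac w Ah a b xbar al ah sg : ℝ)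
    (hp : 0 < p) (hAc : 0 < Ac) (hw : 0 < w) (hAh : 0 < Ah)
    (ha : 0 < a) (hb : 0 < b) (hxbar : 0 < xbar)
    (hal : 0 < al) (hal1 : al < 1) (hah : 0 < ah) (hah1 : ah < 1)
    (hsg : 0 < sg) (hsg1 : sg < 1)
    (hrs : 1 ≤ al + sg) (hax : a * xbar > Ac)
    (G : ℝ → ℝ)
    (hG : ∀ S : ℝ, G S = sSup {y : ℝ | ∃ K N H : ℝ,
      0 ≤ K ∧ 0 ≤ N ∧ 0 ≤ H ∧ p * K + N + H ≤ S ∧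
      y = (Ac + a * max (b * N ^ sg - xbar) 0) * K ^ al + w * Ah * H ^ ah}) :
    ∀ ε : ℝ, 0 < ε → ∃ M : ℝ, 0 < M ∧
      ∀ S : ℝ, M < S →
        ∀ K N H : ℝ, 0 ≤ K → 0 ≤ N → 0 ≤ H → p * K + N + H ≤ S →
          (Ac + a * max (b * N ^ sg - xbar) 0) * K ^ al + w * Ah * H ^ ah = G S →
          |p * K / S - al / (al + sg)| < ε ∧ |N / S - sg / (al + sg)| < ε ∧
            H / S < ε := by
  intro ε hε
  obtain ⟨δ, hδ, hnear⟩ :=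
    exists_pos_forall_abs_sub_lt_of_rpow_mul_rpow hal hsg (half_pos hε)
  have hsum : 0 < al + sg := by positivity
  have hP : 0 < p ^ al := Real.rpow_pos_of_pos hp al
  obtain ⟨M, hM⟩ := eventually_atTop.1 (eventually_add_mul_rpow_lt
    (r₁ := al) (r₂ := ah) (r := al + sg) (c₁ := (Ac + a * xbar) / p ^ al) (c₂ := w * Ah)
    (δ := a * b / p ^ al * δ) (by linarith) (by linarith) (by positivity))
  refine ⟨max M 1, by positivity, fun S hMS K N H hK hN hH hbudget hopt => ?_⟩
  have hS : 0 < S := one_pos.trans ((le_max_right M 1).trans_lt hMS)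
  have hsmall := hM S ((le_max_left M 1).trans hMS.le)
  have hscale : ∀ x y : ℝ, 0 ≤ x → 0 ≤ y →
      (x * S / p) ^ al * (y * S) ^ sg = x ^ al * y ^ sg * S ^ (al + sg) / p ^ al := by
    intro x y hx hy
    rw [Real.div_rpow (by positivity) hp.le, Real.mul_rpow hx hS.le, Real.mul_rpow hy hS.le,
      Real.rpow_add hS]
    ring
  have hSp : (S / p) ^ al = S ^ al / p ^ al := Real.div_rpow hS.le hp.le al
  set x₀ := al / (al + sg) with hx₀
  set y₀ := sg / (al + sg) with hy₀
  have hx₀0 : 0 < x₀ := by positivity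
  have hy₀0 : 0 < y₀ := by positivity
  have hxy₀ : x₀ + y₀ = 1 := by rw [hx₀, hy₀]; field_simp
  have hbdd : BddAbove {y : ℝ | ∃ K N H : ℝ,
      0 ≤ K ∧ 0 ≤ N ∧ 0 ≤ H ∧ p * K + N + H ≤ S ∧
      y = (Ac + a * max (b * N ^ sg - xbar) 0) * K ^ al + w * Ah * H ^ ah} := by
    refine ⟨a * b * ((S / p) ^ al * S ^ sg) + (Ac * (S / p) ^ al + w * Ah * S ^ ah), ?_⟩
    rintro _ ⟨K, N, H, hK, hN, hH, hbudget, rfl⟩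
    refine (objective_le hp hAc hw hAh ha hb hxbar hal hah hK hN hH hbudget).trans ?_
    have hpK : 0 ≤ p * K := by positivity
    have hKS : K ≤ S / p := by rw [le_div_iff₀ hp]; linarith
    have hNS : N ≤ S := by linarith
    gcongr
  have hlower : a * b * ((x₀ * S / p) ^ al * (y₀ * S) ^ sg) - a * xbar * (S / p) ^ al ≤ G S := by
    rw [hG S]
    refine le_trans ?_ (le_csSup hbdd ⟨x₀ * S / p, y₀ * S, 0, by positivity, by positivity, le_rfl,
      ?_, rfl⟩)
    · have hle : (x₀ * S / p) ^ al ≤ (S / p) ^ al := by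
        gcongr
        nlinarith
      have hmax := le_max_left (b * (y₀ * S) ^ sg - xbar) 0
      rw [Real.zero_rpow hah.ne', mul_zero, add_zero]
      calc a * b * ((x₀ * S / p) ^ al * (y₀ * S) ^ sg) - a * xbar * (S / p) ^ al
          ≤ a * b * ((x₀ * S / p) ^ al * (y₀ * S) ^ sg) - a * xbar * (x₀ * S / p) ^ al := by
            gcongr
        _ = (0 + a * (b * (y₀ * S) ^ sg - xbar)) * (x₀ * S / p) ^ al := by ring
        _ ≤ _ := by gcongr
    · have : p * (x₀ * S / p) + y₀ * S + 0 = (x₀ + y₀) * S := by field_simp; ring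
      rw [this, hxy₀, one_mul]
  have hupper := objective_le (sg := sg) hp hAc hw hAh ha hb hxbar hal hah hK hN hH hbudget
  have hx : 0 ≤ p * K / S := by positivity
  have hy : 0 ≤ N / S := by positivity
  have hz : 0 ≤ H / S := by positivity
  have hxyz : p * K / S + N / S + H / S ≤ 1 := by
    rw [← add_div, ← add_div, div_le_one hS]
    exact hbudget
  have hKN : K ^ al * N ^ sg = (p * K / S) ^ al * (N / S) ^ sg * S ^ (al + sg) / p ^ al := by
    rw [← hscale _ _ hx hy, div_mul_cancel₀ _ hS.ne', div_mul_cancel₀ _ hS.ne',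
      mul_div_cancel_left₀ _ hp.ne']
  have hvalue : x₀ ^ al * y₀ ^ sg < (p * K / S) ^ al * (N / S) ^ sg + δ := by
    rw [hscale _ _ hx₀0.le hy₀0.le, hSp] at hlower
    rw [hKN, hSp, hopt] at hupper
    have hc : 0 < a * b / p ^ al * S ^ (al + sg) := by positivity
    refine lt_of_mul_lt_mul_left ?_ hc.le
    ring_nf at hlower hupper hsmall ⊢
    linarith
  obtain ⟨h1, h2⟩ := hnear _ _ hx hy (by linarith) hvalue
  refine ⟨by linarith, by linarith, ?_⟩
  have h1' := (abs_lt.1 h1).1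
  have h2' := (abs_lt.1 h2).1
  linarith
end

section
/- Assume a·x̄ > A_c and α + σ ≥ 1, let S* > 0 be the unique threshold such that G(S) = F(S) for all 0 ≤ S ≤ S* and G(S) > F(S) for all S > S*, and suppose F is differentiable at S* with derivative F'(S*). Then for every S > 0, the upper right Dini derivative D⁺G(S) := limsup_{ε → 0⁺} (G(S+ε) − G(S))/ε satisfies D⁺G(S) ≥ min(F'(S*), Γ(a,b,x̄)). -/
open Filter Topology

/-- The output of the consumption sector with capital `K` and adoption expenditure `N`. -/
noncomputable def sectorOutput (Ac a b xbar al sg K N : ℝ) : ℝ :=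
  (Ac + a * max (b * N ^ sg - xbar) 0) * K ^ al

lemma exists_max_of_isCompact {E : Type*} [TopologicalSpace E] {s : Set E} (hs : IsCompact s)
    (hne : s.Nonempty) {f : E → ℝ} (hf : Continuous f) {T : Set ℝ} (hT : T = f '' s) :
    (∃ x ∈ s, sSup T = f x) ∧ ∀ x ∈ s, f x ≤ sSup T := by
  subst hT
  refine ⟨?_, fun x hx => le_csSup (hs.image hf).bddAbove ⟨x, hx, rfl⟩⟩
  obtain ⟨x, hx, h⟩ := (hs.image hf).sSup_mem (hne.image f)
  exact ⟨x, hx, h.symm⟩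

/-- Attainment in the problem without adoption. -/
lemma baseline_max {p Ac c al ah S : ℝ} (hp : 0 < p) (hal : 0 < al) (hah : 0 < ah) (hS : 0 ≤ S)
    {v : ℝ} (hv : v = sSup {y : ℝ | ∃ K H : ℝ,
      0 ≤ K ∧ 0 ≤ H ∧ p * K + H ≤ S ∧ y = Ac * K ^ al + c * H ^ ah}) :
    (∃ K H : ℝ, 0 ≤ K ∧ 0 ≤ H ∧ p * K + H ≤ S ∧ v = Ac * K ^ al + c * H ^ ah) ∧
    ∀ K H : ℝ, 0 ≤ K → 0 ≤ H → p * K + H ≤ S → Ac * K ^ al + c * H ^ ah ≤ v := by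
  have hcomp : IsCompact {x : ℝ × ℝ | 0 ≤ x.1 ∧ 0 ≤ x.2 ∧ p * x.1 + x.2 ≤ S} := by
    refine IsCompact.of_isClosed_subset (isCompact_Icc.prod isCompact_Icc : IsCompact
      (Set.Icc (0 : ℝ) (S / p) ×ˢ Set.Icc (0 : ℝ) S)) ?_ ?_
    · exact (isClosed_le continuous_const continuous_fst).inter
        ((isClosed_le continuous_const continuous_snd).inter
          (isClosed_le ((continuous_const.mul continuous_fst).add continuous_snd)
            continuous_const))
    · rintro ⟨K, H⟩ ⟨h1, h2, h3⟩
      simp only at h1 h2 h3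
      have := mul_nonneg hp.le h1
      exact ⟨⟨h1, (le_div_iff₀ hp).2 (by linarith)⟩, h2, by simp only; linarith⟩
  have hcont : Continuous fun x : ℝ × ℝ => Ac * x.1 ^ al + c * x.2 ^ ah :=
    (continuous_const.mul (continuous_fst.rpow_const fun _ => Or.inr hal.le)).add
      (continuous_const.mul (continuous_snd.rpow_const fun _ => Or.inr hah.le))
  obtain ⟨⟨⟨K, H⟩, hx, h⟩, hle⟩ := exists_max_of_isCompact hcomp ⟨(0, 0), by simp [hS]⟩ hcont
    (T := {y : ℝ | ∃ K H : ℝ,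
      0 ≤ K ∧ 0 ≤ H ∧ p * K + H ≤ S ∧ y = Ac * K ^ al + c * H ^ ah}) (by
      ext y
      constructor
      · rintro ⟨K, H, h1, h2, h3, rfl⟩
        exact ⟨(K, H), ⟨h1, h2, h3⟩, rfl⟩
      · rintro ⟨⟨K, H⟩, ⟨h1, h2, h3⟩, rfl⟩
        exact ⟨K, H, h1, h2, h3, rfl⟩)
  rw [← hv] at h hle
  exact ⟨⟨K, H, hx.1, hx.2.1, hx.2.2, h⟩, fun K H h1 h2 h3 => hle (K, H) ⟨h1, h2, h3⟩⟩

/-- Attainment, with a binding budget, in the problem with adoption. -/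
lemma adoption_max {p Ac c a b xbar al ah sg S : ℝ} (hp : 0 < p) (hc : 0 < c)
    (hal : 0 < al) (hah : 0 < ah) (hsg : 0 < sg) (hS : 0 ≤ S)
    {v : ℝ} (hv : v = sSup {y : ℝ | ∃ K N H : ℝ,
      0 ≤ K ∧ 0 ≤ N ∧ 0 ≤ H ∧ p * K + N + H ≤ S ∧
      y = (Ac + a * max (b * N ^ sg - xbar) 0) * K ^ al + c * H ^ ah}) :
    (∃ K N H : ℝ, 0 ≤ K ∧ 0 ≤ N ∧ 0 ≤ H ∧ p * K + N + H = S ∧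
      v = sectorOutput Ac a b xbar al sg K N + c * H ^ ah) ∧
    ∀ K N H : ℝ, 0 ≤ K → 0 ≤ N → 0 ≤ H → p * K + N + H ≤ S →
      sectorOutput Ac a b xbar al sg K N + c * H ^ ah ≤ v := by
  have hcomp : IsCompact {x : ℝ × ℝ × ℝ | 0 ≤ x.1 ∧ 0 ≤ x.2.1 ∧ 0 ≤ x.2.2 ∧
      p * x.1 + x.2.1 + x.2.2 ≤ S} := by
    refine IsCompact.of_isClosed_subset
      (isCompact_Icc.prod (isCompact_Icc.prod isCompact_Icc) : IsCompact
        (Set.Icc (0 : ℝ) (S / p) ×ˢ Set.Icc (0 : ℝ) S ×ˢ Set.Icc (0 : ℝ) S)) ?_ ?_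
    · have hc2 : Continuous fun x : ℝ × ℝ × ℝ => x.2.1 := by fun_prop
      have hc3 : Continuous fun x : ℝ × ℝ × ℝ => x.2.2 := by fun_prop
      exact (isClosed_le continuous_const continuous_fst).inter
        ((isClosed_le continuous_const hc2).inter
          ((isClosed_le continuous_const hc3).inter
            (isClosed_le (((continuous_const.mul continuous_fst).add hc2).add hc3)
              continuous_const)))
    · rintro ⟨K, N, H⟩ ⟨h1, h2, h3, h4⟩
      simp only at h1 h2 h3 h4
      have := mul_nonneg hp.le h1
      exact ⟨⟨h1, (le_div_iff₀ hp).2 (by linarith)⟩, ⟨h2, by simp only; linarith⟩,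
        h3, by simp only; linarith⟩
  have hcont : Continuous fun x : ℝ × ℝ × ℝ =>
      sectorOutput Ac a b xbar al sg x.1 x.2.1 + c * x.2.2 ^ ah := by
    have hK : Continuous fun x : ℝ × ℝ × ℝ => x.1 ^ al :=
      continuous_fst.rpow_const fun _ => Or.inr hal.le
    have hN : Continuous fun x : ℝ × ℝ × ℝ => x.2.1 ^ sg :=
      (continuous_fst.comp continuous_snd).rpow_const fun _ => Or.inr hsg.le
    have hH : Continuous fun x : ℝ × ℝ × ℝ => x.2.2 ^ ah :=
      (continuous_snd.comp continuous_snd).rpow_const fun _ => Or.inr hah.le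
    unfold sectorOutput
    fun_prop
  obtain ⟨⟨⟨K, N, H⟩, hx, h⟩, hle⟩ :=
    exists_max_of_isCompact hcomp ⟨(0, 0, 0), by simp [hS]⟩ hcont
    (T := {y : ℝ | ∃ K N H : ℝ,
      0 ≤ K ∧ 0 ≤ N ∧ 0 ≤ H ∧ p * K + N + H ≤ S ∧
      y = (Ac + a * max (b * N ^ sg - xbar) 0) * K ^ al + c * H ^ ah}) (by
      ext y
      constructor
      · rintro ⟨K, N, H, h1, h2, h3, h4, rfl⟩
        exact ⟨(K, N, H), ⟨h1, h2, h3, h4⟩, rfl⟩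
      · rintro ⟨⟨K, N, H⟩, ⟨h1, h2, h3, h4⟩, rfl⟩
        exact ⟨K, N, H, h1, h2, h3, h4, rfl⟩)
  rw [← hv] at h hle
  have hle' : ∀ K N H : ℝ, 0 ≤ K → 0 ≤ N → 0 ≤ H → p * K + N + H ≤ S →
      sectorOutput Ac a b xbar al sg K N + c * H ^ ah ≤ v :=
    fun K N H h1 h2 h3 h4 => hle (K, N, H) ⟨h1, h2, h3, h4⟩
  obtain ⟨h1, h2, h3, h4⟩ := hx
  simp only at h h1 h2 h3 h4
  have h5 : 0 ≤ S - p * K - N := by linarith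
  refine ⟨⟨K, N, S - p * K - N, h1, h2, h5, by ring, le_antisymm ?_ ?_⟩, hle'⟩
  · rw [h]
    gcongr
    linarith
  · exact hle' _ _ _ h1 h2 h5 (by linarith)

/-- A lower bound for `limsup` at `0⁺` of a function that is bounded above. -/
lemma le_limsup_of_tendsto_le {q r : ℝ → ℝ} {L C : ℝ}
    (hC : ∀ᶠ ε in 𝓝[>] (0 : ℝ), q ε ≤ C) (hr : Tendsto r (𝓝[>] 0) (𝓝 L))
    (hle : ∀ᶠ ε in 𝓝[>] (0 : ℝ), r ε ≤ q ε) : L ≤ limsup q (𝓝[>] 0) := by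
  rw [← hr.limsup_eq]
  exact limsup_le_limsup hle hr.isBoundedUnder_ge.isCoboundedUnder_le ⟨C, by simpa using hC⟩

/-- The right difference quotient of a function differentiable at `x` tends to the derivative. -/
lemma tendsto_right_quotient {f : ℝ → ℝ} {f' x : ℝ} (h : HasDerivAt f f' x) :
    Tendsto (fun ε => (f (x + ε) - f x) / ε) (𝓝[>] 0) (𝓝 f') := by
  have := h.tendsto_slope_zero_right
  refine this.congr fun ε => ?_
  rw [smul_eq_mul, div_eq_inv_mul]

/-- The left difference quotient of a function differentiable at `x` tends to the derivative. -/
lemma tendsto_left_quotient {f : ℝ → ℝ} {f' x : ℝ} (h : HasDerivAt f f' x) :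
    Tendsto (fun ε => (f x - f (x - ε)) / ε) (𝓝[>] 0) (𝓝 f') := by
  have h1 : HasDerivAt (fun y => -f (-y)) f' (-x) := by
    have := (HasDerivAt.comp (-x) (by simpa using h) (hasDerivAt_neg (-x))).neg
    rwa [mul_neg_one, neg_neg] at this
  refine (tendsto_right_quotient h1).congr fun ε => ?_
  simp only [neg_neg, neg_add_rev]
  ring_nf

lemma baseline_concave {p Ac c al ah : ℝ} (hp : 0 < p) (hAc : 0 < Ac) (hc : 0 < c)
    (hal : 0 < al) (hal1 : al < 1) (hah : 0 < ah) (hah1 : ah < 1) {F : ℝ → ℝ}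
    (hF : ∀ S : ℝ, F S = sSup {y : ℝ | ∃ K H : ℝ,
      0 ≤ K ∧ 0 ≤ H ∧ p * K + H ≤ S ∧ y = Ac * K ^ al + c * H ^ ah}) :
    ConcaveOn ℝ (Set.Ici 0) F := by
  refine ⟨convex_Ici 0, fun x hx y hy u v hu hv huv => ?_⟩
  obtain ⟨K, H, hK, hH, hb, h⟩ := (baseline_max hp hal hah hx (hF x)).1
  obtain ⟨K', H', hK', hH', hb', h'⟩ := (baseline_max hp hal hah hy (hF y)).1
  simp only [smul_eq_mul]
  have hle := (baseline_max hp hal hah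
    (add_nonneg (mul_nonneg hu hx) (mul_nonneg hv hy)) (hF (u * x + v * y))).2
    (u * K + v * K') (u * H + v * H') (by positivity) (by positivity)
    (by nlinarith [mul_le_mul_of_nonneg_left hb hu, mul_le_mul_of_nonneg_left hb' hv])
  refine le_trans ?_ hle
  have e1 := (Real.concaveOn_rpow hal.le hal1.le).2 hK hK' hu hv huv
  have e2 := (Real.concaveOn_rpow hah.le hah1.le).2 hH hH' hu hv huv
  simp only [smul_eq_mul] at e1 e2
  rw [h, h']
  nlinarith [mul_le_mul_of_nonneg_left e1 hAc.le, mul_le_mul_of_nonneg_left e2 hc.le]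

/-- To the left of a point of differentiability, chords of a concave function are at least as
steep as the tangent there. -/
lemma ConcaveOn.deriv_le_quotient {F : ℝ → ℝ} (hF : ConcaveOn ℝ (Set.Ici 0) F) {z F' : ℝ}
    (hz : HasDerivAt F F' z) {x y : ℝ} (hx : 0 ≤ x) (hxy : x < y) (hyz : y < z) :
    F' ≤ (F y - F x) / (y - x) := by
  have h1 := hF.slope_anti_adjacent (x := x) (y := y) (z := z) hx
    (Set.mem_Ici.2 (by linarith)) hxy hyz
  have h2 := hF.le_slope_of_hasDerivAt (x := y) (y := z) (Set.mem_Ici.2 (by linarith))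
    (Set.mem_Ici.2 (by linarith)) hyz hz
  rw [slope_def_field] at h2
  exact h2.trans h1

/-- The value function with adoption is Lipschitz to the right of a positive point. -/
lemma adoption_quotient_le {p Ac c a b xbar al ah sg : ℝ} (hp : 0 < p) (hAc : 0 < Ac)
    (hc : 0 < c) (ha : 0 < a) (hb : 0 < b)
    (hal : 0 < al) (hal1 : al < 1) (hah : 0 < ah) (hah1 : ah < 1)
    (hsg : 0 < sg) (hsg1 : sg < 1) {G : ℝ → ℝ}
    (hG : ∀ S : ℝ, G S = sSup {y : ℝ | ∃ K N H : ℝ,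
      0 ≤ K ∧ 0 ≤ N ∧ 0 ≤ H ∧ p * K + N + H ≤ S ∧
      y = (Ac + a * max (b * N ^ sg - xbar) 0) * K ^ al + c * H ^ ah})
    {S : ℝ} (hS : 0 < S) :
    ∃ C : ℝ, ∀ᶠ ε in 𝓝[>] (0 : ℝ), (G (S + ε) - G S) / ε ≤ C := by
  set M := G (S + 1) + a * b * (S + 1) ^ sg * ((S + 1) / p) ^ al
  refine ⟨M / S, ?_⟩
  filter_upwards [Ioo_mem_nhdsGT (zero_lt_one' ℝ)] with ε hε
  obtain ⟨hε0, hε1⟩ := hε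
  obtain ⟨K, N, H, hK, hN, hH, hbud, hval⟩ :=
    (adoption_max hp hc hal hah hsg (by linarith) (hG (S + ε))).1
  have hpK := mul_nonneg hp.le hK
  have hV : G (S + ε) ≤ G (S + 1) := by
    rw [hval]
    exact (adoption_max hp hc hal hah hsg (by linarith) (hG (S + 1))).2 K N H hK hN hH
      (by linarith)
  have hNK : a * b * N ^ sg * K ^ al ≤ a * b * (S + 1) ^ sg * ((S + 1) / p) ^ al := by
    have : K ≤ (S + 1) / p := (le_div_iff₀ hp).2 (by linarith)
    gcongr
    linarith
  set t := S / (S + ε) with ht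
  have ht0 : 0 < t := by positivity
  have ht1 : t ≤ 1 := (div_le_one (by positivity)).2 (by linarith)
  have htS : t * (S + ε) = S := by rw [ht]; field_simp
  have hle := (adoption_max hp hc hal hah hsg hS.le (hG S)).2 (t * K) (t * N) (t * H)
    (by positivity) (by positivity) (by positivity) (by rw [← htS, ← hbud]; linarith)
  have hpow : ∀ s : ℝ, s < 1 → t ≤ t ^ s := fun s hs => by
    simpa using Real.rpow_le_rpow_of_exponent_ge ht0 ht1 hs.le
  have hM0 : 0 ≤ G (S + ε) := by
    rw [hval, sectorOutput]
    positivity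
  have key : G (S + ε) - (1 - t) * (G (S + ε) + a * b * N ^ sg * K ^ al) ≤ G S := by
    refine le_trans ?_ hle
    have e1 : (t * K) ^ al = t ^ al * K ^ al := Real.mul_rpow ht0.le hK
    have e2 : (t * N) ^ sg = t ^ sg * N ^ sg := Real.mul_rpow ht0.le hN
    have e3 : (t * H) ^ ah = t ^ ah * H ^ ah := Real.mul_rpow ht0.le hH
    have hKa : 0 ≤ K ^ al := by positivity
    have hNs : 0 ≤ N ^ sg := by positivity
    have hHa : 0 ≤ H ^ ah := by positivity
    rw [hval, sectorOutput, sectorOutput, e1, e2, e3]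
    have f3 : t * H ^ ah ≤ t ^ ah * H ^ ah := by gcongr; exact hpow ah hah1
    have f1 : t * K ^ al ≤ t ^ al * K ^ al := by gcongr; exact hpow al hal1
    have f2 : max (b * N ^ sg - xbar) 0 - (1 - t) * (b * N ^ sg)
        ≤ max (b * (t ^ sg * N ^ sg) - xbar) 0 := by
      have h2 : b * (t * N ^ sg) ≤ b * (t ^ sg * N ^ sg) := by gcongr; exact hpow sg hsg1
      have h3 : 0 ≤ (1 - t) * (b * N ^ sg) :=
        mul_nonneg (by linarith) (by positivity)
      rcases max_cases (b * N ^ sg - xbar) 0 with ⟨h, _⟩ | ⟨h, _⟩ <;> rw [h]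
      · exact le_trans (by nlinarith) (le_max_left _ _)
      · exact le_trans (by linarith) (le_max_right _ _)
    set X := max (b * N ^ sg - xbar) 0
    set Y := max (b * (t ^ sg * N ^ sg) - xbar) 0
    have hY0 : 0 ≤ Y := le_max_right _ _
    have g1 : (Ac + a * Y) * (t * K ^ al) ≤ (Ac + a * Y) * (t ^ al * K ^ al) := by gcongr
    have g2 : (Ac + a * (X - (1 - t) * (b * N ^ sg))) * (t * K ^ al)
        ≤ (Ac + a * Y) * (t * K ^ al) := by gcongr
    have g3 : c * (t * H ^ ah) ≤ c * (t ^ ah * H ^ ah) := by gcongr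
    have g4 : 0 ≤ (1 - t) * ((1 - t) * (a * b * N ^ sg * K ^ al)) :=
      mul_nonneg (by linarith) (mul_nonneg (by linarith) (by positivity))
    linarith
  have ht' : (1 - t) * (S + ε) = ε := by linarith
  have h1t : 1 - t ≤ ε / S := by
    rw [le_div_iff₀ hS]
    nlinarith
  rw [div_le_iff₀ hε0]
  have hMp : 0 ≤ G (S + ε) + a * b * N ^ sg * K ^ al := by positivity
  calc G (S + ε) - G S ≤ (1 - t) * (G (S + ε) + a * b * N ^ sg * K ^ al) := by linarith
    _ ≤ ε / S * M := by
        apply mul_le_mul h1t (by linarith) hMp (by positivity)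
    _ = M / S * ε := by ring

/-- At an optimum the home sector receives a positive amount. -/
lemma home_pos {p Ac c a b xbar al ah sg : ℝ} (hp : 0 < p) (hAc : 0 < Ac)
    (hc : 0 < c) (ha : 0 < a) (hb : 0 < b)
    (hal : 0 < al) (hal1 : al < 1) (hah : 0 < ah) (hah1 : ah < 1)
    (hsg : 0 < sg) (hsg1 : sg < 1) {G : ℝ → ℝ}
    (hG : ∀ S : ℝ, G S = sSup {y : ℝ | ∃ K N H : ℝ,
      0 ≤ K ∧ 0 ≤ N ∧ 0 ≤ H ∧ p * K + N + H ≤ S ∧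
      y = (Ac + a * max (b * N ^ sg - xbar) 0) * K ^ al + c * H ^ ah})
    {S K N H : ℝ} (hS : 0 < S) (hK : 0 ≤ K) (hN : 0 ≤ N) (hH : 0 ≤ H)
    (hbud : p * K + N + H = S) (hval : G S = sectorOutput Ac a b xbar al sg K N + c * H ^ ah) :
    0 < H := by
  rcases hH.lt_or_eq with h | rfl
  · exact h
  obtain ⟨C, hC⟩ := adoption_quotient_le hp hAc hc ha hb hal hal1 hah hah1 hsg hsg1 hG hS
  have hlim : Tendsto (fun ε : ℝ => c * ε ^ (ah - 1)) (𝓝[>] 0) atTop :=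
    (tendsto_rpow_neg_nhdsGT_zero (by linarith)).const_mul_atTop hc
  obtain ⟨ε, h1, h2, hε⟩ := (hC.and ((hlim.eventually_gt_atTop C).and
    (eventually_mem_nhdsWithin (s := Set.Ioi (0 : ℝ))))).exists
  simp only [Set.mem_Ioi] at hε
  have hle := (adoption_max hp hc hal hah hsg (by linarith) (hG (S + ε))).2 K N ε hK hN hε.le
    (by linarith)
  rw [Real.zero_rpow hah.ne'] at hval
  rw [Real.rpow_sub_one hε.ne', ← mul_div_assoc] at h2
  have : c * ε ^ ah / ε ≤ (G (S + ε) - G S) / ε := by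
    gcongr
    linarith
  linarith

/-- At an optimum with adoption, the sector output dominates its tangent line along rescalings
of the sector inputs, and the slope is the marginal product of the home sector. -/
lemma sectorOutput_tangent {p Ac c a b xbar al ah sg : ℝ} (hp : 0 < p)
    (hc : 0 < c) (ha : 0 < a) (hb : 0 < b)
    (hal : 0 < al) (hal1 : al < 1) (hah : 0 < ah)
    (hsg : 0 < sg) (hax : a * xbar > Ac) (hrs : 1 ≤ al + sg) {G : ℝ → ℝ}
    (hG : ∀ S : ℝ, G S = sSup {y : ℝ | ∃ K N H : ℝ,
      0 ≤ K ∧ 0 ≤ N ∧ 0 ≤ H ∧ p * K + N + H ≤ S ∧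
      y = (Ac + a * max (b * N ^ sg - xbar) 0) * K ^ al + c * H ^ ah})
    {S K N H : ℝ} (hS : 0 < S) (hK : 0 ≤ K) (hN : 0 ≤ N) (hH : 0 < H)
    (hbud : p * K + N + H = S) (hval : G S = sectorOutput Ac a b xbar al sg K N + c * H ^ ah)
    (hadopt : xbar ≤ b * N ^ sg) :
    a * b * N ^ sg * K ^ al * (al + sg) - (a * xbar - Ac) * K ^ al * al
        = (S - H) * (c * (ah * H ^ (ah - 1))) ∧
    ∀ t : ℝ, 0 ≤ t → sectorOutput Ac a b xbar al sg K N
        + (t - 1) * ((S - H) * (c * (ah * H ^ (ah - 1))))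
      ≤ sectorOutput Ac a b xbar al sg (t * K) (t * N) := by
  set C := a * b * N ^ sg * K ^ al with hCdef
  set D := (a * xbar - Ac) * K ^ al with hDdef
  have hC0 : 0 ≤ C := by positivity
  have hD0 : 0 ≤ D := mul_nonneg (by linarith) (by positivity)
  have hone : sectorOutput Ac a b xbar al sg K N = C - D := by
    rw [sectorOutput, max_eq_left (by linarith)]
    ring
  have hlow : ∀ t : ℝ, 0 ≤ t → C * t ^ (al + sg) - D * t ^ al
      ≤ sectorOutput Ac a b xbar al sg (t * K) (t * N) := by
    intro t ht
    rw [sectorOutput, Real.mul_rpow ht hK, Real.mul_rpow ht hN,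
      Real.rpow_add_of_nonneg ht hal.le hsg.le]
    have h0 : 0 ≤ t ^ al * K ^ al := by positivity
    have := mul_le_mul_of_nonneg_right (mul_le_mul_of_nonneg_left
      (le_max_left (b * (t ^ sg * N ^ sg) - xbar) 0) ha.le) h0
    rw [hCdef, hDdef]
    nlinarith
  have hfoc : C * (al + sg) - D * al = (S - H) * (c * (ah * H ^ (ah - 1))) := by
    set f : ℝ → ℝ := fun t => C * t ^ (al + sg) - D * t ^ al + c * (S - t * (S - H)) ^ ah
    have hmax : IsLocalMax f 1 := by
      have h1 : ∀ᶠ t : ℝ in 𝓝 1, 0 < t := lt_mem_nhds one_pos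
      have h2 : ∀ᶠ t : ℝ in 𝓝 1, 0 < S - t * (S - H) := by
        have : ContinuousAt (fun t : ℝ => S - t * (S - H)) 1 := by fun_prop
        exact this.eventually_const_lt (by simpa using hH)
      filter_upwards [h1, h2] with t ht1 ht2
      have hle := (adoption_max hp hc hal hah hsg hS.le (hG S)).2 (t * K) (t * N)
        (S - t * (S - H)) (by positivity) (by positivity) ht2.le (by rw [← hbud]; linarith)
      have := hlow t ht1.le
      simp only [f, Real.one_rpow, one_mul, sub_sub_cancel, mul_one]
      linarith
    have hd1 := (Real.hasDerivAt_rpow_const (x := 1) (p := al + sg) (Or.inl one_ne_zero)).const_mul C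
    have hd2 := (Real.hasDerivAt_rpow_const (x := 1) (p := al) (Or.inl one_ne_zero)).const_mul D
    have hd3 : HasDerivAt (fun t : ℝ => S - t * (S - H)) (-(S - H)) 1 := by
      simpa using ((hasDerivAt_id (1 : ℝ)).mul_const (S - H)).const_sub S
    have hd4 := (hd3.rpow_const (p := ah) (Or.inl (by simpa using hH.ne'))).const_mul c
    have := hmax.hasDerivAt_eq_zero ((hd1.sub hd2).add hd4)
    simp only [Real.one_rpow, one_mul, sub_sub_cancel, mul_one] at this
    linarith
  refine ⟨hfoc, fun t ht => le_trans ?_ (hlow t ht)⟩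
  have b1 := one_add_mul_self_le_rpow_one_add (s := t - 1) (by linarith) hrs
  have b2 := rpow_one_add_le_one_add_mul_self (s := t - 1) (by linarith) hal.le hal1.le
  rw [add_sub_cancel] at b1 b2
  rw [← hfoc, hone]
  nlinarith [mul_le_mul_of_nonneg_left b1 hC0, mul_le_mul_of_nonneg_left b2 hD0]

lemma rpow_add_rpow_lt {c ah x y d : ℝ} (hc : 0 < c) (hah : 0 < ah) (hah1 : ah < 1) (hx : 0 ≤ x)
    (hd : 0 < d) (hdy : x + d < y) :
    c * x ^ ah + c * y ^ ah < c * (x + d) ^ ah + c * (y - d) ^ ah := by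
  have hcv := Real.strictConcaveOn_rpow hah hah1
  have hxy : 0 < y - x := by linarith
  have hu : 0 < d / (y - x) := by positivity
  have hu1 : d / (y - x) < 1 := (div_lt_one hxy).2 (by linarith)
  have hmul : d / (y - x) * (y - x) = d := div_mul_cancel₀ _ hxy.ne'
  set u := d / (y - x)
  have h1 := hcv.2 (Set.mem_Ici.2 hx) (Set.mem_Ici.2 (by linarith : 0 ≤ y)) (by linarith)
    (sub_pos.2 hu1) hu (by ring)
  have h2 := hcv.2 (Set.mem_Ici.2 hx) (Set.mem_Ici.2 (by linarith : 0 ≤ y)) (by linarith)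
    hu (sub_pos.2 hu1) (by ring)
  simp only [smul_eq_mul] at h1 h2
  rw [show (1 - u) * x + u * y = x + d by linear_combination hmul] at h1
  rw [show u * x + (1 - u) * y = y - d by linear_combination -hmul] at h2
  nlinarith

/-- Among optima with adoption, home expenditure is antitone in the budget. -/
lemma home_antitone {p Ac c a b xbar al ah sg : ℝ} (hp : 0 < p)
    (hc : 0 < c) (ha : 0 < a) (hb : 0 < b) (hxbar : 0 < xbar)
    (hal : 0 < al) (hal1 : al < 1) (hah : 0 < ah) (hah1 : ah < 1)
    (hsg : 0 < sg) (hax : a * xbar > Ac) (hrs : 1 ≤ al + sg) {G : ℝ → ℝ}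
    (hG : ∀ S : ℝ, G S = sSup {y : ℝ | ∃ K N H : ℝ,
      0 ≤ K ∧ 0 ≤ N ∧ 0 ≤ H ∧ p * K + N + H ≤ S ∧
      y = (Ac + a * max (b * N ^ sg - xbar) 0) * K ^ al + c * H ^ ah})
    {S₁ K₁ N₁ H₁ S₂ K₂ N₂ H₂ : ℝ} (hS₁ : 0 < S₁) (hS : S₁ < S₂)
    (hK₁ : 0 ≤ K₁) (hN₁ : 0 ≤ N₁) (hH₁ : 0 < H₁) (hbud₁ : p * K₁ + N₁ + H₁ = S₁)
    (hval₁ : G S₁ = sectorOutput Ac a b xbar al sg K₁ N₁ + c * H₁ ^ ah)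
    (hadopt₁ : xbar ≤ b * N₁ ^ sg)
    (hK₂ : 0 ≤ K₂) (hN₂ : 0 ≤ N₂) (hH₂ : 0 < H₂) (hbud₂ : p * K₂ + N₂ + H₂ = S₂)
    (hval₂ : G S₂ = sectorOutput Ac a b xbar al sg K₂ N₂ + c * H₂ ^ ah)
    (hadopt₂ : xbar ≤ b * N₂ ^ sg) : H₂ ≤ H₁ := by
  by_contra! hlt
  have hS₂ : 0 < S₂ := hS₁.trans hS
  have hN_pos : ∀ N : ℝ, 0 ≤ N → xbar ≤ b * N ^ sg → 0 < N := by
    intro N hN h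
    rcases hN.lt_or_eq with h' | rfl
    · exact h'
    · rw [Real.zero_rpow hsg.ne'] at h
      linarith
  have hT₁ : 0 < S₁ - H₁ := by nlinarith [hN_pos N₁ hN₁ hadopt₁]
  have hT₂ : 0 < S₂ - H₂ := by nlinarith [hN_pos N₂ hN₂ hadopt₂]
  have hle₁ := (adoption_max hp hc hal hah hsg hS₁.le (hG S₁)).2
  have hle₂ := (adoption_max hp hc hal hah hsg hS₂.le (hG S₂)).2
  have hmarg : c * (ah * H₂ ^ (ah - 1)) < c * (ah * H₁ ^ (ah - 1)) := by
    have := Real.rpow_lt_rpow_of_neg hH₁ hlt (sub_neg.2 hah1)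
    gcongr c * (ah * ?_)
  obtain ⟨hfoc₁, htan₁⟩ := sectorOutput_tangent hp hc ha hb hal hal1 hah hsg hax hrs hG hS₁ hK₁
    hN₁ hH₁ hbud₁ hval₁ hadopt₁
  rcases lt_trichotomy (S₁ - H₁) (S₂ - H₂) with h | h | h
  · have htan₂ := (sectorOutput_tangent hp hc ha hb hal hal1 hah hsg hax hrs hG hS₂ hK₂
      hN₂ hH₂ hbud₂ hval₂ hadopt₂).2
    set t := (S₂ - H₂) / (S₁ - H₁)
    set s := (S₁ - H₁) / (S₂ - H₂)
    have ht0 : 0 < t := by positivity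
    have hs0 : 0 < s := by positivity
    have htT : t * (S₁ - H₁) = S₂ - H₂ := div_mul_cancel₀ _ hT₁.ne'
    have hsT : s * (S₂ - H₂) = S₁ - H₁ := div_mul_cancel₀ _ hT₂.ne'
    have i1 := htan₁ t ht0.le
    have i2 := htan₂ s hs0.le
    have j2 := hle₂ (t * K₁) (t * N₁) H₂ (by positivity) (by positivity) hH₂.le
      (by rw [← hbud₁] at htT; linarith)
    have j1 := hle₁ (s * K₂) (s * N₂) H₁ (by positivity) (by positivity) hH₁.le
      (by rw [← hbud₂] at hsT; linarith)
    set m₁ := c * (ah * H₁ ^ (ah - 1))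
    set m₂ := c * (ah * H₂ ^ (ah - 1))
    rw [show (t - 1) * ((S₁ - H₁) * m₁) = ((S₂ - H₂) - (S₁ - H₁)) * m₁ by
      rw [← htT]; ring] at i1
    rw [show (s - 1) * ((S₂ - H₂) * m₂) = ((S₁ - H₁) - (S₂ - H₂)) * m₂ by
      rw [← hsT]; ring] at i2
    nlinarith [mul_lt_mul_of_pos_left hmarg (sub_pos.2 h)]
  · have j2 := hle₂ K₁ N₁ H₂ hK₁ hN₁ hH₂.le (by linarith)
    have j1 := hle₁ K₂ N₂ H₁ hK₂ hN₂ hH₁.le (by linarith)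
    have hfoc := (sectorOutput_tangent hp hc ha hb hal hal1 hah hsg hax hrs hG hS₂ hK₁
      hN₁ hH₂ (by linarith) (by linarith) hadopt₁).1
    rw [hfoc₁, h] at hfoc
    exact hmarg.ne' (mul_left_cancel₀ hT₂.ne' hfoc)
  · have hd : 0 < (S₁ - H₁) - (S₂ - H₂) := sub_pos.2 h
    have j1 := hle₁ K₂ N₂ (H₁ + ((S₁ - H₁) - (S₂ - H₂))) hK₂ hN₂ (by linarith) (by linarith)
    have j2 := hle₂ K₁ N₁ (H₂ - ((S₁ - H₁) - (S₂ - H₂))) hK₁ hN₁ (by linarith) (by linarith)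
    have := rpow_add_rpow_lt (y := H₂) hc hah hah1 hH₁.le hd (by linarith)
    linarith


/-- Under a·x̄ > A_c and α + σ ≥ 1, with S* the threshold where
G switches from F and F differentiable at S*, for every S > 0 the upper right
Dini derivative of G at S is at least min(F'(S*), Γ(a,b,x̄)). -/
theorem stmt15 (p Ac w Ah a b xbar al ah sg : ℝ)
    (hp : 0 < p) (hAc : 0 < Ac) (hw : 0 < w) (hAh : 0 < Ah)
    (ha : 0 < a) (hb : 0 < b) (hxbar : 0 < xbar)
    (hal : 0 < al) (hal1 : al < 1) (hah : 0 < ah) (hah1 : ah < 1)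
    (hsg : 0 < sg) (hsg1 : sg < 1)
    (hax : a * xbar > Ac) (hrs : 1 ≤ al + sg)
    (F G : ℝ → ℝ)
    (hF : ∀ S : ℝ, F S = sSup {y : ℝ | ∃ K H : ℝ,
      0 ≤ K ∧ 0 ≤ H ∧ p * K + H ≤ S ∧ y = Ac * K ^ al + w * Ah * H ^ ah})
    (hG : ∀ S : ℝ, G S = sSup {y : ℝ | ∃ K N H : ℝ,
      0 ≤ K ∧ 0 ≤ N ∧ 0 ≤ H ∧ p * K + N + H ≤ S ∧
      y = (Ac + a * max (b * N ^ sg - xbar) 0) * K ^ al + w * Ah * H ^ ah})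
    (Sstar : ℝ) (hSstar : 0 < Sstar)
    (hbelow : ∀ S : ℝ, 0 ≤ S → S ≤ Sstar → G S = F S)
    (habove : ∀ S : ℝ, Sstar < S → G S > F S)
    (F'Sstar : ℝ) (hdiff : HasDerivAt F F'Sstar Sstar)
    (Γ : ℝ)
    (hΓ : Γ = ((al * Ac / (p * sg)) ^ al
        * xbar ^ (-(1 - al) * (1 - sg) / sg) * a ^ (1 - al) * b ^ ((1 - al) / sg))
      / (1 + al / sg
          + (ah * w * Ah * (p * sg) ^ al / (sg * (al * Ac) ^ al)) ^ (1 / (1 - ah))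
            * a ^ (-(1 - al) / (1 - ah)) * b ^ (-(ah - al) / (sg * (1 - ah)))) ^ al) :
    ∀ S : ℝ, 0 < S →
      min F'Sstar Γ ≤
        Filter.limsup (fun ε : ℝ => (G (S + ε) - G S) / ε) (nhdsWithin 0 (Set.Ioi 0)) := by
  intro S hS
  refine (min_le_left _ _).trans ?_
  have hc : 0 < w * Ah := mul_pos hw hAh
  obtain ⟨C, hC⟩ := adoption_quotient_le hp hAc hc ha hb hal hal1 hah hah1 hsg hsg1 hG hS
  rcases lt_trichotomy S Sstar with h | rfl | h
  · refine le_limsup_of_tendsto_le hC tendsto_const_nhds ?_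
    filter_upwards [Ioo_mem_nhdsGT (sub_pos.2 h)] with ε hε
    obtain ⟨hε0, hε1⟩ := hε
    have := (baseline_concave hp hAc hc hal hal1 hah hah1 hF).deriv_le_quotient hdiff hS.le
      (y := S + ε) (by linarith) (by linarith)
    rw [add_sub_cancel_left] at this
    rwa [hbelow S hS.le h.le, hbelow (S + ε) (by linarith) (by linarith)]
  · refine le_limsup_of_tendsto_le hC (tendsto_right_quotient hdiff) ?_
    filter_upwards [self_mem_nhdsWithin] with ε hε
    simp only [Set.mem_Ioi] at hε
    have := habove (S + ε) (by linarith)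
    rw [hbelow S hS.le le_rfl]
    gcongr
  have hopt : ∀ R : ℝ, Sstar < R → ∃ K N H : ℝ, 0 ≤ K ∧ 0 ≤ N ∧ 0 < H ∧ p * K + N + H = R ∧
      G R = sectorOutput Ac a b xbar al sg K N + w * Ah * H ^ ah ∧ xbar ≤ b * N ^ sg := by
    intro R hR
    have hR0 := hSstar.trans hR
    obtain ⟨K, N, H, hK, hN, hH, hbud, hval⟩ :=
      (adoption_max hp hc hal hah hsg hR0.le (hG R)).1
    refine ⟨K, N, H, hK, hN, home_pos hp hAc hc ha hb hal hal1 hah hah1 hsg hsg1 hG hR0 hK hN hH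
      hbud hval, hbud, hval, ?_⟩
    by_contra! hlt
    have h1 := habove R hR
    have h2 := (baseline_max hp hal hah hR0.le (hF R)).2 K H hK hH (by linarith)
    rw [hval, sectorOutput, max_eq_right (by linarith), mul_zero, add_zero] at h1
    linarith
  obtain ⟨K, N, H, hK, hN, hH, hbud, hval, hadopt⟩ := hopt S h
  have hder : HasDerivAt (fun x : ℝ => w * Ah * x ^ ah) (w * Ah * (ah * H ^ (ah - 1))) H :=
    (Real.hasDerivAt_rpow_const (Or.inl hH.ne')).const_mul _
  have hmarg : F'Sstar ≤ w * Ah * (ah * H ^ (ah - 1)) := by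
    refine le_of_tendsto_of_tendsto (tendsto_right_quotient hdiff) (tendsto_left_quotient hder) ?_
    filter_upwards [Ioo_mem_nhdsGT (sub_pos.2 h), Ioo_mem_nhdsGT hH] with ε hε hε'
    obtain ⟨hε0, hε1⟩ := hε
    obtain ⟨-, hεH⟩ := hε'
    have hlt : Sstar < Sstar + ε := by linarith
    obtain ⟨K₁, N₁, H₁, hK₁, hN₁, hH₁, hbud₁, hval₁, hadopt₁⟩ := hopt (Sstar + ε) hlt
    have hanti : H ≤ H₁ := home_antitone hp hc ha hb hxbar hal hal1 hah hah1 hsg hax hrs hG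
      (by linarith) (by linarith) hK₁ hN₁ hH₁ hbud₁ hval₁ hadopt₁ hK hN hH hbud hval hadopt
    have hle := (adoption_max hp hc hal hah hsg hSstar.le (hG Sstar)).2 K₁ N₁ (H₁ - ε) hK₁ hN₁
      (by linarith) (by linarith)
    have habv := habove _ hlt
    have hdim : w * Ah * (H - ε) ^ ah + w * Ah * H₁ ^ ah
        ≤ w * Ah * H ^ ah + w * Ah * (H₁ - ε) ^ ah := by
      rcases hanti.lt_or_eq with hlt' | rfl
      · have := rpow_add_rpow_lt (x := H - ε) (y := H₁) hc hah hah1 (by linarith) hε0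
          (by linarith)
        rw [sub_add_cancel] at this
        exact this.le
      · linarith
    rw [hbelow Sstar hSstar.le le_rfl] at hle
    show (F (Sstar + ε) - F Sstar) / ε ≤ (w * Ah * H ^ ah - w * Ah * (H - ε) ^ ah) / ε
    gcongr ?_ / ε
    linarith
  refine hmarg.trans (le_limsup_of_tendsto_le hC (tendsto_right_quotient hder) ?_)
  filter_upwards [self_mem_nhdsWithin] with ε hε
  simp only [Set.mem_Ioi] at hε
  have := (adoption_max hp hc hal hah hsg (by linarith) (hG (S + ε))).2 K N (H + ε) hK hN
    (by linarith) (by linarith)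
  gcongr ?_ / ε
  linarith
end

section
/- With all other parameters fixed: (i) the map a ↦ Γ(a,b,x̄) is strictly increasing on (0,∞) and Γ(a,b,x̄) → ∞ as a → ∞; (ii) if in addition α_h + 1/α ≥ 2, then the map b ↦ Γ(a,b,x̄) is strictly increasing on (0,∞) and Γ(a,b,x̄) → ∞ as b → ∞. -/
open Filter Topology Set

/-- Absorbing the power `t ^ s` of the numerator into the denominator. -/
lemma mul_rpow_div_add_mul_rpow_rpow {K c D s r e t : ℝ} (hc : 0 < c) (hD : 0 < D) (he : 0 < e)
    (ht : 0 < t) :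
    K * t ^ s / (c + D * t ^ r) ^ e = K * (c * t ^ (-(s / e)) + D * t ^ (-(s / e - r))) ^ (-e) := by
  have hfac : c * t ^ (-(s / e)) + D * t ^ (-(s / e - r)) = (c + D * t ^ r) * t ^ (-(s / e)) := by
    rw [show -(s / e - r) = r + -(s / e) by ring, Real.rpow_add ht]
    ring
  have hexp : -(s / e) * -e = s := by field_simp
  rw [hfac, Real.mul_rpow (by positivity) (by positivity), ← Real.rpow_mul ht.le, hexp,
    Real.rpow_neg (by positivity)]
  ring

/-- If `0 < s` and `e * r < s`, then `t ↦ K * t ^ s / (c + D * t ^ r) ^ e` is strictly increasing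
on the positive half-line and unbounded at infinity. -/
lemma strictMonoOn_and_tendsto_mul_rpow_div {f : ℝ → ℝ} {K c D s r e : ℝ} (hK : 0 < K)
    (hc : 0 < c) (hD : 0 < D) (he : 0 < e) (hs : 0 < s) (hr : e * r < s)
    (hf : ∀ t, 0 < t → f t = K * t ^ s / (c + D * t ^ r) ^ e) :
    StrictMonoOn f (Ioi 0) ∧ Tendsto f atTop atTop := by
  have hu : 0 < s / e := div_pos hs he
  have hv : 0 < s / e - r := by
    rw [sub_pos, lt_div_iff₀ he]
    linarith
  replace hf : ∀ t, 0 < t → f t = K * (c * t ^ (-(s / e)) + D * t ^ (-(s / e - r))) ^ (-e) :=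
    fun t ht => (hf t ht).trans (mul_rpow_div_add_mul_rpow_rpow hc hD he ht)
  constructor
  · intro x hx y hy hxy
    rw [mem_Ioi] at hx hy
    rw [hf x hx, hf y hy]
    have hxy_u := Real.rpow_lt_rpow_of_neg hx hxy (neg_lt_zero.mpr hu)
    have hxy_v := Real.rpow_lt_rpow_of_neg hx hxy (neg_lt_zero.mpr hv)
    refine mul_lt_mul_of_pos_left (Real.rpow_lt_rpow_of_neg (by positivity) ?_ (by linarith)) hK
    gcongr
  · have hzero : Tendsto (fun t : ℝ => c * t ^ (-(s / e)) + D * t ^ (-(s / e - r))) atTop (𝓝 0) := by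
      simpa using ((tendsto_rpow_neg_atTop hu).const_mul c).add
        ((tendsto_rpow_neg_atTop hv).const_mul D)
    have hpos : Tendsto (fun t : ℝ => c * t ^ (-(s / e)) + D * t ^ (-(s / e - r))) atTop
        (𝓝[>] 0) := by
      refine tendsto_nhdsWithin_iff.mpr ⟨hzero, ?_⟩
      filter_upwards [eventually_gt_atTop 0] with t ht
      rw [mem_Ioi]
      positivity
    have hlim := ((tendsto_rpow_neg_nhdsGT_zero (neg_lt_zero.mpr he)).comp hpos).const_mul_atTop hK
    refine hlim.congr' ?_
    filter_upwards [eventually_gt_atTop 0] with t ht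
    exact (hf t ht).symm

/-- The exponent inequality behind the monotonicity in `b`. -/
lemma mul_sub_lt_of_two_le_add_inv {x y : ℝ} (hx : 0 < x) (hx1 : x < 1) (hy1 : y < 1)
    (h : 2 ≤ y + 1 / x) : x * (x - y) < (1 - x) * (1 - y) := by
  have h' : 2 * x ≤ x * y + 1 := by
    have hmul := mul_le_mul_of_nonneg_left h hx.le
    rw [mul_add, mul_one_div_cancel hx.ne'] at hmul
    linarith
  rcases le_total x (1 / 2) with hle | hge
  · nlinarith [mul_nonneg (sub_nonneg.mpr hle) (sub_nonneg.mpr hy1.le), mul_pos hx (sub_pos.mpr hx1)]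
  · have hcube : 0 < (1 - x) ^ 3 := pow_pos (sub_pos.mpr hx1) 3
    refine lt_of_mul_lt_mul_left ?_ hx.le
    nlinarith [mul_nonneg (sub_nonneg.mpr hge) (sub_nonneg.mpr h')]

/-- (i) a ↦ Γ(a,b,x̄) is strictly increasing on (0,∞) and tends
to ∞ as a → ∞; (ii) if α_h + 1/α ≥ 2, then b ↦ Γ(a,b,x̄) is strictly increasing
on (0,∞) and tends to ∞ as b → ∞. -/
theorem stmt16 (p Ac w Ah xbar al ah sg : ℝ)
    (hp : 0 < p) (hAc : 0 < Ac) (hw : 0 < w) (hAh : 0 < Ah) (hxbar : 0 < xbar)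
    (hal : 0 < al) (hal1 : al < 1) (hah : 0 < ah) (hah1 : ah < 1)
    (hsg : 0 < sg) (hsg1 : sg < 1)
    (Γ : ℝ → ℝ → ℝ)
    (hΓ : ∀ a b : ℝ, 0 < a → 0 < b →
      Γ a b = ((al * Ac / (p * sg)) ^ al
          * xbar ^ (-(1 - al) * (1 - sg) / sg) * a ^ (1 - al) * b ^ ((1 - al) / sg))
        / (1 + al / sg
            + (ah * w * Ah * (p * sg) ^ al / (sg * (al * Ac) ^ al)) ^ (1 / (1 - ah))
              * a ^ (-(1 - al) / (1 - ah)) * b ^ (-(ah - al) / (sg * (1 - ah)))) ^ al) :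
    (∀ b : ℝ, 0 < b →
      StrictMonoOn (fun a => Γ a b) (Set.Ioi 0) ∧
      Filter.Tendsto (fun a => Γ a b) Filter.atTop Filter.atTop) ∧
    (ah + 1 / al ≥ 2 → ∀ a : ℝ, 0 < a →
      StrictMonoOn (fun b => Γ a b) (Set.Ioi 0) ∧
      Filter.Tendsto (fun b => Γ a b) Filter.atTop Filter.atTop) := by
  have hal' : 0 < 1 - al := sub_pos.mpr hal1
  have hah' : 0 < 1 - ah := sub_pos.mpr hah1
  have hc : 0 < 1 + al / sg := by positivity
  set P := (al * Ac / (p * sg)) ^ al * xbar ^ (-(1 - al) * (1 - sg) / sg)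
  set Q := (ah * w * Ah * (p * sg) ^ al / (sg * (al * Ac) ^ al)) ^ (1 / (1 - ah))
  have hPpos : 0 < P := by positivity
  have hQpos : 0 < Q := by positivity
  refine ⟨fun b hb => ?_, fun h a ha => ?_⟩
  · refine strictMonoOn_and_tendsto_mul_rpow_div (K := P * b ^ ((1 - al) / sg))
      (c := 1 + al / sg) (D := Q * b ^ (-(ah - al) / (sg * (1 - ah)))) (s := 1 - al)
      (r := -(1 - al) / (1 - ah)) (e := al) (by positivity) hc (by positivity) hal hal' ?_ ?_
    · have hneg : -(1 - al) / (1 - ah) < 0 := div_neg_of_neg_of_pos (by linarith) hah'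
      exact (mul_neg_of_pos_of_neg hal hneg).trans hal'
    · intro a ha
      rw [hΓ a b ha hb, mul_right_comm P, mul_right_comm Q]
  · refine strictMonoOn_and_tendsto_mul_rpow_div (K := P * a ^ (1 - al))
      (c := 1 + al / sg) (D := Q * a ^ (-(1 - al) / (1 - ah))) (s := (1 - al) / sg)
      (r := -(ah - al) / (sg * (1 - ah))) (e := al) (by positivity) hc (by positivity) hal
      (by positivity) ?_ (fun b hb => hΓ a b ha hb)
    have hexp := mul_sub_lt_of_two_le_add_inv hal hal1 hah1 h
    rw [neg_sub, ← mul_div_assoc, div_lt_div_iff₀ (by positivity) hsg]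
    linarith [mul_lt_mul_of_pos_right hexp hsg]
end

section
/- Assume α + σ ≥ 1 and a·x̄ > A_c, and for each b > 0 let S*(b) > 0 be the unique threshold such that G_b(S) = F(S) for all 0 ≤ S ≤ S*(b) and G_b(S) > F(S) for all S > S*(b), where G_b denotes the function G with research-efficiency parameter b. Then S*(b) → 0 as b → ∞; that is, for every ε > 0 there exists B > 0 such that S*(b) < ε for all b > B. -/
/-- Under α + σ ≥ 1 and a·x̄ > A_c, the threshold S*(b) (where
G_b switches from F) tends to 0 as the research efficiency b tends to ∞. -/
theorem stmt17 (p Ac w Ah a xbar al ah sg : ℝ)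
    (hp : 0 < p) (hAc : 0 < Ac) (hw : 0 < w) (hAh : 0 < Ah)
    (ha : 0 < a) (hxbar : 0 < xbar)
    (hal : 0 < al) (hal1 : al < 1) (hah : 0 < ah) (hah1 : ah < 1)
    (hsg : 0 < sg) (hsg1 : sg < 1)
    (hrs : 1 ≤ al + sg) (hax : a * xbar > Ac)
    (F : ℝ → ℝ)
    (hF : ∀ S : ℝ, F S = sSup {y : ℝ | ∃ K H : ℝ,
      0 ≤ K ∧ 0 ≤ H ∧ p * K + H ≤ S ∧ y = Ac * K ^ al + w * Ah * H ^ ah})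
    (G : ℝ → ℝ → ℝ)
    (hG : ∀ b S : ℝ, 0 < b → G b S = sSup {y : ℝ | ∃ K N H : ℝ,
      0 ≤ K ∧ 0 ≤ N ∧ 0 ≤ H ∧ p * K + N + H ≤ S ∧
      y = (Ac + a * max (b * N ^ sg - xbar) 0) * K ^ al + w * Ah * H ^ ah})
    (Sstar : ℝ → ℝ)
    (hSstar : ∀ b : ℝ, 0 < b → 0 < Sstar b ∧
      (∀ S : ℝ, 0 ≤ S → S ≤ Sstar b → G b S = F S) ∧
      (∀ S : ℝ, Sstar b < S → G b S > F S)) :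
    ∀ ε : ℝ, 0 < ε → ∃ B : ℝ, 0 < B ∧ ∀ b : ℝ, B < b → Sstar b < ε := by
  intro ε hε
  set M := Ac * (ε / p) ^ al + w * Ah * ε ^ ah with hM
  have hM0 : 0 ≤ M := by positivity
  have hc : 0 < (ε / 2) ^ sg := by positivity
  have hd : 0 < (ε / (2 * p)) ^ al := by positivity
  refine ⟨(M / (a * (ε / (2 * p)) ^ al) + xbar) / (ε / 2) ^ sg, by positivity, fun b hB => ?_⟩
  have hb : 0 < b := lt_of_le_of_lt (by positivity) hB
  by_contra! hle
  have hGF : G b ε = F ε := (hSstar b hb).2.1 ε hε.le hle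
  have hFM : F ε ≤ M := by
    rw [hF]
    refine Real.sSup_le ?_ hM0
    rintro y ⟨K, H, hK, hH, hKH, rfl⟩
    have hpK : 0 ≤ p * K := by positivity
    have hK' : K ≤ ε / p := by
      rw [le_div_iff₀ hp]
      linarith
    have hH' : H ≤ ε := by linarith
    rw [hM]
    gcongr
  have hbdd : BddAbove {y : ℝ | ∃ K N H : ℝ,
      0 ≤ K ∧ 0 ≤ N ∧ 0 ≤ H ∧ p * K + N + H ≤ ε ∧
      y = (Ac + a * max (b * N ^ sg - xbar) 0) * K ^ al + w * Ah * H ^ ah} := by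
    refine ⟨(Ac + a * max (b * ε ^ sg - xbar) 0) * (ε / p) ^ al + w * Ah * ε ^ ah, ?_⟩
    rintro y ⟨K, N, H, hK, hN, hH, hKNH, rfl⟩
    have hpK : 0 ≤ p * K := by positivity
    have hK' : K ≤ ε / p := by
      rw [le_div_iff₀ hp]
      linarith
    have hN' : N ≤ ε := by linarith
    have hH' : H ≤ ε := by linarith
    gcongr
  -- Splitting the budget evenly between capital and research bounds `G b ε` from below.
  have hG_lower : (Ac + a * max (b * (ε / 2) ^ sg - xbar) 0) * (ε / (2 * p)) ^ al
      + w * Ah * (0 : ℝ) ^ ah ≤ G b ε := by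
    rw [hG b ε hb]
    refine le_csSup hbdd ⟨ε / (2 * p), ε / 2, 0, by positivity, by positivity, le_rfl, ?_, rfl⟩
    apply le_of_eq
    field_simp
    ring
  rw [Real.zero_rpow hah.ne', mul_zero, add_zero] at hG_lower
  rw [div_lt_iff₀ hc] at hB
  have hgain : M < (b * (ε / 2) ^ sg - xbar) * (a * (ε / (2 * p)) ^ al) := by
    rw [← div_lt_iff₀ (by positivity)]
    linarith
  have hmax : (b * (ε / 2) ^ sg - xbar) * (a * (ε / (2 * p)) ^ al)
      ≤ max (b * (ε / 2) ^ sg - xbar) 0 * (a * (ε / (2 * p)) ^ al) := by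
    gcongr
    exact le_max_left _ _
  have hAcd : 0 < Ac * (ε / (2 * p)) ^ al := by positivity
  linarith
end

section
/- Assume α + σ < 1. Then: (i) for every S ≥ 0, G(S) ≤ C·max(1, S^m), where C := (A_c + a·b)/p^α + w·A_h and m := max(α+σ, α_h) < 1; (ii) every sequence (S_t)_{t≥0} of nonnegative reals satisfying S_{t+1} ≤ G(S_t) for all t is bounded above. -/
/-- A power `x ^ e` with `0 ≤ x ≤ S` and `0 ≤ e ≤ m` is at most `max 1 (S ^ m)`. -/
theorem rpow_le_max_one_rpow {x S e m : ℝ} (hx : 0 ≤ x) (hxS : x ≤ S) (he : 0 ≤ e)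
    (hem : e ≤ m) : x ^ e ≤ max 1 (S ^ m) := by
  rcases le_total S 1 with h | h
  · exact le_max_of_le_left (Real.rpow_le_one hx (hxS.trans h) he)
  · exact le_max_of_le_right
      ((Real.rpow_le_rpow hx hxS he).trans (Real.rpow_le_rpow_of_exponent_le h hem))

/-- The output of any feasible allocation of resources `S` grows at most like `S ^ m`. -/
theorem output_le_mul_max_one_rpow {p Ac w Ah a b xbar al ah sg S K N H : ℝ}
    (hp : 0 < p) (hAc : 0 ≤ Ac) (hw : 0 ≤ w) (hAh : 0 ≤ Ah) (ha : 0 ≤ a) (hb : 0 ≤ b)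
    (hxbar : 0 ≤ xbar) (hal : 0 ≤ al) (hah : 0 ≤ ah) (hsg : 0 ≤ sg)
    (hK : 0 ≤ K) (hN : 0 ≤ N) (hH : 0 ≤ H) (hS : p * K + N + H ≤ S) :
    (Ac + a * max (b * N ^ sg - xbar) 0) * K ^ al + w * Ah * H ^ ah ≤
      ((Ac + a * b) / p ^ al + w * Ah) * max 1 (S ^ max (al + sg) ah) := by
  have hpK : 0 ≤ p * K := mul_nonneg hp.le hK
  have hS0 : 0 ≤ S := by linarith
  set M := max 1 (S ^ max (al + sg) ah)
  have hH' : H ^ ah ≤ M := rpow_le_max_one_rpow hH (by linarith) hah (le_max_right _ _)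
  have hSal : S ^ al ≤ M :=
    rpow_le_max_one_rpow hS0 le_rfl hal (le_max_of_le_left (by linarith))
  have hSsum : S ^ sg * S ^ al ≤ M := by
    rw [← Real.rpow_add_of_nonneg hS0 hsg hal, add_comm sg]
    exact rpow_le_max_one_rpow hS0 le_rfl (by linarith) (le_max_left _ _)
  have hpal : 0 < p ^ al := Real.rpow_pos_of_pos hp al
  have hKal : K ^ al ≤ S ^ al / p ^ al := by
    rw [le_div_iff₀ hpal, mul_comm, ← Real.mul_rpow hp.le hK]
    exact Real.rpow_le_rpow hpK (by linarith) hal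
  have hmax : max (b * N ^ sg - xbar) 0 ≤ b * S ^ sg := by
    have hNS : b * N ^ sg ≤ b * S ^ sg :=
      mul_le_mul_of_nonneg_left (Real.rpow_le_rpow hN (by linarith) hsg) hb
    exact max_le (by linarith) (by positivity)
  have hgoods : (Ac + a * max (b * N ^ sg - xbar) 0) * K ^ al ≤ (Ac + a * b) / p ^ al * M :=
    calc
      _ ≤ (Ac + a * (b * S ^ sg)) * (S ^ al / p ^ al) := by gcongr
      _ = (Ac * S ^ al + a * b * (S ^ sg * S ^ al)) / p ^ al := by ring
      _ ≤ (Ac * M + a * b * M) / p ^ al := by gcongr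
      _ = (Ac + a * b) / p ^ al * M := by ring
  have hhome : w * Ah * H ^ ah ≤ w * Ah * M := by gcongr
  linarith

/-- A nonnegative sequence with `u (t + 1) ≤ C * max 1 (u t ^ m)` and `m < 1` is bounded. -/
theorem exists_bound_of_le_mul_max_one_rpow {C m : ℝ} (hC : 0 ≤ C) (hm : 0 ≤ m) (hm1 : m < 1)
    {u : ℕ → ℝ} (hu : ∀ t, 0 ≤ u t) (hstep : ∀ t, u (t + 1) ≤ C * max 1 (u t ^ m)) :
    ∃ B : ℝ, ∀ t, u t ≤ B := by
  set B := max (u 0) (max 1 (C ^ (1 - m)⁻¹))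
  have hB1 : 1 ≤ B := (le_max_left _ _).trans (le_max_right _ _)
  have hB0 : 0 < B := by linarith
  have hCB : C ≤ B ^ (1 - m) := by
    rw [← Real.rpow_inv_le_iff_of_pos hC hB0.le (by linarith)]
    exact (le_max_right _ _).trans (le_max_right _ _)
  refine ⟨B, fun t => ?_⟩
  induction t with
  | zero => exact le_max_left _ _
  | succ t ih =>
    calc
      u (t + 1) ≤ C * max 1 (u t ^ m) := hstep t
      _ ≤ B ^ (1 - m) * B ^ m := by
        gcongr
        exact max_le (Real.one_le_rpow hB1 hm) (Real.rpow_le_rpow (hu t) ih hm)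
      _ = B := by rw [← Real.rpow_add hB0, sub_add_cancel, Real.rpow_one]

/-- If α + σ < 1, then (i) G(S) ≤ C·max(1, S^m) for all S ≥ 0
with C = (A_c + a·b)/p^α + w·A_h and m = max(α+σ, α_h) < 1; and (ii) every
nonnegative sequence with S_{t+1} ≤ G(S_t) is bounded above. -/
theorem stmt18 (p Ac w Ah a b xbar al ah sg : ℝ)
    (hp : 0 < p) (hAc : 0 < Ac) (hw : 0 < w) (hAh : 0 < Ah)
    (ha : 0 < a) (hb : 0 < b) (hxbar : 0 < xbar)
    (hal : 0 < al) (hal1 : al < 1) (hah : 0 < ah) (hah1 : ah < 1)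
    (hsg : 0 < sg) (hsg1 : sg < 1)
    (hdrs : al + sg < 1)
    (G : ℝ → ℝ)
    (hG : ∀ S : ℝ, G S = sSup {y : ℝ | ∃ K N H : ℝ,
      0 ≤ K ∧ 0 ≤ N ∧ 0 ≤ H ∧ p * K + N + H ≤ S ∧
      y = (Ac + a * max (b * N ^ sg - xbar) 0) * K ^ al + w * Ah * H ^ ah}) :
    max (al + sg) ah < 1 ∧
    (∀ S : ℝ, 0 ≤ S →
      G S ≤ ((Ac + a * b) / p ^ al + w * Ah) * max 1 (S ^ max (al + sg) ah)) ∧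
    (∀ Sseq : ℕ → ℝ, (∀ t, 0 ≤ Sseq t) → (∀ t, Sseq (t + 1) ≤ G (Sseq t)) →
      ∃ B : ℝ, ∀ t, Sseq t ≤ B) := by
  have hbound : ∀ S : ℝ, 0 ≤ S →
      G S ≤ ((Ac + a * b) / p ^ al + w * Ah) * max 1 (S ^ max (al + sg) ah) := by
    intro S hS
    rw [hG S]
    refine csSup_le ⟨_, 0, 0, 0, le_rfl, le_rfl, le_rfl, by simpa using hS, rfl⟩ ?_
    rintro y ⟨K, N, H, hK, hN, hH, hKNH, rfl⟩
    exact output_le_mul_max_one_rpow hp hAc.le hw.le hAh.le ha.le hb.le hxbar.le hal.le hah.le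
      hsg.le hK hN hH hKNH
  have hm1 : max (al + sg) ah < 1 := max_lt hdrs hah1
  refine ⟨hm1, hbound, fun u hu hstep => ?_⟩
  exact exists_bound_of_le_mul_max_one_rpow (by positivity) (le_max_of_le_right hah.le) hm1 hu
    fun t => (hstep t).trans (hbound _ (hu t))
end

section
/- Suppose F is differentiable on (0,∞). Then: (i) F'(S) > α·A_c·S^{α−1}/p^α for every S > 0; (ii) for any β ∈ (0,1), if S_b > 0 satisfies β·F'(S_b) = 1 and S_a := (α·β·A_c/p^α)^{1/(1−α)} (the steady state of the economy without FDI, i.e. the unique solution of β·α·A_c·S_a^{α−1}/p^α = 1), then S_b > S_a. -/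
open Filter Topology in
/-- A function with a lower bound `F S + c * t ^ a`, `a < 1`, to the right of `S` has infinite slope
there. -/
theorem not_hasDerivAt_of_rpow_le {F : ℝ → ℝ} {S d c a : ℝ} (hc : 0 < c) (ha : a < 1)
    (h : ∀ t, 0 < t → F S + c * t ^ a ≤ F (S + t)) : ¬ HasDerivAt F d S := by
  intro hd
  have h1 := hd.tendsto_slope_zero_right
  have h2 : Tendsto (fun t : ℝ => c * t ^ (a - 1)) (𝓝[>] 0) atTop :=
    (tendsto_rpow_neg_nhdsGT_zero (by linarith)).const_mul_atTop hc
  refine not_tendsto_nhds_of_tendsto_atTop (tendsto_atTop_mono' _ ?_ h2) d h1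
  filter_upwards [self_mem_nhdsWithin] with t ht
  have ht : 0 < t := ht
  rw [smul_eq_mul, Real.rpow_sub_one ht.ne', ← mul_div_assoc, inv_mul_eq_div]
  gcongr
  linarith [h t ht]

/-- The set of output values attainable from a budget `S` has a greatest element. -/
theorem exists_isGreatest_output {p al ah : ℝ} (Ac B : ℝ) (hp : 0 < p) (hal : 0 < al)
    (hah : 0 < ah) {S : ℝ} (hS : 0 ≤ S) :
    ∃ y, IsGreatest {y : ℝ | ∃ K H : ℝ,
      0 ≤ K ∧ 0 ≤ H ∧ p * K + H ≤ S ∧ y = Ac * K ^ al + B * H ^ ah} y := by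
  let C : Set (ℝ × ℝ) := {x | 0 ≤ x.1 ∧ 0 ≤ x.2 ∧ p * x.1 + x.2 ≤ S}
  have hclosed : IsClosed C := by
    have hK : IsClosed {x : ℝ × ℝ | 0 ≤ x.1} := isClosed_le continuous_const continuous_fst
    have hH : IsClosed {x : ℝ × ℝ | 0 ≤ x.2} := isClosed_le continuous_const continuous_snd
    have hb : IsClosed {x : ℝ × ℝ | p * x.1 + x.2 ≤ S} := isClosed_le (by fun_prop) (by fun_prop)
    exact hK.inter (hH.inter hb)
  have hC : IsCompact C := by
    refine (isCompact_Icc (a := ((0, 0) : ℝ × ℝ)) (b := (S / p, S))).of_isClosed_subset hclosed ?_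
    rintro ⟨K, H⟩ ⟨hK, hH, hb⟩
    dsimp only at hK hH hb
    refine ⟨⟨hK, hH⟩, ?_, ?_⟩
    · change K ≤ S / p
      rw [le_div_iff₀ hp]
      linarith
    · change H ≤ S
      nlinarith
  have hcont : ContinuousOn (fun x : ℝ × ℝ => Ac * x.1 ^ al + B * x.2 ^ ah) C :=
    ((continuous_const.mul (continuous_fst.rpow_const fun _ => Or.inr hal.le)).add
      (continuous_const.mul (continuous_snd.rpow_const fun _ => Or.inr hah.le))).continuousOn
  obtain ⟨⟨K, H⟩, ⟨hK, hH, hb⟩, hmax⟩ :=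
    hC.exists_isMaxOn ⟨(0, 0), le_rfl, le_rfl, by simpa using hS⟩ hcont
  refine ⟨_, ⟨K, H, hK, hH, hb, rfl⟩, ?_⟩
  rintro _ ⟨K', H', hK', hH', hb', rfl⟩
  exact hmax (show (K', H') ∈ C from ⟨hK', hH', hb'⟩)

/-- The marginal value of the budget strictly exceeds its value when it is all spent on `K`. -/
theorem lt_deriv_of_isGreatest_output {p Ac B al ah : ℝ} (hp : 0 < p) (hAc : 0 < Ac) (hB : 0 < B)
    (hal : 0 < al) (hal1 : al < 1) (hah : 0 < ah) (hah1 : ah < 1) {F : ℝ → ℝ}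
    (hF : ∀ S, 0 ≤ S → IsGreatest {y : ℝ | ∃ K H : ℝ,
      0 ≤ K ∧ 0 ≤ H ∧ p * K + H ≤ S ∧ y = Ac * K ^ al + B * H ^ ah} (F S))
    {S d : ℝ} (hS : 0 < S) (hd : HasDerivAt F d S) :
    al * Ac * S ^ (al - 1) / p ^ al < d := by
  obtain ⟨K, H, hK, hH, hb, hFS⟩ := (hF S hS.le).1
  have hlow : ∀ t K' H', 0 ≤ K' → 0 ≤ H' → p * K' + H' ≤ t →
      Ac * K' ^ al + B * H' ^ ah ≤ F t := fun t K' H' h1 h2 h3 =>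
    (hF t (by nlinarith [mul_nonneg hp.le h1])).2 ⟨K', H', h1, h2, h3, rfl⟩
  have hHpos : 0 < H := by
    refine hH.lt_of_ne' fun h0 => not_hasDerivAt_of_rpow_le hB hah1 (fun t ht => ?_) hd
    subst h0
    rw [Real.zero_rpow hah.ne'] at hFS
    linarith [hlow (S + t) K t hK ht.le (by linarith)]
  have hKpos : 0 < K := by
    refine hK.lt_of_ne' fun h0 => not_hasDerivAt_of_rpow_le (c := Ac / p ^ al)
      (div_pos hAc (Real.rpow_pos_of_pos hp _)) hal1 (fun t ht => ?_) hd
    subst h0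
    rw [Real.zero_rpow hal.ne'] at hFS
    have h := hlow (S + t) (t / p) H (by positivity) hH
      (by rw [mul_div_cancel₀ _ hp.ne']; linarith)
    rw [Real.div_rpow ht.le hp.le, ← mul_div_assoc, mul_div_right_comm] at h
    linarith
  have hf : HasDerivAt (fun t => Ac * (K + (t - S) / p) ^ al + B * H ^ ah)
      (Ac * (1 / p * al * K ^ (al - 1))) S := by
    have h1 : HasDerivAt (fun t => K + (t - S) / p) (1 / p) S :=
      (((hasDerivAt_id S).sub_const S).div_const p).const_add K
    have h2 := h1.rpow_const (p := al) (Or.inl (by simpa using hKpos.ne'))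
    simpa using (h2.const_mul Ac).add_const (B * H ^ ah)
  have hmin : IsLocalMin (fun t => F t - (Ac * (K + (t - S) / p) ^ al + B * H ^ ah)) S := by
    have hcont : Continuous fun t => K + (t - S) / p := by fun_prop
    have hpos : ∀ᶠ t in nhds S, 0 < K + (t - S) / p :=
      hcont.continuousAt.eventually (lt_mem_nhds (by simpa using hKpos))
    filter_upwards [hpos] with t ht
    have h := hlow t _ H ht.le hH (by rw [mul_add, mul_div_cancel₀ _ hp.ne']; linarith)
    simp only [sub_self, zero_div, add_zero]
    linarith
  have hdeq := hmin.hasDerivAt_eq_zero (hd.sub hf)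
  have hKS : K < S / p := by
    rw [lt_div_iff₀ hp]
    linarith
  have hlt : (S / p) ^ (al - 1) < K ^ (al - 1) :=
    Real.rpow_lt_rpow_of_neg hKpos hKS (by linarith)
  calc al * Ac * S ^ (al - 1) / p ^ al = Ac * (1 / p * al * (S / p) ^ (al - 1)) := by
        rw [Real.div_rpow hS.le hp.le, Real.rpow_sub_one hp.ne']
        field_simp
    _ < Ac * (1 / p * al * K ^ (al - 1)) := by gcongr
    _ = d := by linarith


/-- If F is differentiable on (0,∞), then
(i) F'(S) > α·A_c·S^{α−1}/p^α for every S > 0, and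
(ii) for β ∈ (0,1), if β·F'(S_b) = 1 with S_b > 0, then
S_b > S_a := (α·β·A_c/p^α)^{1/(1−α)}. -/
theorem stmt19 (p Ac w Ah al ah : ℝ)
    (hp : 0 < p) (hAc : 0 < Ac) (hw : 0 < w) (hAh : 0 < Ah)
    (hal : 0 < al) (hal1 : al < 1) (hah : 0 < ah) (hah1 : ah < 1)
    (F : ℝ → ℝ)
    (hF : ∀ S : ℝ, F S = sSup {y : ℝ | ∃ K H : ℝ,
      0 ≤ K ∧ 0 ≤ H ∧ p * K + H ≤ S ∧ y = Ac * K ^ al + w * Ah * H ^ ah})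
    (F' : ℝ → ℝ)
    (hdiff : ∀ S : ℝ, 0 < S → HasDerivAt F (F' S) S) :
    (∀ S : ℝ, 0 < S → F' S > al * Ac * S ^ (al - 1) / p ^ al) ∧
    (∀ β : ℝ, 0 < β → β < 1 →
      ∀ Sb : ℝ, 0 < Sb → β * F' Sb = 1 →
        Sb > (al * β * Ac / p ^ al) ^ (1 / (1 - al))) := by
  have hgr : ∀ S, 0 ≤ S → IsGreatest {y : ℝ | ∃ K H : ℝ,
      0 ≤ K ∧ 0 ≤ H ∧ p * K + H ≤ S ∧ y = Ac * K ^ al + w * Ah * H ^ ah} (F S) := by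
    intro S hS
    obtain ⟨y, hy⟩ := exists_isGreatest_output Ac (w * Ah) hp hal hah hS
    rwa [hF, hy.csSup_eq]
  have hmarg : ∀ S, 0 < S → al * Ac * S ^ (al - 1) / p ^ al < F' S := fun S hS =>
    lt_deriv_of_isGreatest_output hp hAc (mul_pos hw hAh) hal hal1 hah hah1 hgr hS (hdiff S hS)
  refine ⟨hmarg, fun β hβ _ Sb hSb hSb1 => ?_⟩
  have hpow : 0 < Sb ^ (1 - al) := Real.rpow_pos_of_pos hSb _
  have hpp : 0 < p ^ al := Real.rpow_pos_of_pos hp _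
  have h := mul_lt_mul_of_pos_left (hmarg Sb hSb) hβ
  rw [hSb1, ← neg_sub 1 al, Real.rpow_neg hSb.le] at h
  rw [gt_iff_lt, one_div, Real.rpow_inv_lt_iff_of_pos (by positivity) hSb.le (by linarith)]
  calc al * β * Ac / p ^ al
      = β * (al * Ac * (Sb ^ (1 - al))⁻¹ / p ^ al) * Sb ^ (1 - al) := by field_simp
    _ < 1 * Sb ^ (1 - al) := by gcongr
    _ = Sb ^ (1 - al) := one_mul _
end
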